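/- arXiv:2207.10769 — 3 statements merged into one kernel-verified Lean document; each statement's English description precedes it below -/
import Mathlib

section
/- Let γ > 0, T_b ∈ [0, γ], and let ψ_b : (0,1] → ℝ be measurable with 0 ≤ ψ_b(μ) ≤ γ⁴ for all μ ∈ (0,1]. Then there exist a twice continuously differentiable function T : [0,∞) → ℝ and a function ψ : [0,∞)×[-1,1] → ℝ such that: (i) 0 ≤ T(x) ≤ γ and 0 ≤ ψ(x,μ) ≤ γ⁴ for all x ≥ 0, μ ∈ [-1,1]; (ii) T(0) = T_b; (iii) for every μ ∈ (0,1] and x ≥ 0, ψ(x,μ) = ψ_b(μ) e^{-x/μ} + ∫₀ˣ μ⁻¹ e^{-(x-s)/μ} T(s)⁴ ds, and for every μ ∈ [-1,0) and x ≥ 0, ψ(x,μ) = −∫ₓ^∞ μ⁻¹ e^{-(x-s)/μ} T(s)⁴ ds (consequently μ ∂_x ψ(x,μ) + ψ(x,μ) − T(x)⁴ = 0 for every x ≥ 0 and μ ≠ 0, and ψ(0,μ) = ψ_b(μ) for μ > 0); (iv) T''(x) + ∫_{-1}^{1} (ψ(x,μ) − T(x)⁴) dμ = 0 for every x ≥ 0;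 (v) for every α ∈ [0,1): ∫₀^∞ e^{2αx} 4 T(x)³ T'(x)² dx + (1−α) ∫₀^∞ ∫_{-1}^{1} e^{2αx} (ψ(x,μ) − T(x)⁴)² dμ dx + (1/2) ∫_{-1}^{0} |μ| (ψ(0,μ) − T_b⁴)² dμ ≤ (1/2) ∫₀¹ μ (ψ_b(μ) − T_b⁴)² dμ. -/
open MeasureTheory Set

/-- The solution at `x` of `μ u' + u = B` on the half-line with incoming value `b`,
written along the characteristic through `x`. -/
noncomputable def transport (b : ℝ) (B : ℝ → ℝ) (x μ : ℝ) : ℝ :=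
  ∫ t in Ioi (0:ℝ), Real.exp (-t) * (if 0 ≤ x - μ * t then B (x - μ * t) else b)

section Transport

variable {M b b' : ℝ} {B B' : ℝ → ℝ}

lemma measurable_transport_integrand {β : ℝ → ℝ} (hβ : Measurable β) (hB : Measurable B) :
    Measurable (fun p : (ℝ × ℝ) × ℝ => Real.exp (-p.2) *
      (if 0 ≤ p.1.1 - p.1.2 * p.2 then B (p.1.1 - p.1.2 * p.2) else β p.1.2)) := by
  have h : Measurable (fun p : (ℝ × ℝ) × ℝ => p.1.1 - p.1.2 * p.2) := by fun_prop
  refine Measurable.mul (by fun_prop) (Measurable.ite (measurableSet_le measurable_const h)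
    (hB.comp h) (by fun_prop))

lemma measurable_transport {β : ℝ → ℝ} (hβ : Measurable β) (hB : Measurable B) :
    Measurable (fun p : ℝ × ℝ => transport (β p.2) B p.1 p.2) :=
  (StronglyMeasurable.integral_prod_right
    (f := fun (p : ℝ × ℝ) (t : ℝ) => Real.exp (-t) *
      (if 0 ≤ p.1 - p.2 * t then B (p.1 - p.2 * t) else β p.2))
    (measurable_transport_integrand hβ hB).stronglyMeasurable).measurable

lemma measurable_transport_integrand_right (hB : Measurable B) (b x μ : ℝ) :
    Measurable (fun t : ℝ => Real.exp (-t) *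
      (if 0 ≤ x - μ * t then B (x - μ * t) else b)) :=
  (measurable_transport_integrand (β := fun _ => b) measurable_const hB).comp
    (measurable_const.prodMk measurable_id : Measurable (fun t : ℝ => ((x, μ), t)))

lemma ite_mem_Icc (hb : b ∈ Icc 0 M) (hB' : ∀ y, B y ∈ Icc 0 M) (y : ℝ) :
    (if 0 ≤ y then B y else b) ∈ Icc 0 M := by
  split_ifs
  exacts [hB' y, hb]

lemma integrable_transport (hb : b ∈ Icc 0 M) (hB : Measurable B) (hB' : ∀ y, B y ∈ Icc 0 M)
    (x μ : ℝ) :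
    IntegrableOn (fun t : ℝ => Real.exp (-t) *
      (if 0 ≤ x - μ * t then B (x - μ * t) else b)) (Ioi 0) := by
  refine Integrable.mono' ((integrableOn_exp_neg_Ioi 0).mul_const M)
    (measurable_transport_integrand_right hB b x μ).aestronglyMeasurable
    (Filter.Eventually.of_forall fun t => ?_)
  have h := ite_mem_Icc hb hB' (x - μ * t)
  rw [norm_mul, Real.norm_eq_abs, Real.abs_exp, Real.norm_eq_abs, abs_of_nonneg h.1]
  exact mul_le_mul_of_nonneg_left h.2 (Real.exp_pos _).le

lemma transport_mono (hb : b ∈ Icc 0 M) (hB : Measurable B) (hBM : ∀ y, B y ∈ Icc 0 M)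
    (hB' : Measurable B') (hBM' : ∀ y, B' y ∈ Icc 0 M) (h : ∀ y, B y ≤ B' y) (x μ : ℝ) :
    transport b B x μ ≤ transport b B' x μ := by
  refine integral_mono (integrable_transport hb hB hBM x μ)
    (integrable_transport hb hB' hBM' x μ) fun t => ?_
  refine mul_le_mul_of_nonneg_left ?_ (Real.exp_pos _).le
  split_ifs
  exacts [h _, le_rfl]

lemma transport_mem_Icc (hb : b ∈ Icc 0 M) (hB : Measurable B) (hBM : ∀ y, B y ∈ Icc 0 M)
    (x μ : ℝ) : transport b B x μ ∈ Icc 0 M := by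
  constructor
  · exact integral_nonneg fun t => mul_nonneg (Real.exp_pos _).le (ite_mem_Icc hb hBM _).1
  · calc transport b B x μ ≤ ∫ t in Ioi (0:ℝ), Real.exp (-t) * M :=
          integral_mono (integrable_transport hb hB hBM x μ)
            ((integrableOn_exp_neg_Ioi 0).mul_const M) fun t =>
            mul_le_mul_of_nonneg_left (ite_mem_Icc hb hBM _).2 (Real.exp_pos _).le
      _ = M := by rw [integral_mul_const, integral_exp_neg_Ioi_zero, one_mul]

lemma tendsto_transport {Bn : ℕ → ℝ → ℝ} (hb : b ∈ Icc 0 M) (hBn : ∀ n, Measurable (Bn n))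
    (hBM : ∀ n y, Bn n y ∈ Icc 0 M)
    (h : ∀ y, Filter.Tendsto (fun n => Bn n y) Filter.atTop (nhds (B y))) (x μ : ℝ) :
    Filter.Tendsto (fun n => transport b (Bn n) x μ) Filter.atTop
      (nhds (transport b B x μ)) := by
  refine tendsto_integral_of_dominated_convergence (fun t => Real.exp (-t) * M)
    (fun n => (measurable_transport_integrand_right (hBn n) b x μ).aestronglyMeasurable)
    ((integrableOn_exp_neg_Ioi 0).mul_const M)
    (fun n => Filter.Eventually.of_forall fun t => ?_)
    (Filter.Eventually.of_forall fun t => ?_)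
  · have h := ite_mem_Icc hb (hBM n) (x - μ * t)
    rw [norm_mul, Real.norm_eq_abs, Real.abs_exp, Real.norm_eq_abs, abs_of_nonneg h.1]
    exact mul_le_mul_of_nonneg_left h.2 (Real.exp_pos _).le
  · refine Filter.Tendsto.const_mul _ ?_
    split_ifs
    exacts [h _, tendsto_const_nhds]

lemma transport_of_pos (hb : b ∈ Icc 0 M) (hB : Measurable B) (hBM : ∀ y, B y ∈ Icc 0 M)
    {x μ : ℝ} (hx : 0 ≤ x) (hμ : 0 < μ) :
    transport b B x μ = b * Real.exp (-x / μ)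
      + ∫ s in (0:ℝ)..x, μ⁻¹ * Real.exp (-(x - s) / μ) * B s := by
  have hint := integrable_transport hb hB hBM x μ
  have hxμ : 0 ≤ x / μ := div_nonneg hx hμ.le
  rw [transport, ← Ioc_union_Ioi_eq_Ioi hxμ, setIntegral_union Ioc_disjoint_Ioi_same
    measurableSet_Ioi (hint.mono_set Ioc_subset_Ioi_self)
    (hint.mono_set (Ioi_subset_Ioi hxμ)), add_comm]
  congr 1
  · rw [setIntegral_congr_fun (g := fun t => Real.exp (-t) * b) measurableSet_Ioi]
    · rw [integral_mul_const, integral_exp_neg_Ioi, mul_comm, neg_div]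
    · intro t ht
      have : x < μ * t := by rw [mul_comm]; exact (div_lt_iff₀ hμ).1 ht
      simp only [if_neg (by linarith : ¬ 0 ≤ x - μ * t)]
  · rw [setIntegral_congr_fun (g := fun t =>
      (fun s => Real.exp (-(x - s) / μ) * B s) (x - μ * t)) measurableSet_Ioc]
    · rw [← intervalIntegral.integral_of_le hxμ,
        intervalIntegral.integral_comp_sub_mul (fun s => Real.exp (-(x - s) / μ) * B s) hμ.ne',
        mul_div_cancel₀ _ hμ.ne', sub_self, mul_zero, sub_zero, smul_eq_mul,
        ← intervalIntegral.integral_const_mul]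
      simp only [mul_assoc]
    · intro t ht
      have : μ * t ≤ x := by rw [mul_comm]; exact (le_div_iff₀ hμ).1 ht.2
      simp only [if_pos (by linarith : 0 ≤ x - μ * t)]
      congr 2
      field_simp
      ring

lemma transport_of_neg {x μ : ℝ} (hx : 0 ≤ x) (hμ : μ < 0) :
    transport b B x μ = -∫ s in Ioi x, μ⁻¹ * Real.exp (-(x - s) / μ) * B s := by
  have hμ' : 0 < -μ := neg_pos.2 hμ
  have htr : ∫ s in Ioi x, μ⁻¹ * Real.exp (-(x - s) / μ) * B s =
      ∫ y in Ioi (0:ℝ), μ⁻¹ * Real.exp (-(x - (x + y)) / μ) * B (x + y) := by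
    rw [← (measurePreserving_add_left volume x).setIntegral_preimage_emb
      (measurableEmbedding_addLeft x)]
    simp
  rw [htr, transport, setIntegral_congr_fun (g := fun t =>
      (fun y => Real.exp (-(x - (x + y)) / μ) * B (x + y)) (-μ * t)) measurableSet_Ioi]
  · rw [integral_comp_mul_left_Ioi (fun y => Real.exp (-(x - (x + y)) / μ) * B (x + y)) 0 hμ',
      mul_zero, smul_eq_mul, ← integral_const_mul, ← integral_neg]
    congr 1 with y
    rw [inv_neg]
    ring
  · intro t ht
    have : 0 ≤ -μ * t := mul_nonneg hμ'.le (le_of_lt ht)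
    simp only [if_pos (by linarith : 0 ≤ x - μ * t)]
    congr 2
    · have := hμ.ne
      field_simp
      ring
    · ring

lemma transport_zero_of_pos (B : ℝ → ℝ) {μ : ℝ} (hμ : 0 < μ) : transport b B 0 μ = b := by
  rw [transport, setIntegral_congr_fun (g := fun t => Real.exp (-t) * b) measurableSet_Ioi]
  · rw [integral_mul_const, integral_exp_neg_Ioi_zero, one_mul]
  · intro t ht
    have : 0 < μ * t := mul_pos hμ ht
    simp only [if_neg (by linarith : ¬ 0 ≤ 0 - μ * t)]

lemma intervalIntegrable_exp_mul (hB : Measurable B) (hBM : ∀ y, B y ∈ Icc 0 M) (μ x y : ℝ) :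
    IntervalIntegrable (fun s => Real.exp (s / μ) * B s) volume x y := by
  refine IntervalIntegrable.continuousOn_mul ?_ (by fun_prop)
  refine (intervalIntegrable_const (c := M)).mono_fun' hB.aestronglyMeasurable ?_
  refine Filter.Eventually.of_forall fun t => ?_
  simpa [Real.norm_eq_abs, abs_of_nonneg (hBM t).1] using (hBM t).2

lemma transport_eq_exp_mul (hb : b ∈ Icc 0 M) (hB : Measurable B) (hBM : ∀ y, B y ∈ Icc 0 M)
    {x μ : ℝ} (hx : 0 ≤ x) (hμ : μ ≠ 0) :
    transport b B x μ = Real.exp (-x / μ) *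
      (transport b B 0 μ + μ⁻¹ * ∫ s in (0:ℝ)..x, Real.exp (s / μ) * B s) := by
  have hexp : ∀ x s : ℝ, μ⁻¹ * Real.exp (-(x - s) / μ) * B s =
      Real.exp (-x / μ) * μ⁻¹ * (Real.exp (s / μ) * B s) := by
    intro x s
    rw [show -(x - s) / μ = -x / μ + s / μ by ring, Real.exp_add]
    ring
  rcases lt_or_gt_of_ne hμ with h | h
  · have hint : IntegrableOn (fun s => Real.exp (s / μ) * B s) (Ioi 0) := by
      refine Integrable.mono' (g := fun s => Real.exp (μ⁻¹ * s) * M)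
        ((integrableOn_exp_mul_Ioi (inv_lt_zero.2 h) 0).mul_const M)
        (by fun_prop) (Filter.Eventually.of_forall fun t => ?_)
      rw [norm_mul, Real.norm_eq_abs, Real.abs_exp, Real.norm_eq_abs,
        abs_of_nonneg (hBM t).1, div_eq_inv_mul]
      exact mul_le_mul_of_nonneg_left (hBM t).2 (Real.exp_pos _).le
    rw [transport_of_neg hx h, transport_of_neg le_rfl h,
      ← intervalIntegral.integral_Ioi_sub_Ioi hint hx]
    simp only [hexp, integral_const_mul, neg_zero, zero_div, Real.exp_zero]
    ring
  · rw [transport_of_pos hb hB hBM hx h, transport_zero_of_pos B h]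
    simp only [hexp, intervalIntegral.integral_const_mul]
    ring

lemma continuousOn_transport (hb : b ∈ Icc 0 M) (hB : Measurable B) (hBM : ∀ y, B y ∈ Icc 0 M)
    {μ : ℝ} (hμ : μ ≠ 0) : ContinuousOn (fun x => transport b B x μ) (Ici 0) := by
  have hc : Continuous fun x => ∫ s in (0:ℝ)..x, Real.exp (s / μ) * B s :=
    intervalIntegral.continuous_primitive (intervalIntegrable_exp_mul hB hBM μ) 0
  refine ContinuousOn.congr (f := fun x => Real.exp (-x / μ) *
    (transport b B 0 μ + μ⁻¹ * ∫ s in (0:ℝ)..x, Real.exp (s / μ) * B s))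
    (Continuous.continuousOn (by fun_prop)) fun x hx => transport_eq_exp_mul hb hB hBM hx hμ

lemma hasDerivWithinAt_transport (hb : b ∈ Icc 0 M) (hB : Measurable B)
    (hBM : ∀ y, B y ∈ Icc 0 M) (hBc : ContinuousOn B (Ici 0)) {x μ : ℝ} (hx : 0 ≤ x)
    (hμ : μ ≠ 0) :
    HasDerivWithinAt (fun x => transport b B x μ) ((B x - transport b B x μ) / μ) (Ici 0) x := by
  have hcont : Continuous fun s => Real.exp (s / μ) * B (max s 0) := by
    have : Continuous fun s => B (max s 0) :=
      hBc.comp_continuous (by fun_prop) fun s => le_max_right s 0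
    exact Continuous.mul (by fun_prop) this
  have hprim := intervalIntegral.integral_hasDerivAt_right
    (hcont.intervalIntegrable 0 x) (hcont.stronglyMeasurableAtFilter _ _) hcont.continuousAt
  have heq : ∀ y ∈ Ici (0:ℝ), transport b B y μ = Real.exp (-y / μ) *
      (transport b B 0 μ + μ⁻¹ * ∫ s in (0:ℝ)..y, Real.exp (s / μ) * B (max s 0)) := by
    intro y hy
    rw [transport_eq_exp_mul hb hB hBM hy hμ, intervalIntegral.integral_congr fun s hs => ?_]
    rw [uIcc_of_le hy] at hs
    simp only [max_eq_left hs.1]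
  have hexp : HasDerivAt (fun y : ℝ => Real.exp (-y / μ)) (Real.exp (-x / μ) * (-1 / μ)) x :=
    ((hasDerivAt_neg x).div_const μ).exp
  have hd := hexp.mul ((hprim.const_mul μ⁻¹).const_add (transport b B 0 μ))
  refine (hd.hasDerivWithinAt.congr heq (heq x hx)).congr_deriv ?_
  have he : Real.exp (-x / μ) * Real.exp (x / μ) = 1 := by
    rw [← Real.exp_add, ← add_div, neg_add_cancel, zero_div, Real.exp_zero]
  rw [heq x hx, max_eq_left hx]
  linear_combination (B x / μ) * he

end Transport

section FixedPoint

variable {γ κ Tb : ℝ} {β T T₁ T₂ : ℝ → ℝ}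

/-- Measurable functions with values in `[0, M]`. -/
def BoundedMeasurable (M : ℝ) (T : ℝ → ℝ) : Prop :=
  Measurable T ∧ ∀ y, T y ∈ Icc 0 M

lemma BoundedMeasurable.pow_four (hT : BoundedMeasurable γ T) :
    BoundedMeasurable (γ ^ 4) (fun y => T y ^ 4) :=
  ⟨hT.1.pow_const 4, fun y => ⟨pow_nonneg (hT.2 y).1 4,
    pow_le_pow_left₀ (hT.2 y).1 (hT.2 y).2 4⟩⟩

/-- The radiative intensity generated by the temperature profile `T` and the incoming data `β`. -/
noncomputable def intensity (β T : ℝ → ℝ) (x μ : ℝ) : ℝ :=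
  transport (β μ) (fun y => T y ^ 4) x μ

/-- The angular integral of the intensity. -/
noncomputable def totalIntensity (β T : ℝ → ℝ) (x : ℝ) : ℝ :=
  ∫ μ in (-1:ℝ)..1, intensity β T x μ

lemma measurable_intensity (hβ : BoundedMeasurable (γ ^ 4) β) (hT : BoundedMeasurable γ T) :
    Measurable (fun p : ℝ × ℝ => intensity β T p.1 p.2) :=
  measurable_transport hβ.1 hT.pow_four.1

lemma measurable_intensity_right (hβ : BoundedMeasurable (γ ^ 4) β)
    (hT : BoundedMeasurable γ T) (x : ℝ) : Measurable (intensity β T x) :=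
  (measurable_intensity hβ hT).comp measurable_prodMk_left

lemma intensity_mem_Icc (hβ : BoundedMeasurable (γ ^ 4) β) (hT : BoundedMeasurable γ T)
    (x μ : ℝ) : intensity β T x μ ∈ Icc 0 (γ ^ 4) :=
  transport_mem_Icc (hβ.2 μ) hT.pow_four.1 hT.pow_four.2 x μ

lemma intensity_mono (hβ : BoundedMeasurable (γ ^ 4) β) (hT₁ : BoundedMeasurable γ T₁)
    (hT₂ : BoundedMeasurable γ T₂) (h : ∀ y, T₁ y ≤ T₂ y) (x μ : ℝ) :
    intensity β T₁ x μ ≤ intensity β T₂ x μ :=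
  transport_mono (hβ.2 μ) hT₁.pow_four.1 hT₁.pow_four.2 hT₂.pow_four.1 hT₂.pow_four.2
    (fun y => pow_le_pow_left₀ (hT₁.2 y).1 (h y) 4) x μ

lemma intervalIntegrable_intensity (hβ : BoundedMeasurable (γ ^ 4) β)
    (hT : BoundedMeasurable γ T) (x : ℝ) :
    IntervalIntegrable (intensity β T x) volume (-1) 1 := by
  refine (intervalIntegrable_const (c := γ ^ 4)).mono_fun'
    (measurable_intensity_right hβ hT x).aestronglyMeasurable
    (Filter.Eventually.of_forall fun μ => ?_)
  have h := intensity_mem_Icc hβ hT x μ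
  simpa only [Real.norm_eq_abs, abs_of_nonneg h.1] using h.2

lemma measurable_totalIntensity (hβ : BoundedMeasurable (γ ^ 4) β)
    (hT : BoundedMeasurable γ T) : Measurable (totalIntensity β T) := by
  simp only [funext_iff.2 fun x => show totalIntensity β T x =
    ∫ μ in Ioc (-1:ℝ) 1, intensity β T x μ from intervalIntegral.integral_of_le (by norm_num)]
  exact (StronglyMeasurable.integral_prod_right
    (measurable_intensity hβ hT).stronglyMeasurable).measurable

lemma totalIntensity_mono (hβ : BoundedMeasurable (γ ^ 4) β) (hT₁ : BoundedMeasurable γ T₁)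
    (hT₂ : BoundedMeasurable γ T₂) (h : ∀ y, T₁ y ≤ T₂ y) (x : ℝ) :
    totalIntensity β T₁ x ≤ totalIntensity β T₂ x :=
  intervalIntegral.integral_mono (by norm_num) (intervalIntegrable_intensity hβ hT₁ x)
    (intervalIntegrable_intensity hβ hT₂ x) (intensity_mono hβ hT₁ hT₂ h x)

lemma totalIntensity_nonneg (hβ : BoundedMeasurable (γ ^ 4) β)
    (hT : BoundedMeasurable γ T) (x : ℝ) : 0 ≤ totalIntensity β T x :=
  intervalIntegral.integral_nonneg (by norm_num) fun μ _ => (intensity_mem_Icc hβ hT x μ).1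

lemma totalIntensity_le (hβ : BoundedMeasurable (γ ^ 4) β)
    (hT : BoundedMeasurable γ T) (x : ℝ) : totalIntensity β T x ≤ 2 * γ ^ 4 :=
  calc totalIntensity β T x ≤ ∫ _ in (-1:ℝ)..1, γ ^ 4 :=
        intervalIntegral.integral_mono (by norm_num) (intervalIntegrable_intensity hβ hT x)
          intervalIntegrable_const fun μ => (intensity_mem_Icc hβ hT x μ).2
    _ = 2 * γ ^ 4 := by rw [intervalIntegral.integral_const, smul_eq_mul]; norm_num

lemma tendsto_totalIntensity {Tn : ℕ → ℝ → ℝ} (hβ : BoundedMeasurable (γ ^ 4) β)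
    (hTn : ∀ n, BoundedMeasurable γ (Tn n))
    (h : ∀ y, Filter.Tendsto (fun n => Tn n y) Filter.atTop (nhds (T y))) (x : ℝ) :
    Filter.Tendsto (fun n => totalIntensity β (Tn n) x) Filter.atTop
      (nhds (totalIntensity β T x)) := by
  refine intervalIntegral.tendsto_integral_filter_of_dominated_convergence (fun _ => γ ^ 4)
    (Filter.Eventually.of_forall fun n =>
      (measurable_intensity_right hβ (hTn n) x).aestronglyMeasurable)
    (Filter.Eventually.of_forall fun n => Filter.Eventually.of_forall fun μ _ => ?_)
    intervalIntegrable_const (Filter.Eventually.of_forall fun μ _ => ?_)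
  · have h := intensity_mem_Icc hβ (hTn n) x μ
    rw [Real.norm_eq_abs, abs_of_nonneg h.1]
    exact h.2
  · exact tendsto_transport (hβ.2 μ) (fun n => (hTn n).pow_four.1) (fun n => (hTn n).pow_four.2)
      (fun y => (h y).pow 4) x μ

/-- The right-hand side of the linearized heat equation `T - κ² T'' = linearSource`. -/
noncomputable def linearSource (κ : ℝ) (β T : ℝ → ℝ) (x : ℝ) : ℝ :=
  T x - κ ^ 2 * (2 * T x ^ 4 - totalIntensity β T x)

/-- The solution `w` of `w - κ w' = linearSource`. -/
noncomputable def backwardSolve (κ : ℝ) (β T : ℝ → ℝ) (x : ℝ) : ℝ :=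
  transport 0 (linearSource κ β T) x (-κ)

/-- The solution `u` of `u + κ u' = backwardSolve` with `u 0 = Tb`. -/
noncomputable def milneMap (Tb κ : ℝ) (β T : ℝ → ℝ) (x : ℝ) : ℝ :=
  transport Tb (backwardSolve κ β T) x κ

lemma sub_mul_pow_four_mono (hκ : κ ^ 2 * (8 * γ ^ 3) ≤ 1) {a b : ℝ} (ha : 0 ≤ a) (hab : a ≤ b)
    (hb : b ≤ γ) : a - κ ^ 2 * (2 * a ^ 4) ≤ b - κ ^ 2 * (2 * b ^ 4) := by
  have hb0 : 0 ≤ b := ha.trans hab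
  have h1 : b ^ 3 ≤ γ ^ 3 := pow_le_pow_left₀ hb0 hb 3
  have h2 : a ^ 3 + a ^ 2 * b + a * b ^ 2 + b ^ 3 ≤ 4 * γ ^ 3 := by
    have : a ^ 3 ≤ b ^ 3 := pow_le_pow_left₀ ha hab 3
    have : a ^ 2 * b ≤ b ^ 2 * b := by gcongr
    have : a * b ^ 2 ≤ b * b ^ 2 := by gcongr
    nlinarith
  have h3 : κ ^ 2 * (2 * (a ^ 3 + a ^ 2 * b + a * b ^ 2 + b ^ 3)) ≤ 1 :=
    (mul_le_mul_of_nonneg_left (by linarith) (sq_nonneg κ)).trans hκ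
  nlinarith [mul_nonneg (sub_nonneg.2 hab) (sub_nonneg.2 h3)]

lemma linearSource_mono (hκ : κ ^ 2 * (8 * γ ^ 3) ≤ 1) (hβ : BoundedMeasurable (γ ^ 4) β)
    (hT₁ : BoundedMeasurable γ T₁) (hT₂ : BoundedMeasurable γ T₂) (h : ∀ y, T₁ y ≤ T₂ y) (x : ℝ) :
    linearSource κ β T₁ x ≤ linearSource κ β T₂ x := by
  have h1 := sub_mul_pow_four_mono hκ (hT₁.2 x).1 (h x) (hT₂.2 x).2
  have h2 := mul_le_mul_of_nonneg_left (totalIntensity_mono hβ hT₁ hT₂ h x) (sq_nonneg κ)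
  simp only [linearSource]
  linarith

lemma boundedMeasurable_linearSource (hκ : κ ^ 2 * (8 * γ ^ 3) ≤ 1)
    (hβ : BoundedMeasurable (γ ^ 4) β) (hT : BoundedMeasurable γ T) :
    BoundedMeasurable γ (linearSource κ β T) := by
  refine ⟨?_, fun y => ?_⟩
  · have := measurable_totalIntensity hβ hT
    have := hT.1
    unfold linearSource
    fun_prop
  · have hy := hT.2 y
    have h1 := sub_mul_pow_four_mono hκ le_rfl hy.1 hy.2
    have h2 := sub_mul_pow_four_mono hκ hy.1 hy.2 le_rfl
    have h3 := mul_nonneg (sq_nonneg κ) (totalIntensity_nonneg hβ hT y)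
    have h4 := mul_le_mul_of_nonneg_left (totalIntensity_le hβ hT y) (sq_nonneg κ)
    simp only [linearSource, mem_Icc]
    constructor <;> linarith

lemma boundedMeasurable_transport {M b μ : ℝ} {B : ℝ → ℝ} (hb : b ∈ Icc 0 M)
    (hB : BoundedMeasurable M B) : BoundedMeasurable M (fun x => transport b B x μ) :=
  ⟨(measurable_transport (β := fun _ => b) measurable_const hB.1).comp measurable_prodMk_right,
    fun x => transport_mem_Icc hb hB.1 hB.2 x μ⟩

lemma boundedMeasurable_backwardSolve (hγ : 0 ≤ γ) (hκ : κ ^ 2 * (8 * γ ^ 3) ≤ 1)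
    (hβ : BoundedMeasurable (γ ^ 4) β) (hT : BoundedMeasurable γ T) :
    BoundedMeasurable γ (backwardSolve κ β T) :=
  boundedMeasurable_transport ⟨le_rfl, hγ⟩ (boundedMeasurable_linearSource hκ hβ hT)

lemma boundedMeasurable_milneMap (hTb : Tb ∈ Icc 0 γ) (hκ : κ ^ 2 * (8 * γ ^ 3) ≤ 1)
    (hβ : BoundedMeasurable (γ ^ 4) β) (hT : BoundedMeasurable γ T) :
    BoundedMeasurable γ (milneMap Tb κ β T) :=
  boundedMeasurable_transport hTb (boundedMeasurable_backwardSolve (hTb.1.trans hTb.2) hκ hβ hT)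

lemma milneMap_mono (hTb : Tb ∈ Icc 0 γ) (hκ : κ ^ 2 * (8 * γ ^ 3) ≤ 1)
    (hβ : BoundedMeasurable (γ ^ 4) β) (hT₁ : BoundedMeasurable γ T₁)
    (hT₂ : BoundedMeasurable γ T₂) (h : ∀ y, T₁ y ≤ T₂ y) (x : ℝ) :
    milneMap Tb κ β T₁ x ≤ milneMap Tb κ β T₂ x := by
  have hγ := hTb.1.trans hTb.2
  have s₁ := boundedMeasurable_linearSource hκ hβ hT₁
  have s₂ := boundedMeasurable_linearSource hκ hβ hT₂
  have w₁ := boundedMeasurable_backwardSolve hγ hκ hβ hT₁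
  have w₂ := boundedMeasurable_backwardSolve hγ hκ hβ hT₂
  exact transport_mono hTb w₁.1 w₁.2 w₂.1 w₂.2 (fun y => transport_mono ⟨le_rfl, hγ⟩ s₁.1 s₁.2
    s₂.1 s₂.2 (linearSource_mono hκ hβ hT₁ hT₂ h) y (-κ)) x κ

lemma tendsto_milneMap {Tn : ℕ → ℝ → ℝ} (hTb : Tb ∈ Icc 0 γ) (hκ : κ ^ 2 * (8 * γ ^ 3) ≤ 1)
    (hβ : BoundedMeasurable (γ ^ 4) β) (hTn : ∀ n, BoundedMeasurable γ (Tn n))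
    (h : ∀ y, Filter.Tendsto (fun n => Tn n y) Filter.atTop (nhds (T y))) (x : ℝ) :
    Filter.Tendsto (fun n => milneMap Tb κ β (Tn n) x) Filter.atTop
      (nhds (milneMap Tb κ β T x)) := by
  have hγ := hTb.1.trans hTb.2
  have s := fun n => boundedMeasurable_linearSource hκ hβ (hTn n)
  have w := fun n => boundedMeasurable_backwardSolve hγ hκ hβ (hTn n)
  refine tendsto_transport hTb (fun n => (w n).1) (fun n => (w n).2) (fun y => ?_) x κ
  refine tendsto_transport ⟨le_rfl, hγ⟩ (fun n => (s n).1) (fun n => (s n).2) (fun z => ?_) y (-κ)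
  exact (h z).sub (((((h z).pow 4).const_mul 2).sub
    (tendsto_totalIntensity hβ hTn h z)).const_mul (κ ^ 2))

lemma exists_fixedPoint_milneMap (hTb : Tb ∈ Icc 0 γ) (hκ : κ ^ 2 * (8 * γ ^ 3) ≤ 1)
    (hβ : BoundedMeasurable (γ ^ 4) β) :
    ∃ T, BoundedMeasurable γ T ∧ milneMap Tb κ β T = T := by
  set N := milneMap Tb κ β with hN
  have hγ := hTb.1.trans hTb.2
  let Tn : ℕ → ℝ → ℝ := fun n => N^[n] 0
  have hsucc : ∀ n, Tn (n + 1) = N (Tn n) := fun n => Function.iterate_succ_apply' N n 0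
  have hTn : ∀ n, BoundedMeasurable γ (Tn n) := by
    intro n
    induction n with
    | zero => exact ⟨measurable_const, fun y => ⟨le_rfl, hγ⟩⟩
    | succ n ih =>
      rw [hsucc]
      exact boundedMeasurable_milneMap hTb hκ hβ ih
  have hmono : ∀ n y, Tn n y ≤ Tn (n + 1) y := by
    intro n
    induction n with
    | zero => exact fun y => ((hTn 1).2 y).1
    | succ n ih =>
      rw [hsucc, hsucc (n + 1)]
      exact milneMap_mono hTb hκ hβ (hTn n) (hTn (n + 1)) ih
  have hlim : ∀ y, Filter.Tendsto (fun n => Tn n y) Filter.atTop (nhds (⨆ n, Tn n y)) :=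
    fun y => tendsto_atTop_ciSup (monotone_nat_of_le_succ fun n => hmono n y)
      ⟨γ, by rintro _ ⟨n, rfl⟩; exact ((hTn n).2 y).2⟩
  refine ⟨fun y => ⨆ n, Tn n y, ⟨measurable_of_tendsto_metrizable (fun n => (hTn n).1)
    (tendsto_pi_nhds.2 hlim), fun y => isClosed_Icc.mem_of_tendsto (hlim y)
    (Filter.Eventually.of_forall fun n => (hTn n).2 y)⟩, funext fun x => ?_⟩
  refine tendsto_nhds_unique (tendsto_milneMap hTb hκ hβ hTn hlim x) ?_
  have h := (hlim x).comp (Filter.tendsto_add_atTop_nat 1)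
  simpa only [Function.comp_def, hsucc] using h

end FixedPoint

section Moments

variable {γ κ Tb : ℝ} {β T : ℝ → ℝ}

lemma exists_norm_le_intensity {H : ℝ → ℝ → ℝ} (hH : Continuous (Function.uncurry H))
    (hβ : BoundedMeasurable (γ ^ 4) β) (hT : BoundedMeasurable γ T) :
    ∃ C, ∀ x, ∀ μ ∈ Icc (-1:ℝ) 1, ‖H μ (intensity β T x μ)‖ ≤ C := by
  obtain ⟨C, hC⟩ := (isCompact_Icc.prod isCompact_Icc :
    IsCompact (Icc (-1:ℝ) 1 ×ˢ Icc (0:ℝ) (γ ^ 4))).exists_bound_of_continuousOn hH.continuousOn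
  exact ⟨C, fun x μ hμ => hC (μ, intensity β T x μ) ⟨hμ, intensity_mem_Icc hβ hT x μ⟩⟩

lemma measurable_comp_intensity {H : ℝ → ℝ → ℝ} (hH : Continuous (Function.uncurry H))
    (hβ : BoundedMeasurable (γ ^ 4) β) (hT : BoundedMeasurable γ T) (x : ℝ) :
    Measurable (fun μ => H μ (intensity β T x μ)) :=
  hH.measurable.comp (measurable_id.prodMk (measurable_intensity_right hβ hT x))

lemma mem_Icc_of_mem_uIoc {μ : ℝ} (hμ : μ ∈ uIoc (-1:ℝ) 1) : μ ∈ Icc (-1:ℝ) 1 := by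
  rw [uIoc_of_le (by norm_num)] at hμ
  exact Ioc_subset_Icc_self hμ

lemma intervalIntegrable_comp_intensity {H : ℝ → ℝ → ℝ} (hH : Continuous (Function.uncurry H))
    (hβ : BoundedMeasurable (γ ^ 4) β) (hT : BoundedMeasurable γ T) (x : ℝ) :
    IntervalIntegrable (fun μ => H μ (intensity β T x μ)) volume (-1) 1 := by
  obtain ⟨C, hC⟩ := exists_norm_le_intensity hH hβ hT
  refine (intervalIntegrable_const (c := C)).mono_fun'
    (measurable_comp_intensity hH hβ hT x).aestronglyMeasurable ?_
  filter_upwards [ae_restrict_mem measurableSet_uIoc] with μ hμ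
  exact hC x μ (mem_Icc_of_mem_uIoc hμ)

lemma continuousOn_intensity (hβ : BoundedMeasurable (γ ^ 4) β) (hT : BoundedMeasurable γ T)
    {μ : ℝ} (hμ : μ ≠ 0) : ContinuousOn (fun x => intensity β T x μ) (Ici 0) :=
  continuousOn_transport (hβ.2 μ) hT.pow_four.1 hT.pow_four.2 hμ

lemma ae_ne_zero : ∀ᵐ μ : ℝ, μ ≠ 0 := by
  simp [ae_iff, measure_singleton]

lemma continuousOn_integral_intensity {H : ℝ → ℝ → ℝ} (hH : Continuous (Function.uncurry H))
    (hβ : BoundedMeasurable (γ ^ 4) β) (hT : BoundedMeasurable γ T) :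
    ContinuousOn (fun x => ∫ μ in (-1:ℝ)..1, H μ (intensity β T x μ)) (Ici 0) := by
  intro x hx
  obtain ⟨C, hC⟩ := exists_norm_le_intensity hH hβ hT
  refine intervalIntegral.continuousWithinAt_of_dominated_interval (bound := fun _ => C)
    (Filter.Eventually.of_forall fun y =>
      (measurable_comp_intensity hH hβ hT y).aestronglyMeasurable)
    (Filter.Eventually.of_forall fun y => Filter.Eventually.of_forall fun μ hμ =>
      hC y μ (mem_Icc_of_mem_uIoc hμ))
    intervalIntegrable_const ?_
  filter_upwards [ae_ne_zero] with μ hμ _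
  exact (hH.comp (Continuous.prodMk_right μ)).continuousAt.comp_continuousWithinAt
    (continuousOn_intensity hβ hT hμ x hx)

lemma continuousOn_totalIntensity (hβ : BoundedMeasurable (γ ^ 4) β)
    (hT : BoundedMeasurable γ T) : ContinuousOn (totalIntensity β T) (Ici 0) :=
  continuousOn_integral_intensity (H := fun _ y => y) (by fun_prop) hβ hT

lemma hasDerivAt_integral_intensity {φ φ' : ℝ → ℝ} (hφ : ∀ y, HasDerivAt φ (φ' y) y)
    (hφ' : Continuous φ') (hβ : BoundedMeasurable (γ ^ 4) β) (hT : BoundedMeasurable γ T)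
    (hTc : ContinuousOn T (Ici 0)) {x : ℝ} (hx : 0 < x) :
    HasDerivAt (fun x => ∫ μ in (-1:ℝ)..1, μ * φ (intensity β T x μ))
      (∫ μ in (-1:ℝ)..1, φ' (intensity β T x μ) * (T x ^ 4 - intensity β T x μ)) x := by
  have hφc : Continuous φ := continuous_iff_continuousAt.2 fun y => (hφ y).continuousAt
  have hH : Continuous (Function.uncurry fun μ y : ℝ => μ * φ y) := by
    simp only [Function.uncurry_def]
    fun_prop
  have hH' : Continuous (Function.uncurry fun _ y : ℝ => φ' y * (T x ^ 4 - y)) := by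
    simp only [Function.uncurry_def]
    fun_prop
  obtain ⟨C, hC⟩ := exists_norm_le_intensity (H := fun _ y => φ' y)
    (by simp only [Function.uncurry_def]; fun_prop) hβ hT
  refine (intervalIntegral.hasDerivAt_integral_of_dominated_loc_of_deriv_le
    (bound := fun _ => C * γ ^ 4) (s := Ioi 0) (Ioi_mem_nhds hx)
    (F' := fun x μ => φ' (intensity β T x μ) * (T x ^ 4 - intensity β T x μ))
    (Filter.Eventually.of_forall fun y =>
      (measurable_comp_intensity hH hβ hT y).aestronglyMeasurable)
    (intervalIntegrable_comp_intensity hH hβ hT x)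
    (measurable_comp_intensity hH' hβ hT x).aestronglyMeasurable
    (Filter.Eventually.of_forall fun μ hμ y hy => ?_) intervalIntegrable_const ?_).2
  · have h1 := hC y μ (mem_Icc_of_mem_uIoc hμ)
    have h2 : |T y ^ 4 - intensity β T y μ| ≤ γ ^ 4 := by
      have := hT.pow_four.2 y
      have := intensity_mem_Icc hβ hT y μ
      simp only [mem_Icc] at *
      exact abs_le.2 ⟨by linarith, by linarith⟩
    rw [norm_mul]
    exact mul_le_mul h1 h2 (abs_nonneg _) ((norm_nonneg _).trans h1)
  · filter_upwards [ae_ne_zero] with μ hμ _ y hy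
    have hd : HasDerivAt (fun y => intensity β T y μ) ((T y ^ 4 - intensity β T y μ) / μ) y :=
      (hasDerivWithinAt_transport (hβ.2 μ) hT.pow_four.1 hT.pow_four.2 (hTc.pow 4)
        (le_of_lt hy) hμ).hasDerivAt (Ici_mem_nhds hy)
    refine (((hφ _).comp y hd).const_mul μ).congr_deriv ?_
    field_simp

lemma continuousOn_linearSource (hβ : BoundedMeasurable (γ ^ 4) β) (hT : BoundedMeasurable γ T)
    (hTc : ContinuousOn T (Ici 0)) : ContinuousOn (linearSource κ β T) (Ici 0) :=
  hTc.sub (continuousOn_const.mul ((continuousOn_const.mul (hTc.pow 4)).sub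
    (continuousOn_totalIntensity hβ hT)))

/-- A fixed point of `milneMap` is twice differentiable and satisfies the heat equation. -/
lemma hasDerivWithinAt_of_fixedPoint (hTb : Tb ∈ Icc 0 γ) (hκ0 : 0 < κ)
    (hκ : κ ^ 2 * (8 * γ ^ 3) ≤ 1) (hβ : BoundedMeasurable (γ ^ 4) β)
    (hT : BoundedMeasurable γ T) (hfix : milneMap Tb κ β T = T) :
    T 0 = Tb ∧ ContinuousOn T (Ici 0) ∧ ∃ T' : ℝ → ℝ, (∃ K, ∀ x, |T' x| ≤ K) ∧
      (∀ x ∈ Ici (0:ℝ), HasDerivWithinAt T (T' x) (Ici 0) x) ∧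
      (∀ x ∈ Ici (0:ℝ), HasDerivWithinAt T' (2 * T x ^ 4 - totalIntensity β T x) (Ici 0) x) := by
  have hγ := hTb.1.trans hTb.2
  have hs := boundedMeasurable_linearSource hκ hβ hT
  have hw := boundedMeasurable_backwardSolve hγ hκ hβ hT
  have hTc : ContinuousOn T (Ici 0) := by
    have h := continuousOn_transport hTb hw.1 hw.2 hκ0.ne'
    change ContinuousOn (milneMap Tb κ β T) _ at h
    rwa [hfix] at h
  have hwc : ContinuousOn (backwardSolve κ β T) (Ici 0) :=
    continuousOn_transport ⟨le_rfl, hγ⟩ hs.1 hs.2 (neg_ne_zero.2 hκ0.ne')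
  have hw' : ∀ x ∈ Ici (0:ℝ), HasDerivWithinAt (backwardSolve κ β T)
      ((linearSource κ β T x - backwardSolve κ β T x) / -κ) (Ici 0) x := fun x hx =>
    hasDerivWithinAt_transport ⟨le_rfl, hγ⟩ hs.1 hs.2 (continuousOn_linearSource hβ hT hTc) hx
      (neg_ne_zero.2 hκ0.ne')
  have hT' : ∀ x ∈ Ici (0:ℝ), HasDerivWithinAt T
      ((backwardSolve κ β T x - T x) / κ) (Ici 0) x := by
    intro x hx
    have h := hasDerivWithinAt_transport hTb hw.1 hw.2 hwc hx hκ0.ne'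
    change HasDerivWithinAt (milneMap Tb κ β T)
      ((backwardSolve κ β T x - milneMap Tb κ β T x) / κ) _ x at h
    rwa [hfix] at h
  refine ⟨?_, hTc, fun x => (backwardSolve κ β T x - T x) / κ, ⟨γ / κ, fun x => ?_⟩, hT',
    fun x hx => (((hw' x hx).sub (hT' x hx)).div_const κ).congr_deriv ?_⟩
  · rw [← hfix]
    exact transport_zero_of_pos _ hκ0
  · rw [abs_div, abs_of_pos hκ0]
    have h1 := hw.2 x
    have h2 := hT.2 x
    simp only [mem_Icc] at h1 h2
    gcongr
    exact abs_le.2 ⟨by linarith, by linarith⟩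
  · have := hκ0.ne'
    simp only [linearSource]
    field_simp
    ring

end Moments

section Energy

lemma antitoneOn_Ici_of_hasDerivAt {f f' : ℝ → ℝ} (hf : ContinuousOn f (Ici 0))
    (hd : ∀ x, 0 < x → HasDerivAt f (f' x) x) (hf' : ∀ x, 0 < x → f' x ≤ 0) :
    AntitoneOn f (Ici 0) := by
  refine antitoneOn_of_hasDerivWithinAt_nonpos (f' := f') (convex_Ici 0) hf ?_ ?_ <;>
    rw [interior_Ici]
  exacts [fun x hx => (hd x hx).hasDerivWithinAt, hf']

lemma nonneg_of_abs_le_dissipation {H D : ℝ → ℝ} {M : ℝ} (hH : ContinuousOn H (Ici 0))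
    (hd : ∀ x, 0 < x → HasDerivAt H (-D x) x) (hHD : ∀ x, 0 < x → |H x| ≤ D x / 2)
    (hM : ∀ x ∈ Ici (0:ℝ), |H x| ≤ M) : ∀ x ∈ Ici (0:ℝ), 0 ≤ H x := by
  intro x₀ hx₀
  by_contra! hneg
  have hanti : AntitoneOn (fun x => Real.exp (-2 * x) * H x) (Ici 0) := by
    refine antitoneOn_Ici_of_hasDerivAt (Continuous.continuousOn (by fun_prop) |>.mul hH)
      (fun x hx => (((hasDerivAt_id x).const_mul (-2)).exp).mul (hd x hx)) fun x hx => ?_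
    have h1 := (abs_le.1 (hHD x hx)).1
    have h2 : Real.exp (-2 * x) * (-2 * H x - D x) ≤ 0 :=
      mul_nonpos_of_nonneg_of_nonpos (Real.exp_pos _).le (by linarith)
    simp only [id]
    linarith
  have hM0 : 0 ≤ M := (abs_nonneg _).trans (hM x₀ hx₀)
  set t := M / (-H x₀) with ht
  have ht0 : 0 ≤ t := div_nonneg hM0 (by linarith)
  have hx₀' : (0:ℝ) ≤ x₀ := hx₀
  have hmem : x₀ + t ∈ Ici (0:ℝ) := add_nonneg hx₀' ht0
  have h1 : Real.exp (-2 * (x₀ + t)) * H (x₀ + t) ≤ Real.exp (-2 * x₀) * H x₀ :=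
    hanti hx₀ hmem (by linarith)
  have h2 : H (x₀ + t) ≤ Real.exp (2 * t) * H x₀ := by
    have h3 : Real.exp (-2 * x₀) = Real.exp (-2 * (x₀ + t)) * Real.exp (2 * t) := by
      rw [← Real.exp_add]
      ring_nf
    rw [h3, mul_assoc] at h1
    exact le_of_mul_le_mul_left h1 (Real.exp_pos _)
  have h4 := (abs_le.1 (hM _ hmem)).1
  have h5 : t * (-H x₀) = M := div_mul_cancel₀ _ (by linarith)
  nlinarith [Real.add_one_le_exp (2 * t)]

lemma weighted_dissipation_le {H Q W : ℝ → ℝ} {M α : ℝ} (hα : α ∈ Ico (0:ℝ) 1)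
    (hH : ContinuousOn H (Ici 0)) (hQ : ContinuousOn Q (Ici 0)) (hW : ContinuousOn W (Ici 0))
    (hd : ∀ x, 0 < x → HasDerivAt H (-(Q x + W x)) x) (hQ0 : ∀ x ∈ Ici (0:ℝ), 0 ≤ Q x)
    (hHW : ∀ x ∈ Ici (0:ℝ), |H x| ≤ W x / 2) (hM : ∀ x ∈ Ici (0:ℝ), |H x| ≤ M) :
    (∫ x in Ioi (0:ℝ), Real.exp (2 * α * x) * Q x)
      + (1 - α) * (∫ x in Ioi (0:ℝ), Real.exp (2 * α * x) * W x) ≤ H 0 := by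
  have hα1 : 0 ≤ 1 - α := sub_nonneg.2 hα.2.le
  have hH0 := nonneg_of_abs_le_dissipation hH hd
    (fun x hx => (hHW x hx.le).trans (by linarith [hQ0 x hx.le])) hM
  have hW0 : ∀ x ∈ Ici (0:ℝ), 0 ≤ W x := fun x hx => by
    linarith [(abs_nonneg _).trans (hHW x hx)]
  have hexp : ContinuousOn (fun x : ℝ => Real.exp (2 * α * x)) (Ici 0) :=
    Continuous.continuousOn (by fun_prop)
  set A : ℝ → ℝ := fun x => Real.exp (2 * α * x) * Q x with hA
  set C : ℝ → ℝ := fun x => (1 - α) * (Real.exp (2 * α * x) * W x) with hC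
  have hAc : ContinuousOn A (Ici 0) := hexp.mul hQ
  have hCc : ContinuousOn C (Ici 0) := continuousOn_const.mul (hexp.mul hW)
  have hA0 : ∀ x ∈ Ici (0:ℝ), 0 ≤ A x := fun x hx => mul_nonneg (Real.exp_pos _).le (hQ0 x hx)
  have hC0 : ∀ x ∈ Ici (0:ℝ), 0 ≤ C x := fun x hx =>
    mul_nonneg hα1 (mul_nonneg (Real.exp_pos _).le (hW0 x hx))
  have hbound : ∀ L, 0 ≤ L → ∫ x in (0:ℝ)..L, (A x + C x) ≤ H 0 := by
    intro L hL
    have hsub : Icc 0 L ⊆ Ici (0:ℝ) := Icc_subset_Ici_self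
    set g : ℝ → ℝ := fun x => Real.exp (2 * α * x) * (Q x + W x - 2 * α * H x) with hg
    have hgc : ContinuousOn g (Icc 0 L) :=
      (hexp.mul ((hQ.add hW).sub (continuousOn_const.mul hH))).mono hsub
    have hgi : IntervalIntegrable g volume 0 L := hgc.intervalIntegrable_of_Icc hL
    have hftc : ∫ x in (0:ℝ)..L, g x = -(Real.exp (2 * α * L) * H L)
        - -(Real.exp (2 * α * 0) * H 0) := by
      refine intervalIntegral.integral_eq_sub_of_hasDerivAt_of_le hL
        (f := fun x => -(Real.exp (2 * α * x) * H x)) ((hexp.mul hH).neg.mono hsub)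
        (fun x hx => ?_) hgi
      refine (((((hasDerivAt_id x).const_mul (2 * α)).exp).mul (hd x hx.1)).neg).congr_deriv ?_
      simp only [hg, id]
      ring
    calc ∫ x in (0:ℝ)..L, (A x + C x) ≤ ∫ x in (0:ℝ)..L, g x := by
          refine intervalIntegral.integral_mono_on hL
            (((hAc.add hCc).mono hsub).intervalIntegrable_of_Icc hL) hgi fun x hx => ?_
          have h1 := (abs_le.1 (hHW x (hsub hx))).2
          have h2 : 0 ≤ Real.exp (2 * α * x) * (α * (W x - 2 * H x)) :=
            mul_nonneg (Real.exp_pos _).le (mul_nonneg hα.1 (by linarith))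
          simp only [hA, hC, hg]
          linarith
      _ ≤ H 0 := by
          rw [hftc]
          have := mul_nonneg (Real.exp_pos (2 * α * L)).le (hH0 L hL)
          simp only [mul_zero, Real.exp_zero]
          linarith
  have hint : IntegrableOn (fun x => A x + C x) (Ioi 0) := by
    refine integrableOn_Ioi_of_intervalIntegral_norm_bounded (l := Filter.atTop)
      (b := fun L : ℝ => L) (H 0) 0 (fun L => ?_) Filter.tendsto_id ?_
    · exact (((hAc.add hCc).mono Icc_subset_Ici_self).integrableOn_Icc).mono_set
        Ioc_subset_Icc_self
    · filter_upwards [Filter.eventually_ge_atTop 0] with L hL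
      rw [intervalIntegral.integral_congr (g := fun x => A x + C x)]
      · exact hbound L hL
      · intro x hx
        rw [uIcc_of_le hL] at hx
        exact Real.norm_of_nonneg (add_nonneg (hA0 x hx.1) (hC0 x hx.1))
  have hAi : IntegrableOn A (Ioi 0) := by
    refine Integrable.mono' hint
      ((hAc.mono Ioi_subset_Ici_self).aestronglyMeasurable measurableSet_Ioi) ?_
    filter_upwards [ae_restrict_mem measurableSet_Ioi] with x hx
    rw [Real.norm_of_nonneg (hA0 x (Ioi_subset_Ici_self hx))]
    linarith [hC0 x (Ioi_subset_Ici_self hx)]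
  have hCi : IntegrableOn C (Ioi 0) := by
    refine Integrable.mono' hint
      ((hCc.mono Ioi_subset_Ici_self).aestronglyMeasurable measurableSet_Ioi) ?_
    filter_upwards [ae_restrict_mem measurableSet_Ioi] with x hx
    rw [Real.norm_of_nonneg (hC0 x (Ioi_subset_Ici_self hx))]
    linarith [hA0 x (Ioi_subset_Ici_self hx)]
  rw [← integral_const_mul, ← integral_add hAi hCi]
  refine le_of_tendsto (intervalIntegral_tendsto_integral_Ioi 0 hint Filter.tendsto_id) ?_
  filter_upwards [Filter.eventually_ge_atTop 0] with L hL
  exact hbound L hL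

/-- A bounded function whose derivative is the constant `c` up to an error controlled by the
dissipation of a bounded energy can only have `c = 0`. -/
lemma eq_zero_of_bounded_of_dissipation {T T' E D : ℝ → ℝ} {c M N : ℝ}
    (hT : ContinuousOn T (Ici 0)) (hE : ContinuousOn E (Ici 0))
    (hT' : ∀ x, 0 < x → HasDerivAt T (T' x) x) (hE' : ∀ x, 0 < x → HasDerivAt E (-D x) x)
    (hM : ∀ x ∈ Ici (0:ℝ), |T x| ≤ M) (hN : ∀ x ∈ Ici (0:ℝ), |E x| ≤ N)
    (h : ∀ x, 0 < x → 2 / 3 * c ^ 2 - D x / 2 ≤ c * T' x) : c = 0 := by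
  by_contra hc
  have hc2 : 0 < c ^ 2 := by positivity
  have hanti : AntitoneOn (fun x => 2 / 3 * c ^ 2 * x + E x / 2 - c * T x) (Ici 0) := by
    refine antitoneOn_Ici_of_hasDerivAt
      (((Continuous.continuousOn (by fun_prop)).add (hE.div_const 2)).sub
        (continuousOn_const.mul hT))
      (fun x hx => (((hasDerivAt_id x).const_mul (2 / 3 * c ^ 2)).add
        ((hE' x hx).div_const 2)).sub ((hT' x hx).const_mul c)) fun x hx => ?_
    linarith [h x hx]
  have hM0 : 0 ≤ M := (abs_nonneg _).trans (hM 0 self_mem_Ici)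
  have hN0 : 0 ≤ N := (abs_nonneg _).trans (hN 0 self_mem_Ici)
  have hcT : ∀ x ∈ Ici (0:ℝ), |c * T x| ≤ |c| * M := fun x hx => by
    rw [abs_mul]
    exact mul_le_mul_of_nonneg_left (hM x hx) (abs_nonneg c)
  set L := 3 / 2 * (N + 2 * (|c| * M) + 1) / c ^ 2 with hL
  have hL0 : L ∈ Ici (0:ℝ) := by
    have : 0 ≤ N + 2 * (|c| * M) + 1 := by positivity
    exact div_nonneg (by linarith) hc2.le
  have h1 := hanti (self_mem_Ici) hL0 hL0
  have h2 : c ^ 2 * L = 3 / 2 * (N + 2 * (|c| * M) + 1) := mul_div_cancel₀ _ hc2.ne'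
  simp only [mul_zero] at h1
  have := abs_le.1 (hcT 0 self_mem_Ici)
  have := abs_le.1 (hcT L hL0)
  have := abs_le.1 (hN 0 self_mem_Ici)
  have := abs_le.1 (hN L hL0)
  linarith

end Energy

section MilneEnergy

variable {γ : ℝ} {β T T' : ℝ → ℝ}

lemma integral_intensity_quadratic (hβ : BoundedMeasurable (γ ^ 4) β)
    (hT : BoundedMeasurable γ T) (x a b c d e f g : ℝ) :
    ∫ μ in (-1:ℝ)..1, (a + b * intensity β T x μ + c * intensity β T x μ ^ 2 + d * μ
      + e * (μ * intensity β T x μ) + f * (μ * intensity β T x μ ^ 2) + g * μ ^ 2)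
      = 2 * a + b * totalIntensity β T x + c * (∫ μ in (-1:ℝ)..1, intensity β T x μ ^ 2)
        + e * (∫ μ in (-1:ℝ)..1, μ * intensity β T x μ)
        + f * (∫ μ in (-1:ℝ)..1, μ * intensity β T x μ ^ 2) + 2 / 3 * g := by
  have h0 : IntervalIntegrable (fun _ : ℝ => a) volume (-1) 1 := intervalIntegrable_const
  have h1 : IntervalIntegrable (fun μ => b * intensity β T x μ) volume (-1) 1 :=
    (intervalIntegrable_intensity hβ hT x).const_mul b
  have h2 : IntervalIntegrable (fun μ => c * intensity β T x μ ^ 2) volume (-1) 1 :=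
    (intervalIntegrable_comp_intensity (H := fun _ y => y ^ 2)
      (by simp only [Function.uncurry_def]; fun_prop) hβ hT x).const_mul c
  have h3 : IntervalIntegrable (fun μ : ℝ => d * μ) volume (-1) 1 :=
    Continuous.intervalIntegrable (by fun_prop) _ _
  have h4 : IntervalIntegrable (fun μ => e * (μ * intensity β T x μ)) volume (-1) 1 :=
    (intervalIntegrable_comp_intensity (H := fun μ y => μ * y)
      (by simp only [Function.uncurry_def]; fun_prop) hβ hT x).const_mul e
  have h5 : IntervalIntegrable (fun μ => f * (μ * intensity β T x μ ^ 2)) volume (-1) 1 :=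
    (intervalIntegrable_comp_intensity (H := fun μ y => μ * y ^ 2)
      (by simp only [Function.uncurry_def]; fun_prop) hβ hT x).const_mul f
  have h6 : IntervalIntegrable (fun μ : ℝ => g * μ ^ 2) volume (-1) 1 :=
    Continuous.intervalIntegrable (by fun_prop) _ _
  rw [intervalIntegral.integral_add (((((h0.add h1).add h2).add h3).add h4).add h5) h6,
    intervalIntegral.integral_add ((((h0.add h1).add h2).add h3).add h4) h5,
    intervalIntegral.integral_add (((h0.add h1).add h2).add h3) h4,
    intervalIntegral.integral_add ((h0.add h1).add h2) h3,
    intervalIntegral.integral_add (h0.add h1) h2, intervalIntegral.integral_add h0 h1]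
  have hodd : ∫ μ in (-1:ℝ)..1, d * μ = 0 := by
    rw [intervalIntegral.integral_const_mul, integral_id]
    norm_num
  rw [hodd]
  simp only [intervalIntegral.integral_const_mul, intervalIntegral.integral_const, integral_pow,
    smul_eq_mul, totalIntensity]
  norm_num
  ring

lemma integral_intensity_eq (hβ : BoundedMeasurable (γ ^ 4) β) (hT : BoundedMeasurable γ T)
    {x : ℝ} {φ : ℝ → ℝ} (a b c d e f g : ℝ)
    (hφ : ∀ μ, φ μ = a + b * intensity β T x μ + c * intensity β T x μ ^ 2 + d * μ
      + e * (μ * intensity β T x μ) + f * (μ * intensity β T x μ ^ 2) + g * μ ^ 2) :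
    ∫ μ in (-1:ℝ)..1, φ μ
      = 2 * a + b * totalIntensity β T x + c * (∫ μ in (-1:ℝ)..1, intensity β T x μ ^ 2)
        + e * (∫ μ in (-1:ℝ)..1, μ * intensity β T x μ)
        + f * (∫ μ in (-1:ℝ)..1, μ * intensity β T x μ ^ 2) + 2 / 3 * g := by
  rw [← integral_intensity_quadratic hβ hT x a b c d e f g]
  exact intervalIntegral.integral_congr fun μ _ => hφ μ

lemma milne_weighted_estimate (hβ : BoundedMeasurable (γ ^ 4) β) (hT : BoundedMeasurable γ T)
    (hTc : ContinuousOn T (Ici 0)) {K : ℝ} (hK : ∀ x, |T' x| ≤ K)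
    (hT' : ∀ x ∈ Ici (0:ℝ), HasDerivWithinAt T (T' x) (Ici 0) x)
    (hT'' : ∀ x ∈ Ici (0:ℝ),
      HasDerivWithinAt T' (2 * T x ^ 4 - totalIntensity β T x) (Ici 0) x)
    {α : ℝ} (hα : α ∈ Ico (0:ℝ) 1) :
    (∫ x in Ioi (0:ℝ), Real.exp (2 * α * x) * (4 * T x ^ 3 * T' x ^ 2))
      + (1 - α) * (∫ x in Ioi (0:ℝ), (∫ μ in (-1:ℝ)..1,
          Real.exp (2 * α * x) * (intensity β T x μ - T x ^ 4) ^ 2))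
      ≤ 1 / 2 * ∫ μ in (-1:ℝ)..1, μ * (intensity β T 0 μ - T 0 ^ 4) ^ 2 := by
  set m₀ := totalIntensity β T with hm₀
  set m₂ : ℝ → ℝ := fun x => ∫ μ in (-1:ℝ)..1, intensity β T x μ ^ 2 with hm₂
  set q : ℝ → ℝ := fun x => ∫ μ in (-1:ℝ)..1, μ * intensity β T x μ with hq
  set P : ℝ → ℝ := fun x => ∫ μ in (-1:ℝ)..1, μ * intensity β T x μ ^ 2 with hP
  set W : ℝ → ℝ := fun x => ∫ μ in (-1:ℝ)..1, (intensity β T x μ - T x ^ 4) ^ 2 with hW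
  set E : ℝ → ℝ := fun x => P x / 2 - T x ^ 4 * T' x with hE
  set Q : ℝ → ℝ := fun x => 4 * T x ^ 3 * T' x ^ 2 with hQ
  have hTc' : ContinuousOn T' (Ici 0) := fun x hx => (hT'' x hx).continuousWithinAt
  have hm₀c : ContinuousOn m₀ (Ici 0) := continuousOn_totalIntensity hβ hT
  have hm₂c : ContinuousOn m₂ (Ici 0) :=
    continuousOn_integral_intensity (H := fun _ y => y ^ 2)
      (by simp only [Function.uncurry_def]; fun_prop) hβ hT
  have hqc : ContinuousOn q (Ici 0) :=
    continuousOn_integral_intensity (H := fun μ y => μ * y)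
      (by simp only [Function.uncurry_def]; fun_prop) hβ hT
  have hPc : ContinuousOn P (Ici 0) :=
    continuousOn_integral_intensity (H := fun μ y => μ * y ^ 2)
      (by simp only [Function.uncurry_def]; fun_prop) hβ hT
  have hWeq : ∀ x, W x = 2 * T x ^ 8 - 2 * T x ^ 4 * m₀ x + m₂ x := by
    intro x
    rw [hW]
    simp only []
    rw [integral_intensity_eq hβ hT (T x ^ 8) (-2 * T x ^ 4) 1 0 0 0 0 fun μ => by ring]
    ring
  have hWc : ContinuousOn W (Ici 0) := by
    rw [funext hWeq]
    fun_prop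
  have hEc : ContinuousOn E (Ici 0) := by fun_prop
  have hQc : ContinuousOn Q (Ici 0) := by fun_prop
  have hTd : ∀ x, 0 < x → HasDerivAt T (T' x) x := fun x hx =>
    (hT' x hx.le).hasDerivAt (Ici_mem_nhds hx)
  have hTd' : ∀ x, 0 < x → HasDerivAt T' (2 * T x ^ 4 - m₀ x) x := fun x hx =>
    (hT'' x hx.le).hasDerivAt (Ici_mem_nhds hx)
  have hqd : ∀ x, 0 < x → HasDerivAt q (2 * T x ^ 4 - m₀ x) x := by
    intro x hx
    refine (hasDerivAt_integral_intensity (φ := fun y => y) (φ' := fun _ => 1)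
      (fun y => hasDerivAt_id y) continuous_const hβ hT hTc hx).congr_deriv ?_
    rw [integral_intensity_eq hβ hT (T x ^ 4) (-1) 0 0 0 0 0 fun μ => by ring]
    ring
  have hPd : ∀ x, 0 < x → HasDerivAt P (2 * T x ^ 4 * m₀ x - 2 * m₂ x) x := by
    intro x hx
    refine (hasDerivAt_integral_intensity (φ := fun y => y ^ 2) (φ' := fun y => 2 * y)
      (fun y => by simpa using hasDerivAt_pow 2 y) (by fun_prop) hβ hT hTc hx).congr_deriv ?_
    rw [integral_intensity_eq hβ hT 0 (2 * T x ^ 4) (-2) 0 0 0 0 fun μ => by ring]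
    ring
  have hEd : ∀ x, 0 < x → HasDerivAt E (-(Q x + W x)) x := by
    intro x hx
    refine (((hPd x hx).div_const 2).sub
      (((hTd x hx).pow 4).mul (hTd' x hx))).congr_deriv ?_
    rw [hWeq]
    simp only [hQ, Pi.pow_apply]
    push_cast
    ring
  have hQ0 : ∀ x ∈ Ici (0:ℝ), 0 ≤ Q x := fun x _ =>
    mul_nonneg (mul_nonneg (by norm_num) (pow_nonneg (hT.2 x).1 3)) (sq_nonneg _)
  obtain ⟨C, hC⟩ : ∃ C, ∀ x, |P x| ≤ C := by
    obtain ⟨C, hC⟩ := exists_norm_le_intensity (H := fun μ y => μ * y ^ 2)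
      (by simp only [Function.uncurry_def]; fun_prop) hβ hT
    exact ⟨C * |1 - (-1)|, fun x => intervalIntegral.norm_integral_le_of_norm_le_const
      fun μ hμ => hC x μ (mem_Icc_of_mem_uIoc hμ)⟩
  have hEM : ∀ x ∈ Ici (0:ℝ), |E x| ≤ C / 2 + γ ^ 4 * K := by
    intro x _
    have h1 : |T x ^ 4 * T' x| ≤ γ ^ 4 * K := by
      rw [abs_mul, abs_of_nonneg (hT.pow_four.2 x).1]
      exact mul_le_mul (hT.pow_four.2 x).2 (hK x) (abs_nonneg _) (by positivity)
    have h2 := abs_le.1 (hC x)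
    have h3 := abs_le.1 h1
    exact abs_le.2 ⟨by simp only [hE]; linarith, by simp only [hE]; linarith⟩
  set c := T' 0 - q 0 with hc
  have hflux : ∀ x ∈ Ici (0:ℝ), T' x = q x + c := by
    intro x hx
    have hdc : ContinuousOn (fun x => T' x - q x) (Ici 0) := hTc'.sub hqc
    have h1 := antitoneOn_Ici_of_hasDerivAt hdc
      (fun x hx => (hTd' x hx).sub (hqd x hx)) (fun x _ => (sub_self _).le) self_mem_Ici hx hx
    have h2 := antitoneOn_Ici_of_hasDerivAt hdc.neg
      (fun x hx => ((hTd' x hx).sub (hqd x hx)).neg) (fun x _ => by simp) self_mem_Ici hx hx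
    simp only [Pi.neg_apply] at h1 h2
    linarith
  have hc0 : c = 0 := by
    refine eq_zero_of_bounded_of_dissipation hTc hEc hTd hEd (M := γ)
      (fun x _ => by rw [abs_of_nonneg (hT.2 x).1]; exact (hT.2 x).2) hEM fun x hx => ?_
    have h : 0 ≤ ∫ μ in (-1:ℝ)..1, (c * μ + (intensity β T x μ - T x ^ 4)) ^ 2 :=
      intervalIntegral.integral_nonneg (by norm_num) fun μ _ => sq_nonneg _
    rw [integral_intensity_eq hβ hT (T x ^ 8) (-2 * T x ^ 4) 1 (-2 * c * T x ^ 4) (2 * c) 0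
      (c ^ 2) fun μ => by ring] at h
    have h1 := hWeq x
    have h2 := hQ0 x hx.le
    have h3 : c * T' x = c * q x + c ^ 2 := by rw [hflux x hx.le]; ring
    simp only [hq, hm₂] at h1 h3
    linarith
  have hEq : ∀ x ∈ Ici (0:ℝ), E x = P x / 2 - T x ^ 4 * q x := fun x hx => by
    simp only [hE]
    rw [hflux x hx, hc0, add_zero]
  have hEW : ∀ x ∈ Ici (0:ℝ), |E x| ≤ W x / 2 := by
    intro x hx
    have h1 : 0 ≤ ∫ μ in (-1:ℝ)..1, (1 - μ) * (intensity β T x μ - T x ^ 4) ^ 2 :=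
      intervalIntegral.integral_nonneg (by norm_num) fun μ hμ =>
        mul_nonneg (by linarith [hμ.2]) (sq_nonneg _)
    have h2 : 0 ≤ ∫ μ in (-1:ℝ)..1, (1 + μ) * (intensity β T x μ - T x ^ 4) ^ 2 :=
      intervalIntegral.integral_nonneg (by norm_num) fun μ hμ =>
        mul_nonneg (by linarith [hμ.1]) (sq_nonneg _)
    rw [integral_intensity_eq hβ hT (T x ^ 8) (-2 * T x ^ 4) 1 (-T x ^ 8) (2 * T x ^ 4) (-1) 0
      fun μ => by ring] at h1
    rw [integral_intensity_eq hβ hT (T x ^ 8) (-2 * T x ^ 4) 1 (T x ^ 8) (-2 * T x ^ 4) 1 0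
      fun μ => by ring] at h2
    rw [hEq x hx, hWeq]
    exact abs_le.2 ⟨by simp only [hP, hq, hm₂]; linarith, by simp only [hP, hq, hm₂]; linarith⟩
  have hE0 : E 0 = 1 / 2 * ∫ μ in (-1:ℝ)..1, μ * (intensity β T 0 μ - T 0 ^ 4) ^ 2 := by
    rw [hEq 0 self_mem_Ici, integral_intensity_eq hβ hT 0 0 0 (T 0 ^ 8) (-2 * T 0 ^ 4) 1 0
      fun μ => by ring]
    ring
  rw [← hE0]
  simp only [intervalIntegral.integral_const_mul]
  exact weighted_dissipation_le hα hEc hQc hWc hEd hQ0 hEW hEM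

end MilneEnergy

/-- Existence of a solution to the nonlinear Milne problem of radiative heat
transfer on the half-line, together with the weighted energy estimate. -/
theorem stmt_0 (γ Tb : ℝ) (hγ : 0 < γ) (hTb : Tb ∈ Set.Icc 0 γ)
    (ψb : ℝ → ℝ) (hψbmeas : Measurable ψb)
    (hψb : ∀ μ ∈ Set.Ioc (0:ℝ) 1, ψb μ ∈ Set.Icc 0 (γ ^ 4)) :
    ∃ (T T' T'' : ℝ → ℝ) (ψ : ℝ → ℝ → ℝ),
      -- (T is twice continuously differentiable on [0,∞))
      (∀ x ∈ Set.Ici (0:ℝ), HasDerivWithinAt T (T' x) (Set.Ici 0) x) ∧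
      (∀ x ∈ Set.Ici (0:ℝ), HasDerivWithinAt T' (T'' x) (Set.Ici 0) x) ∧
      ContinuousOn T'' (Set.Ici 0) ∧
      -- (i) bounds
      (∀ x ∈ Set.Ici (0:ℝ), T x ∈ Set.Icc 0 γ) ∧
      (∀ x ∈ Set.Ici (0:ℝ), ∀ μ ∈ Set.Icc (-1:ℝ) 1, ψ x μ ∈ Set.Icc 0 (γ ^ 4)) ∧
      -- (ii) boundary value of T
      T 0 = Tb ∧
      -- (iii) formulas for ψ
      (∀ μ ∈ Set.Ioc (0:ℝ) 1, ∀ x ∈ Set.Ici (0:ℝ),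
        ψ x μ = ψb μ * Real.exp (-x / μ)
          + ∫ s in (0:ℝ)..x, μ⁻¹ * Real.exp (-(x - s) / μ) * T s ^ 4) ∧
      (∀ μ ∈ Set.Ico (-1:ℝ) 0, ∀ x ∈ Set.Ici (0:ℝ),
        ψ x μ = -∫ s in Set.Ioi x, μ⁻¹ * Real.exp (-(x - s) / μ) * T s ^ 4) ∧
      -- (iv) the second order ODE
      (∀ x ∈ Set.Ici (0:ℝ),
        T'' x + (∫ μ in (-1:ℝ)..1, (ψ x μ - T x ^ 4)) = 0) ∧
      -- (v) weighted estimate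
      (∀ α ∈ Set.Ico (0:ℝ) 1,
        (∫ x in Set.Ioi (0:ℝ), Real.exp (2*α*x) * (4 * T x ^ 3 * T' x ^ 2))
          + (1 - α) * (∫ x in Set.Ioi (0:ℝ),
              (∫ μ in (-1:ℝ)..1, Real.exp (2*α*x) * (ψ x μ - T x ^ 4) ^ 2))
          + (1/2) * (∫ μ in (-1:ℝ)..0, |μ| * (ψ 0 μ - Tb ^ 4) ^ 2)
          ≤ (1/2) * (∫ μ in (0:ℝ)..1, μ * (ψb μ - Tb ^ 4) ^ 2)) := by
  set β : ℝ → ℝ := fun μ => max 0 (min (γ ^ 4) (ψb μ)) with hβdef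
  have hβ : BoundedMeasurable (γ ^ 4) β :=
    ⟨measurable_const.max (measurable_const.min hψbmeas), fun μ =>
      ⟨le_max_left _ _, max_le (by positivity) (min_le_left _ _)⟩⟩
  have hβψ : ∀ μ ∈ Ioc (0:ℝ) 1, β μ = ψb μ := fun μ hμ => by
    simp only [hβdef]
    rw [min_eq_right (hψb μ hμ).2, max_eq_right (hψb μ hμ).1]
  obtain ⟨κ, hκ0, hκ⟩ : ∃ κ : ℝ, 0 < κ ∧ κ ^ 2 * (8 * γ ^ 3) ≤ 1 := by
    have h : 0 < 8 * γ ^ 3 := by positivity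
    refine ⟨1 / (8 * γ ^ 3 + 1), by positivity, ?_⟩
    rw [div_pow, one_pow, one_div_mul_eq_div]
    exact (div_le_one (by positivity)).2 (by nlinarith)
  obtain ⟨T, hT, hfix⟩ := exists_fixedPoint_milneMap hTb hκ hβ
  obtain ⟨hT0, hTc, T', ⟨K, hK⟩, hT', hT''⟩ :=
    hasDerivWithinAt_of_fixedPoint hTb hκ0 hκ hβ hT hfix
  refine ⟨T, T', fun x => 2 * T x ^ 4 - totalIntensity β T x, intensity β T, hT', hT'',
    (continuousOn_const.mul (hTc.pow 4)).sub (continuousOn_totalIntensity hβ hT),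
    fun x _ => hT.2 x, fun x _ μ _ => intensity_mem_Icc hβ hT x μ, hT0,
    fun μ hμ x hx => ?_, fun μ hμ x hx => transport_of_neg hx hμ.2, fun x _ => ?_,
    fun α hα => ?_⟩
  · rw [← hβψ μ hμ]
    exact transport_of_pos (hβ.2 μ) hT.pow_four.1 hT.pow_four.2 hx hμ.1
  · rw [integral_intensity_eq hβ hT (-T x ^ 4) 1 0 0 0 0 0 fun μ => by ring]
    ring
  · have h := milne_weighted_estimate hβ hT hTc hK hT' hT'' hα
    have hi := intervalIntegrable_comp_intensity (H := fun μ y => μ * (y - T 0 ^ 4) ^ 2)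
      (by simp only [Function.uncurry_def]; fun_prop) hβ hT 0
    rw [← intervalIntegral.integral_add_adjacent_intervals (b := 0)
      (hi.mono_set (uIcc_subset_uIcc_left (by simp)))
      (hi.mono_set (uIcc_subset_uIcc_right (by simp))), hT0] at h
    have hneg : ∫ μ in (-1:ℝ)..0, |μ| * (intensity β T 0 μ - Tb ^ 4) ^ 2 =
        -∫ μ in (-1:ℝ)..0, μ * (intensity β T 0 μ - Tb ^ 4) ^ 2 := by
      rw [← intervalIntegral.integral_neg]
      refine intervalIntegral.integral_congr fun μ hμ => ?_
      rw [uIcc_of_le (by norm_num)] at hμ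
      simp only [abs_of_nonpos hμ.2, neg_mul]
    have hpos : ∫ μ in (0:ℝ)..1, μ * (intensity β T 0 μ - Tb ^ 4) ^ 2 =
        ∫ μ in (0:ℝ)..1, μ * (ψb μ - Tb ^ 4) ^ 2 := by
      rw [intervalIntegral.integral_of_le zero_le_one, intervalIntegral.integral_of_le zero_le_one]
      refine setIntegral_congr_fun measurableSet_Ioc fun μ hμ => ?_
      simp only [intensity, transport_zero_of_pos _ hμ.1, hβψ μ hμ]
    rw [hpos] at h
    rw [hneg]
    linarith
end

section
/- Let γ > 0, T_b ∈ [0,γ], α ∈ (0,1), and let ψ_b : (0,1] → ℝ be measurable with 0 ≤ ψ_b ≤ γ⁴. Set M_α := (6α(1−α))^{-1/2} (∫₀¹ μ (ψ_b(μ) − T_b⁴)² dμ)^{1/2}. Suppose (T, ψ) is a classical solution of the nonlinear Milne problem with data (T_b, ψ_b) and bound γ which moreover satisfies the weighted estimate: ∫₀^∞ e^{2αx} 4T(x)³ T'(x)² dx + (1−α) ∫₀^∞ ∫_{-1}^{1} e^{2αx} (ψ(x,μ) − T(x)⁴)² dμ dx ≤ (1/2) ∫₀¹ μ (ψ_b(μ)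 − T_b⁴)² dμ. Then there exists a constant T_∞ ≥ 0 such that for all x ≥ 0: |T(x) − T_∞| ≤ M_α e^{-αx}; for every μ ∈ (0,1], |ψ(x,μ) − T_∞⁴| ≤ |ψ_b(μ) − T_b⁴| e^{-x/μ} + 4 (T_b + 2M_α)³ M_α e^{-αx} / (1 − μα); for every μ ∈ [-1,0), |ψ(x,μ) − T_∞⁴| ≤ 4 (T_b + 2M_α)³ M_α e^{-αx} / (1 − μα). Moreover T_∞ ≤ T_b + M_α and |T(x)| ≤ T_b + 2M_α for all x ≥ 0. -/
open MeasureTheory Set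

lemma antitoneOn_Ici_of_hasDerivAt_nonpos {f f' : ℝ → ℝ} (hc : ContinuousOn f (Ici 0))
    (hd : ∀ x > 0, HasDerivAt f (f' x) x) (hf' : ∀ x > 0, f' x ≤ 0) :
    AntitoneOn f (Ici 0) := by
  refine antitoneOn_of_hasDerivWithinAt_nonpos (convex_Ici 0) hc (f' := f') ?_ ?_
  · intro x hx
    rw [interior_Ici] at hx
    exact (hd x hx).hasDerivWithinAt
  · intro x hx
    rw [interior_Ici] at hx
    exact hf' x hx

lemma eq_of_hasDerivAt_zero_Ici {f : ℝ → ℝ} (hc : ContinuousOn f (Ici 0))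
    (hd : ∀ x > 0, HasDerivAt f 0 x) {x : ℝ} (hx : 0 ≤ x) : f x = f 0 := by
  have h1 := antitoneOn_Ici_of_hasDerivAt_nonpos hc hd (fun _ _ => le_rfl)
    (mem_Ici.2 le_rfl) (mem_Ici.2 hx) hx
  have h2 := antitoneOn_Ici_of_hasDerivAt_nonpos (f := fun x => -f x) (f' := fun _ => 0) hc.neg
    (fun y hy => by simpa using (hd y hy).fun_neg) (fun _ _ => le_rfl)
    (mem_Ici.2 le_rfl) (mem_Ici.2 hx) hx
  simp only at h2
  linarith

lemma hasDerivAt_integral_of_bounded {φ φ' : ℝ → ℝ → ℝ} {C x : ℝ} (hx : 0 < x)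
    (hmeas : ∀ y > 0, AEStronglyMeasurable (φ y) (volume.restrict (uIoc (-1) 1)))
    (hmeas' : AEStronglyMeasurable (φ' x) (volume.restrict (uIoc (-1) 1)))
    (hint : IntervalIntegrable (φ x) volume (-1) 1)
    (hbd : ∀ y > 0, ∀ μ ∈ Icc (-1 : ℝ) 1, |φ' y μ| ≤ C)
    (hd : ∀ μ ∈ Icc (-1 : ℝ) 1, μ ≠ 0 → ∀ y > 0, HasDerivAt (fun z => φ z μ) (φ' y μ) y) :
    HasDerivAt (fun y => ∫ μ in (-1 : ℝ)..1, φ y μ) (∫ μ in (-1 : ℝ)..1, φ' x μ) x := by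
  have hsub : ∀ μ ∈ uIoc (-1 : ℝ) 1, μ ∈ Icc (-1 : ℝ) 1 := fun μ hμ => by
    rw [uIoc_of_le (by norm_num)] at hμ
    exact Ioc_subset_Icc_self hμ
  refine (intervalIntegral.hasDerivAt_integral_of_dominated_loc_of_deriv_le
    (s := Ioi 0) (bound := fun _ => C) (Ioi_mem_nhds hx) ?_ hint hmeas' ?_ (by simp) ?_).2
  · filter_upwards [Ioi_mem_nhds hx] with y hy using hmeas y hy
  · exact Filter.Eventually.of_forall fun μ hμ y hy => hbd y hy μ (hsub μ hμ)
  · filter_upwards [Measure.ae_ne volume (0 : ℝ)] with μ hμ0 hμ y hy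
    exact hd μ (hsub μ hμ) hμ0 y hy

lemma continuousOn_integral_of_bounded {φ : ℝ → ℝ → ℝ} {C : ℝ}
    (hmeas : ∀ y ≥ 0, AEStronglyMeasurable (φ y) (volume.restrict (uIoc (-1) 1)))
    (hbd : ∀ y ≥ 0, ∀ μ ∈ Icc (-1 : ℝ) 1, |φ y μ| ≤ C)
    (hc : ∀ μ ∈ Icc (-1 : ℝ) 1, μ ≠ 0 → ContinuousOn (fun y => φ y μ) (Ici 0)) :
    ContinuousOn (fun y => ∫ μ in (-1 : ℝ)..1, φ y μ) (Ici 0) := by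
  have hsub : ∀ μ ∈ uIoc (-1 : ℝ) 1, μ ∈ Icc (-1 : ℝ) 1 := fun μ hμ => by
    rw [uIoc_of_le (by norm_num)] at hμ
    exact Ioc_subset_Icc_self hμ
  intro x hx
  refine intervalIntegral.continuousWithinAt_of_dominated_interval (bound := fun _ => C)
    ?_ ?_ (by simp) ?_
  · filter_upwards [self_mem_nhdsWithin] with y hy using hmeas y hy
  · filter_upwards [self_mem_nhdsWithin] with y hy
    exact Filter.Eventually.of_forall fun μ hμ => hbd y hy μ (hsub μ hμ)
  · filter_upwards [Measure.ae_ne volume (0 : ℝ)] with μ hμ0 hμ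
    exact hc μ (hsub μ hμ) hμ0 x hx

lemma intervalIntegrable_of_bounded {f : ℝ → ℝ} {C : ℝ}
    (hmeas : AEStronglyMeasurable f (volume.restrict (uIoc (-1) 1)))
    (hbd : ∀ μ ∈ Icc (-1 : ℝ) 1, |f μ| ≤ C) : IntervalIntegrable f volume (-1) 1 := by
  refine (intervalIntegrable_const (c := C)).mono_fun hmeas ?_
  refine (ae_restrict_iff' measurableSet_uIoc).2 (Filter.Eventually.of_forall fun μ hμ => ?_)
  rw [uIoc_of_le (by norm_num)] at hμ
  exact (hbd μ (Ioc_subset_Icc_self hμ)).trans (le_abs_self C)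

/-- A bounded solution `ψ` of the transport equation `μ ∂ₓψ + ψ = T⁴` on the half-line, with the
regularity needed to differentiate its angular moments. -/
structure IsTransportSolution (γ : ℝ) (T : ℝ → ℝ) (ψ : ℝ → ℝ → ℝ) : Prop where
  continuousOn_temp : ContinuousOn T (Ici 0)
  temp_mem : ∀ x ≥ 0, T x ∈ Icc 0 γ
  mem : ∀ x ≥ 0, ∀ μ ∈ Icc (-1 : ℝ) 1, ψ x μ ∈ Icc 0 (γ ^ 4)
  meas : ∀ x ≥ 0, AEStronglyMeasurable (ψ x) (volume.restrict (uIoc (-1) 1))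
  cont : ∀ μ ∈ Icc (-1 : ℝ) 1, μ ≠ 0 → ContinuousOn (fun x => ψ x μ) (Ici 0)
  deriv : ∀ μ ∈ Icc (-1 : ℝ) 1, μ ≠ 0 → ∀ x > 0,
    HasDerivAt (fun y => ψ y μ) ((T x ^ 4 - ψ x μ) / μ) x

namespace IsTransportSolution

variable {γ : ℝ} {T : ℝ → ℝ} {ψ : ℝ → ℝ → ℝ}

lemma temp_pow_mem (h : IsTransportSolution γ T ψ) {x : ℝ} (hx : 0 ≤ x) :
    T x ^ 4 ∈ Icc 0 (γ ^ 4) := by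
  obtain ⟨h0, h1⟩ := h.temp_mem x hx
  exact ⟨by positivity, by gcongr⟩

lemma abs_sub_le (h : IsTransportSolution γ T ψ) {x μ : ℝ} (hx : 0 ≤ x)
    (hμ : μ ∈ Icc (-1 : ℝ) 1) : |ψ x μ - T x ^ 4| ≤ γ ^ 4 := by
  have h1 := h.temp_pow_mem hx
  have h2 := h.mem x hx μ hμ
  rw [abs_le]
  exact ⟨by linarith [h1.2, h2.1], by linarith [h1.1, h2.2]⟩

lemma meas_sub (h : IsTransportSolution γ T ψ) {x : ℝ} (hx : 0 ≤ x) :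
    AEStronglyMeasurable (fun μ => ψ x μ - T x ^ 4) (volume.restrict (uIoc (-1) 1)) :=
  (h.meas x hx).sub aestronglyMeasurable_const

lemma intervalIntegrable_mul (h : IsTransportSolution γ T ψ) {p : ℝ → ℝ} (hp : Continuous p)
    {x : ℝ} (hx : 0 ≤ x) : IntervalIntegrable (fun μ => p μ * ψ x μ) volume (-1) 1 := by
  have h1 : IntervalIntegrable (ψ x) volume (-1) 1 :=
    intervalIntegrable_of_bounded (h.meas x hx)
      (fun μ hμ => by rw [abs_of_nonneg (h.mem x hx μ hμ).1]; exact (h.mem x hx μ hμ).2)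
  exact h1.continuousOn_mul hp.continuousOn

lemma intervalIntegrable_id_mul (h : IsTransportSolution γ T ψ) {x : ℝ} (hx : 0 ≤ x) :
    IntervalIntegrable (fun μ => μ * ψ x μ) volume (-1) 1 :=
  h.intervalIntegrable_mul continuous_id hx

lemma continuousOn_moment (h : IsTransportSolution γ T ψ) {p : ℝ → ℝ} (hp : Continuous p)
    (hp1 : ∀ μ ∈ Icc (-1 : ℝ) 1, |p μ| ≤ 1) :
    ContinuousOn (fun x => ∫ μ in (-1 : ℝ)..1, p μ * ψ x μ) (Ici 0) := by
  refine continuousOn_integral_of_bounded (C := γ ^ 4) ?_ ?_ ?_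
  · exact fun y hy => hp.aestronglyMeasurable.mul (h.meas y hy)
  · intro y hy μ hμ
    have := h.mem y hy μ hμ
    rw [abs_mul, abs_of_nonneg this.1]
    nlinarith [hp1 μ hμ, this.1, this.2, abs_nonneg (p μ)]
  · exact fun μ hμ h0 => continuousOn_const.mul (h.cont μ hμ h0)

/-- Each angular moment with weight `μ p(μ)` is differentiable, by the transport equation. -/
lemma hasDerivAt_moment (h : IsTransportSolution γ T ψ) {p : ℝ → ℝ} (hp : Continuous p)
    (hp1 : ∀ μ ∈ Icc (-1 : ℝ) 1, |p μ| ≤ 1) {x : ℝ} (hx : 0 < x) :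
    HasDerivAt (fun x => ∫ μ in (-1 : ℝ)..1, (μ * p μ) * ψ x μ)
      (∫ μ in (-1 : ℝ)..1, p μ * (T x ^ 4 - ψ x μ)) x := by
  refine hasDerivAt_integral_of_bounded (φ' := fun x μ => p μ * (T x ^ 4 - ψ x μ))
    (C := γ ^ 4) hx ?_ ?_ ?_ ?_ ?_
  · exact fun y hy => (continuous_id.mul hp).aestronglyMeasurable.mul (h.meas y hy.le)
  · exact hp.aestronglyMeasurable.mul (aestronglyMeasurable_const.sub (h.meas x hx.le))
  · exact h.intervalIntegrable_mul (continuous_id.mul hp) hx.le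
  · intro y hy μ hμ
    rw [abs_mul, abs_sub_comm]
    nlinarith [hp1 μ hμ, h.abs_sub_le hy.le hμ, abs_nonneg (p μ), abs_nonneg (ψ y μ - T y ^ 4)]
  · intro μ hμ h0 y hy
    refine ((h.deriv μ hμ h0 y hy).const_mul (μ * p μ)).congr_deriv ?_
    field_simp

lemma abs_moment_le (h : IsTransportSolution γ T ψ) {p : ℝ → ℝ}
    (hp1 : ∀ μ ∈ Icc (-1 : ℝ) 1, |p μ| ≤ 1) {x : ℝ} (hx : 0 ≤ x) :
    |∫ μ in (-1 : ℝ)..1, p μ * ψ x μ| ≤ 2 * γ ^ 4 := by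
  have : ∀ μ ∈ uIoc (-1 : ℝ) 1, ‖p μ * ψ x μ‖ ≤ γ ^ 4 := by
    intro μ hμ
    rw [uIoc_of_le (by norm_num)] at hμ
    have hμ := Ioc_subset_Icc_self hμ
    have := h.mem x hx μ hμ
    rw [Real.norm_eq_abs, abs_mul, abs_of_nonneg this.1]
    nlinarith [hp1 μ hμ, this.1, this.2, abs_nonneg (p μ)]
  have := intervalIntegral.norm_integral_le_of_norm_le_const this
  rw [Real.norm_eq_abs] at this
  refine this.trans (le_of_eq ?_)
  norm_num
  ring

/-- Conservation of the total flux: the temperature gradient equals the radiative flux. -/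
lemma deriv_temp_eq_flux (h : IsTransportSolution γ T ψ) {T' T'' : ℝ → ℝ}
    (hT' : ContinuousOn T' (Ici 0)) (hdT : ∀ x > 0, HasDerivAt T (T' x) x)
    (hdT' : ∀ x > 0, HasDerivAt T' (T'' x) x)
    (hode : ∀ x > 0, T'' x + (∫ μ in (-1 : ℝ)..1, (ψ x μ - T x ^ 4)) = 0)
    {x : ℝ} (hx : 0 ≤ x) : T' x = ∫ μ in (-1 : ℝ)..1, μ * ψ x μ := by
  have hid : ∀ μ ∈ Icc (-1 : ℝ) 1, |μ| ≤ 1 := fun μ hμ => abs_le.2 hμ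
  have hsq : ∀ μ ∈ Icc (-1 : ℝ) 1, |μ * μ| ≤ 1 := fun μ hμ => by
    rw [abs_mul]; nlinarith [hid μ hμ, abs_nonneg μ]
  set m : ℝ → ℝ := fun x => ∫ μ in (-1 : ℝ)..1, μ * ψ x μ
  set q : ℝ → ℝ := fun x => ∫ μ in (-1 : ℝ)..1, (μ * μ) * ψ x μ
  have hm : ContinuousOn m (Ici 0) := h.continuousOn_moment continuous_id hid
  have hq : ContinuousOn q (Ici 0) :=
    h.continuousOn_moment (continuous_id.mul continuous_id) hsq
  have hdm : ∀ x > 0, HasDerivAt m (T'' x) x := by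
    intro x hx
    have := h.hasDerivAt_moment (p := fun _ => 1) continuous_const (by simp) hx
    simp only [mul_one, one_mul] at this
    convert this using 1
    rw [eq_neg_of_add_eq_zero_left (hode x hx), ← intervalIntegral.integral_neg]
    simp
  have hdq : ∀ x > 0, HasDerivAt q (-m x) x := by
    intro x hx
    convert h.hasDerivAt_moment (p := fun μ => μ) continuous_id hid hx using 1
    simp only [mul_sub]
    rw [intervalIntegral.integral_sub
      (Continuous.intervalIntegrable (by fun_prop) _ _)
      (h.intervalIntegrable_id_mul hx.le)]
    simp [m]
  have hconst : ∀ x ≥ 0, T' x - m x = T' 0 - m 0 := fun x hx =>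
    eq_of_hasDerivAt_zero_Ici (f := fun x => T' x - m x) (hT'.sub hm)
      (fun y hy => by simpa using (hdT' y hy).fun_sub (hdm y hy)) hx
  set c := T' 0 - m 0
  have hlin : ∀ x ≥ 0, T x + q x - c * x = T 0 + q 0 := fun x hx => by
    have := eq_of_hasDerivAt_zero_Ici (f := fun x => T x + q x - c * x)
      ((h.continuousOn_temp.add hq).sub (continuousOn_const.mul continuousOn_id))
      (fun y hy => by
        refine (((hdT y hy).fun_add (hdq y hy)).fun_sub
            ((hasDerivAt_id y).const_mul c)).congr_deriv ?_
        linarith [hconst y hy.le]) hx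
    simpa using this
  have hqb : ∀ x ≥ 0, |q x| ≤ 2 * γ ^ 4 := fun x hx => h.abs_moment_le hsq hx
  have hc : c = 0 := by
    by_contra hc
    have hB : ∀ x ≥ 0, |c| * x ≤ 2 * γ + 4 * γ ^ 4 := by
      intro x hx
      have habs : |c| * x = |c * x| := by rw [abs_mul, abs_of_nonneg hx]
      rw [habs]
      have h0 := h.temp_mem 0 le_rfl
      have h1 := h.temp_mem x hx
      have h2 := abs_le.1 (hqb 0 le_rfl)
      have h3 := abs_le.1 (hqb x hx)
      have := hlin x hx
      rw [abs_le]
      constructor <;> linarith [h0.1, h0.2, h1.1, h1.2]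
    have hγ : 0 ≤ γ := (h.temp_mem 0 le_rfl).1.trans (h.temp_mem 0 le_rfl).2
    have hc' := abs_pos.2 hc
    have := hB ((2 * γ + 4 * γ ^ 4 + 1) / |c|) (by positivity)
    rw [mul_div_cancel₀ _ hc'.ne'] at this
    linarith
  linarith [hconst x hx]

/-- Cauchy–Schwarz: the squared flux is controlled by the deviation from equilibrium. -/
lemma flux_sq_le (h : IsTransportSolution γ T ψ) {x : ℝ} (hx : 0 ≤ x) :
    3 / 2 * (∫ μ in (-1 : ℝ)..1, μ * ψ x μ) ^ 2 ≤ ∫ μ in (-1 : ℝ)..1, (ψ x μ - T x ^ 4) ^ 2 := by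
  set m := ∫ μ in (-1 : ℝ)..1, μ * ψ x μ with hm
  have hsq : IntervalIntegrable (fun μ => (ψ x μ - T x ^ 4) ^ 2) volume (-1) 1 :=
    intervalIntegrable_of_bounded ((h.meas_sub hx).pow 2) (C := (γ ^ 4) ^ 2) fun μ hμ => by
      rw [abs_pow]; gcongr; exact h.abs_sub_le hx hμ
  have hlin := h.intervalIntegrable_id_mul hx
  have hpoly : Continuous fun μ : ℝ => 3 * m * (μ * T x ^ 4) + 9 / 4 * m ^ 2 * μ ^ 2 := by
    fun_prop
  have h0 : 0 ≤ ∫ μ in (-1 : ℝ)..1, ((ψ x μ - T x ^ 4) - 3 / 2 * m * μ) ^ 2 :=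
    intervalIntegral.integral_nonneg (by norm_num) fun μ _ => sq_nonneg _
  have h1 : ∫ μ in (-1 : ℝ)..1, ((ψ x μ - T x ^ 4) - 3 / 2 * m * μ) ^ 2
      = (∫ μ in (-1 : ℝ)..1, (ψ x μ - T x ^ 4) ^ 2) - 3 * m * m + 3 / 2 * m ^ 2 := by
    have : ∀ μ, ((ψ x μ - T x ^ 4) - 3 / 2 * m * μ) ^ 2 =
        ((ψ x μ - T x ^ 4) ^ 2 - 3 * m * (μ * ψ x μ)) +
          (3 * m * (μ * T x ^ 4) + 9 / 4 * m ^ 2 * μ ^ 2) := fun μ => by ring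
    simp only [this]
    rw [intervalIntegral.integral_add (hsq.sub (hlin.const_mul _)) (hpoly.intervalIntegrable _ _),
      intervalIntegral.integral_sub hsq (hlin.const_mul _), intervalIntegral.integral_const_mul,
      ← hm, intervalIntegral.integral_add (Continuous.intervalIntegrable (by fun_prop) _ _)
        (Continuous.intervalIntegrable (by fun_prop) _ _)]
    simp only [intervalIntegral.integral_const_mul, intervalIntegral.integral_mul_const,
      integral_pow, integral_id]
    norm_num
    ring
  nlinarith

/-- The entropy balance of the transport equation coupled to `T' = ∫ μψ`. -/
lemma hasDerivAt_entropy_flux (h : IsTransportSolution γ T ψ) {T' : ℝ → ℝ}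
    (hdT : ∀ x > 0, HasDerivAt T (T' x) x)
    (hflux : ∀ x ≥ 0, T' x = ∫ μ in (-1 : ℝ)..1, μ * ψ x μ) {x : ℝ} (hx : 0 < x) :
    HasDerivAt (fun x => ∫ μ in (-1 : ℝ)..1, μ * (ψ x μ - T x ^ 4) ^ 2)
      (-2 * (∫ μ in (-1 : ℝ)..1, (ψ x μ - T x ^ 4) ^ 2) - 8 * T x ^ 3 * T' x ^ 2) x := by
  have hγ : 0 ≤ γ := (h.temp_mem 0 le_rfl).1.trans (h.temp_mem 0 le_rfl).2
  have hT'b : ∀ y ≥ 0, |T' y| ≤ 2 * γ ^ 4 := fun y hy => by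
    rw [hflux y hy]
    exact h.abs_moment_le (p := fun μ => μ) (fun μ hμ => abs_le.2 hμ) hy
  have hsq : ∀ y ≥ 0, ∀ μ ∈ Icc (-1 : ℝ) 1, |(ψ y μ - T y ^ 4) ^ 2| ≤ (γ ^ 4) ^ 2 :=
    fun y hy μ hμ => by rw [abs_pow]; gcongr; exact h.abs_sub_le hy hμ
  have hsqi : IntervalIntegrable (fun μ => (ψ x μ - T x ^ 4) ^ 2) volume (-1) 1 :=
    intervalIntegrable_of_bounded ((h.meas_sub hx.le).pow 2) (hsq x hx.le)
  have hlin : IntervalIntegrable (fun μ => μ * (ψ x μ - T x ^ 4)) volume (-1) 1 := by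
    simp only [mul_sub]
    exact (h.intervalIntegrable_id_mul hx.le).sub
      (Continuous.intervalIntegrable (by fun_prop) _ _)
  have hflux' : ∫ μ in (-1 : ℝ)..1, μ * (ψ x μ - T x ^ 4) = T' x := by
    simp only [mul_sub]
    rw [intervalIntegral.integral_sub (h.intervalIntegrable_id_mul hx.le)
      (Continuous.intervalIntegrable (by fun_prop) _ _), hflux x hx.le]
    simp
  have key := hasDerivAt_integral_of_bounded
    (φ := fun y μ => μ * (ψ y μ - T y ^ 4) ^ 2)
    (φ' := fun y μ => -2 * (ψ y μ - T y ^ 4) ^ 2 - 8 * T y ^ 3 * T' y * (μ * (ψ y μ - T y ^ 4)))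
    (C := 2 * (γ ^ 4) ^ 2 + 8 * γ ^ 3 * (2 * γ ^ 4) * (1 * γ ^ 4)) hx
    (fun y hy => aestronglyMeasurable_id.mul ((h.meas_sub hy.le).pow 2))
    ((aestronglyMeasurable_const.mul ((h.meas_sub hx.le).pow 2)).sub
      (aestronglyMeasurable_const.mul (aestronglyMeasurable_id.mul (h.meas_sub hx.le))))
    (hsqi.continuousOn_mul continuousOn_id) ?_ ?_
  · convert key using 1
    rw [intervalIntegral.integral_sub (hsqi.const_mul _) (hlin.const_mul _),
      intervalIntegral.integral_const_mul, intervalIntegral.integral_const_mul, hflux']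
    ring
  · intro y hy μ hμ
    refine (abs_sub _ _).trans (add_le_add ?_ ?_)
    · rw [abs_mul]
      have := hsq y hy.le μ hμ
      norm_num at this ⊢
      exact this
    · have h1 := h.temp_mem y hy.le
      have h2 : |8 * T y ^ 3| ≤ 8 * γ ^ 3 := by
        rw [abs_of_nonneg (mul_nonneg (by norm_num) (pow_nonneg h1.1 3))]
        gcongr
        · exact h1.1
        · exact h1.2
      rw [abs_mul, abs_mul, abs_mul μ]
      gcongr
      · exact hT'b y hy.le
      · exact abs_le.2 hμ
      · exact h.abs_sub_le hy.le hμ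
  · intro μ hμ h0 y hy
    refine ((((h.deriv μ hμ h0 y hy).fun_sub ((hdT y hy).fun_pow 4)).fun_pow 2).const_mul
      μ).congr_deriv ?_
    field_simp
    push_cast
    ring

lemma continuousOn_entropy_flux (h : IsTransportSolution γ T ψ) :
    ContinuousOn (fun x => ∫ μ in (-1 : ℝ)..1, μ * (ψ x μ - T x ^ 4) ^ 2) (Ici 0) := by
  refine continuousOn_integral_of_bounded (C := 1 * (γ ^ 4) ^ 2) ?_ ?_ ?_
  · exact fun y hy => aestronglyMeasurable_id.mul ((h.meas_sub hy).pow 2)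
  · intro y hy μ hμ
    rw [abs_mul, abs_pow]
    gcongr
    · exact abs_le.2 hμ
    · exact h.abs_sub_le hy hμ
  · exact fun μ hμ h0 =>
      continuousOn_const.mul (((h.cont μ hμ h0).sub (h.continuousOn_temp.pow 4)).pow 2)

lemma abs_entropy_flux_le (h : IsTransportSolution γ T ψ) {x : ℝ} (hx : 0 ≤ x) :
    |∫ μ in (-1 : ℝ)..1, μ * (ψ x μ - T x ^ 4) ^ 2| ≤ ∫ μ in (-1 : ℝ)..1, (ψ x μ - T x ^ 4) ^ 2 := by
  have hsqi : IntervalIntegrable (fun μ => (ψ x μ - T x ^ 4) ^ 2) volume (-1) 1 :=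
    intervalIntegrable_of_bounded ((h.meas_sub hx).pow 2) (C := (γ ^ 4) ^ 2) fun μ hμ => by
      rw [abs_pow]; gcongr; exact h.abs_sub_le hx hμ
  rw [← Real.norm_eq_abs]
  refine intervalIntegral.norm_integral_le_of_norm_le (by norm_num)
    (Filter.Eventually.of_forall fun μ hμ => ?_) hsqi
  rw [Real.norm_eq_abs, abs_mul, abs_of_nonneg (sq_nonneg (ψ x μ - T x ^ 4))]
  exact mul_le_of_le_one_left (sq_nonneg _) (abs_le.2 (Ioc_subset_Icc_self hμ))

lemma entropy_flux_nonneg (h : IsTransportSolution γ T ψ) {T' : ℝ → ℝ}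
    (hdT : ∀ x > 0, HasDerivAt T (T' x) x)
    (hflux : ∀ x ≥ 0, T' x = ∫ μ in (-1 : ℝ)..1, μ * ψ x μ) {x : ℝ} (hx : 0 ≤ x) :
    0 ≤ ∫ μ in (-1 : ℝ)..1, μ * (ψ x μ - T x ^ 4) ^ 2 := by
  set E : ℝ → ℝ := fun x => ∫ μ in (-1 : ℝ)..1, μ * (ψ x μ - T x ^ 4) ^ 2 with hE
  have hdE := fun y hy => h.hasDerivAt_entropy_flux hdT hflux (x := y) hy
  have hdiss : ∀ y > 0, -2 * (∫ μ in (-1 : ℝ)..1, (ψ y μ - T y ^ 4) ^ 2)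
      - 8 * T y ^ 3 * T' y ^ 2 ≤ -2 * |E y| := fun y hy => by
    have := h.abs_entropy_flux_le hy.le
    have h3 := pow_nonneg (h.temp_mem y hy.le).1 3
    have : 0 ≤ T y ^ 3 * T' y ^ 2 := by positivity
    simp only [hE]
    linarith
  have hanti : AntitoneOn E (Ici 0) := antitoneOn_Ici_of_hasDerivAt_nonpos
    h.continuousOn_entropy_flux hdE fun y hy => by linarith [hdiss y hy, abs_nonneg (E y)]
  by_contra! hneg
  change E x < 0 at hneg
  have hlin : ∀ z ≥ 0, E (x + z) - 2 * E x * z ≤ E x := by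
    intro z hz
    have := antitoneOn_Ici_of_hasDerivAt_nonpos (f := fun z => E (x + z) - 2 * E x * z)
      (f' := fun z => (-2 * (∫ μ in (-1 : ℝ)..1, (ψ (x + z) μ - T (x + z) ^ 4) ^ 2)
      - 8 * T (x + z) ^ 3 * T' (x + z) ^ 2) - 2 * E x) ?_ ?_ ?_
      (mem_Ici.2 le_rfl) (mem_Ici.2 hz) hz
    · simpa using this
    · refine ContinuousOn.sub (h.continuousOn_entropy_flux.comp
        (continuous_const.add continuous_id).continuousOn fun z hz => ?_)
        (continuousOn_const.mul continuousOn_id)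
      exact add_nonneg hx hz
    · intro z hz
      simpa using ((hdE (x + z) (by linarith)).comp_const_add x z).fun_sub
        ((hasDerivAt_id z).const_mul (2 * E x))
    · intro z hz
      have h1 := hdiss (x + z) (by linarith)
      have h2 : E (x + z) ≤ E x :=
        hanti (mem_Ici.2 hx) (mem_Ici.2 (by linarith)) (by linarith)
      rw [abs_of_neg (by linarith)] at h1
      linarith
  have hbd : ∀ y ≥ 0, |E y| ≤ 2 * (γ ^ 4) ^ 2 := by
    intro y hy
    have : ∀ μ ∈ uIoc (-1 : ℝ) 1, ‖μ * (ψ y μ - T y ^ 4) ^ 2‖ ≤ 1 * (γ ^ 4) ^ 2 := by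
      intro μ hμ
      rw [uIoc_of_le (by norm_num)] at hμ
      have hμ := Ioc_subset_Icc_self hμ
      rw [Real.norm_eq_abs, abs_mul, abs_pow]
      gcongr
      · exact abs_le.2 hμ
      · exact h.abs_sub_le hy hμ
    have := intervalIntegral.norm_integral_le_of_norm_le_const this
    rw [Real.norm_eq_abs] at this
    refine this.trans (le_of_eq ?_)
    norm_num
    ring
  have hz : 0 ≤ (γ ^ 4) ^ 2 / (-E x) := div_nonneg (by positivity) (by linarith)
  have h1 := hlin _ hz
  have h2 := (abs_le.1 (hbd _ (add_nonneg hx hz))).1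
  have h3 : E x * ((γ ^ 4) ^ 2 / (-E x)) = -(γ ^ 4) ^ 2 := by
    rw [div_neg, mul_neg, mul_div_cancel₀ _ hneg.ne]
  linarith

/-- Outgoing directions: relaxation towards the limit of the source. -/
lemma abs_sub_le_of_pos (h : IsTransportSolution γ T ψ) {α K L μ x : ℝ} (hα : α ∈ Ioo (0 : ℝ) 1)
    (hT : ∀ x ≥ 0, |T x ^ 4 - L| ≤ K * Real.exp (-α * x)) (hμ : μ ∈ Ioc (0 : ℝ) 1)
    (hx : 0 ≤ x) :
    |ψ x μ - L| ≤ |ψ 0 μ - L| * Real.exp (-x / μ)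
      + K * (Real.exp (-α * x) - Real.exp (-x / μ)) / (1 - μ * α) := by
  have hμ1 : μ ∈ Icc (-1 : ℝ) 1 := ⟨by linarith [hμ.1], hμ.2⟩
  have hμ0 := hμ.1
  have hd : 0 < 1 - μ * α := by nlinarith [hμ.1, hμ.2, hα.1, hα.2]
  have key : ∀ σ : ℝ, |σ| = 1 → σ * (ψ x μ - L) ≤ |ψ 0 μ - L| * Real.exp (-x / μ)
      + K * (Real.exp (-α * x) - Real.exp (-x / μ)) / (1 - μ * α) := by
    intro σ hσ
    have hanti := antitoneOn_Ici_of_hasDerivAt_nonpos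
      (f := fun x => σ * ((ψ x μ - L) * Real.exp (x / μ))
        - K / (1 - μ * α) * Real.exp ((1 / μ - α) * x))
      (f' := fun x => Real.exp (x / μ) / μ * (σ * (T x ^ 4 - L) - K * Real.exp (-α * x)))
      ?_ ?_ ?_ (mem_Ici.2 le_rfl) (mem_Ici.2 hx) hx
    · have h0 : σ * (ψ 0 μ - L) ≤ |ψ 0 μ - L| := by
        simpa [abs_mul, hσ] using le_abs_self (σ * (ψ 0 μ - L))
      have e1 : Real.exp ((1 / μ - α) * x) = Real.exp (x / μ) * Real.exp (-α * x) := by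
        rw [← Real.exp_add]; congr 1; ring
      have e2 : Real.exp (x / μ) * Real.exp (-x / μ) = 1 := by
        rw [← Real.exp_add, ← Real.exp_zero]; congr 1; ring
      simp only [e1, zero_div, mul_zero, Real.exp_zero, mul_one] at hanti
      have := mul_le_mul_of_nonneg_right hanti (Real.exp_pos (-x / μ)).le
      have e3 := mul_le_mul_of_nonneg_right h0 (Real.exp_pos (-x / μ)).le
      have e4 : (σ * ((ψ x μ - L) * Real.exp (x / μ))
          - K / (1 - μ * α) * (Real.exp (x / μ) * Real.exp (-α * x))) * Real.exp (-x / μ)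
          = σ * (ψ x μ - L) - K / (1 - μ * α) * Real.exp (-α * x) := by
        linear_combination (σ * (ψ x μ - L) - K / (1 - μ * α) * Real.exp (-α * x)) * e2
      rw [e4] at this
      have e5 : K * (Real.exp (-α * x) - Real.exp (-x / μ)) / (1 - μ * α)
          = K / (1 - μ * α) * Real.exp (-α * x) - K / (1 - μ * α) * Real.exp (-x / μ) := by ring
      rw [e5]
      linarith
    · exact (continuousOn_const.mul (((h.cont μ hμ1 hμ0.ne').sub continuousOn_const).mul
        (Continuous.continuousOn (by fun_prop)))).sub (Continuous.continuousOn (by fun_prop))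
    · intro y hy
      refine (((((h.deriv μ hμ1 hμ0.ne' y hy).sub_const L).fun_mul
        ((hasDerivAt_id y).div_const μ).exp).const_mul σ).fun_sub
        ((((hasDerivAt_id y).const_mul (1 / μ - α)).exp).const_mul
          (K / (1 - μ * α)))).congr_deriv ?_
      have e1 : Real.exp ((1 / μ - α) * y) = Real.exp (y / μ) * Real.exp (-α * y) := by
        rw [← Real.exp_add]; congr 1; ring
      simp only [id, e1]
      field_simp
      ring
    · intro y hy
      refine mul_nonpos_of_nonneg_of_nonpos (by positivity) ?_
      have := (le_abs_self (σ * (T y ^ 4 - L))).trans_eq (by rw [abs_mul, hσ, one_mul])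
      linarith [hT y hy.le]
  rw [abs_le]
  have h1 := key 1 (by simp)
  have h2 := key (-1) (by simp)
  constructor <;> linarith

/-- Incoming directions: a bounded solution is controlled by the decay of the source. -/
lemma abs_sub_le_of_neg (h : IsTransportSolution γ T ψ) {α K L μ x : ℝ} (hα : α ∈ Ioo (0 : ℝ) 1)
    (hK : 0 ≤ K) (hT : ∀ x ≥ 0, |T x ^ 4 - L| ≤ K * Real.exp (-α * x))
    (hμ : μ ∈ Ico (-1 : ℝ) 0) (hx : 0 ≤ x) :
    |ψ x μ - L| ≤ K * Real.exp (-α * x) / (1 - μ * α) := by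
  have hμ1 : μ ∈ Icc (-1 : ℝ) 1 := ⟨hμ.1, by linarith [hμ.2]⟩
  have hμ0 : μ < 0 := hμ.2
  have hd : 0 < 1 - μ * α := by nlinarith [hμ.1, hμ.2, hα.1, hα.2]
  have hexp : ∀ y, Real.exp ((1 / μ - α) * y) = Real.exp (y / μ) * Real.exp (-α * y) := by
    intro y; rw [← Real.exp_add]; congr 1; ring
  have key : ∀ σ : ℝ, |σ| = 1 → 0 ≤ σ * (ψ x μ - L) + K * Real.exp (-α * x) / (1 - μ * α) := by
    intro σ hσ
    have hanti : AntitoneOn (fun x => σ * ((ψ x μ - L) * Real.exp (x / μ))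
        + K / (1 - μ * α) * Real.exp ((1 / μ - α) * x)) (Ici 0) := by
      refine antitoneOn_Ici_of_hasDerivAt_nonpos
        (f' := fun x => Real.exp (x / μ) / μ * (σ * (T x ^ 4 - L) + K * Real.exp (-α * x)))
        ?_ ?_ ?_
      · exact (continuousOn_const.mul (((h.cont μ hμ1 hμ0.ne).sub continuousOn_const).mul
          (Continuous.continuousOn (by fun_prop)))).add (Continuous.continuousOn (by fun_prop))
      · intro y hy
        refine (((((h.deriv μ hμ1 hμ0.ne y hy).sub_const L).fun_mul
          ((hasDerivAt_id y).div_const μ).exp).const_mul σ).fun_add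
          ((((hasDerivAt_id y).const_mul (1 / μ - α)).exp).const_mul
            (K / (1 - μ * α)))).congr_deriv ?_
        simp only [id, hexp]
        have := hμ0.ne
        field_simp
        ring
      · intro y hy
        refine mul_nonpos_of_nonpos_of_nonneg
          (div_nonpos_of_nonneg_of_nonpos (Real.exp_pos _).le hμ0.le) ?_
        have := (neg_abs_le (σ * (T y ^ 4 - L)))
        rw [abs_mul, hσ, one_mul] at this
        linarith [hT y hy.le]
    have hlow : ∀ z ≥ x, -(γ ^ 4 + |L|) * Real.exp (z / μ) ≤ σ * ((ψ x μ - L) * Real.exp (x / μ))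
        + K / (1 - μ * α) * Real.exp ((1 / μ - α) * x) := by
      intro z hz
      refine le_trans ?_ (hanti (mem_Ici.2 hx) (mem_Ici.2 (hx.trans hz)) hz)
      have h1 := h.mem z (hx.trans hz) μ hμ1
      have h2 : |σ * (ψ z μ - L)| ≤ γ ^ 4 + |L| := by
        rw [abs_mul, hσ, one_mul]
        refine (abs_sub _ _).trans ?_
        rw [abs_of_nonneg h1.1]
        linarith [h1.2]
      have h3 := (abs_le.1 h2).1
      have h4 : 0 ≤ K / (1 - μ * α) * Real.exp ((1 / μ - α) * z) := by positivity
      have h5 := mul_le_mul_of_nonneg_right h3 (Real.exp_pos (z / μ)).le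
      simp only
      linarith
    have hlim : Filter.Tendsto (fun z => -(γ ^ 4 + |L|) * Real.exp (z / μ)) Filter.atTop
        (nhds (-(γ ^ 4 + |L|) * 0)) :=
      (Real.tendsto_exp_atBot.comp
        (Filter.tendsto_id.atTop_div_const_of_neg hμ0)).const_mul _
    rw [mul_zero] at hlim
    have hnn := le_of_tendsto hlim (Filter.eventually_atTop.2 ⟨x, hlow⟩)
    rw [hexp] at hnn
    have : 0 ≤ Real.exp (x / μ) * (σ * (ψ x μ - L) + K * Real.exp (-α * x) / (1 - μ * α)) := by
      refine hnn.trans_eq ?_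
      ring
    exact nonneg_of_mul_nonneg_right this (Real.exp_pos _)
  rw [abs_le]
  have h1 := key 1 (by simp)
  have h2 := key (-1) (by simp)
  constructor <;> linarith

end IsTransportSolution

/-- A weighted dissipation estimate for `T'` yields an exponential Cauchy estimate for `T`. -/
lemma abs_sub_le_of_dissipation {T T' H H' : ℝ → ℝ} {α β M : ℝ} (hα : 0 < α) (hβ : 0 < β)
    (hM : 0 ≤ M) (hTc : ContinuousOn T (Ici 0)) (hHc : ContinuousOn H (Ici 0))
    (hdT : ∀ x > 0, HasDerivAt T (T' x) x) (hdH : ∀ x > 0, HasDerivAt H (H' x) x)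
    (hdiss : ∀ x > 0, H' x ≤ -(3 * β * Real.exp (2 * α * x) * T' x ^ 2))
    (hH : ∀ x ≥ 0, 0 ≤ H x) (hH0 : H 0 ≤ 6 * α * β * M ^ 2) {x y : ℝ} (hx : 0 ≤ x)
    (hxy : x ≤ y) : |T x - T y| ≤ M * Real.exp (-α * x) := by
  have hHx : H x ≤ 6 * α * β * M ^ 2 := by
    refine (antitoneOn_Ici_of_hasDerivAt_nonpos hHc hdH (fun z hz => (hdiss z hz).trans ?_)
      (mem_Ici.2 le_rfl) (mem_Ici.2 hx) hx).trans hH0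
    have : 0 ≤ 3 * β * Real.exp (2 * α * z) * T' z ^ 2 := by positivity
    linarith
  have hHy := hH y (hx.trans hxy)
  suffices hN : ∀ N > M, |T x - T y| ≤ N * Real.exp (-α * x) by
    have hc : Filter.Tendsto (fun N => N * Real.exp (-α * x)) (nhdsWithin M (Ioi M))
        (nhds (M * Real.exp (-α * x))) :=
      (Continuous.tendsto (by fun_prop) M).mono_left nhdsWithin_le_nhds
    exact ge_of_tendsto hc (by filter_upwards [self_mem_nhdsWithin] with N hN' using hN N hN')
  intro N hN
  have hN0 : 0 < N := hM.trans_lt hN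
  set l := Real.exp (-α * x) / (2 * α * N) with hl
  have hl0 : 0 < l := by positivity
  have key : ∀ σ : ℝ, σ ^ 2 = 1 → σ * (T y - T x) ≤ N * Real.exp (-α * x) := by
    intro σ hσ
    have hanti := antitoneOn_Ici_of_hasDerivAt_nonpos
      (f := fun s => σ * T s + l / (6 * β) * H s + 1 / (4 * α * l) * Real.exp (-(2 * α) * s))
      (f' := fun s => σ * T' s + l / (6 * β) * H' s - 1 / (2 * l) * Real.exp (-(2 * α) * s))
      ?_ ?_ ?_ (mem_Ici.2 hx) (mem_Ici.2 (hx.trans hxy)) hxy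
    · have h1 : l / (6 * β) * H x ≤ N * Real.exp (-α * x) / 2 := by
        calc l / (6 * β) * H x ≤ l / (6 * β) * (6 * α * β * N ^ 2) := by
              gcongr
              refine hHx.trans ?_
              gcongr
          _ = _ := by rw [hl]; field_simp
      have h2 : 1 / (4 * α * l) * Real.exp (-(2 * α) * x) = N * Real.exp (-α * x) / 2 := by
        have : Real.exp (-(2 * α) * x) = Real.exp (-α * x) * Real.exp (-α * x) := by
          rw [← Real.exp_add]; congr 1; ring
        rw [this, hl]
        field_simp
        norm_num
      have h3 : 0 ≤ l / (6 * β) * H y := by positivity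
      have h4 : 0 ≤ 1 / (4 * α * l) * Real.exp (-(2 * α) * y) := by positivity
      simp only at hanti
      linarith
    · exact ((continuousOn_const.mul hTc).add (continuousOn_const.mul hHc)).add
        (Continuous.continuousOn (by fun_prop))
    · intro s hs
      refine ((((hdT s hs).const_mul σ).fun_add ((hdH s hs).const_mul (l / (6 * β)))).fun_add
        (((hasDerivAt_id s).const_mul (-(2 * α))).exp.const_mul (1 / (4 * α * l)))).congr_deriv ?_
      simp only [id]
      field_simp
      ring
    · intro s hs
      have h1 : l / (6 * β) * H' s ≤ -(l / 2 * Real.exp (2 * α * s) * T' s ^ 2) := by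
        refine (mul_le_mul_of_nonneg_left (hdiss s hs) (by positivity)).trans_eq ?_
        field_simp
        norm_num
      have huv : Real.exp (2 * α * s) * Real.exp (-(2 * α) * s) = 1 := by
        rw [← Real.exp_add, ← Real.exp_zero]; congr 1; ring
      set u := Real.exp (2 * α * s)
      set v := Real.exp (-(2 * α) * s)
      have h2 : 0 ≤ (l * u * T' s - σ) ^ 2 * (v / (2 * l)) := by positivity
      have h3 : (l * u * T' s - σ) ^ 2 * (v / (2 * l))
          = l / 2 * u * T' s ^ 2 - σ * T' s + 1 / (2 * l) * v := by
        have : (l * u * T' s - σ) ^ 2 * (v / (2 * l))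
          = (l ^ 2 * u * T' s ^ 2 * (u * v) - 2 * σ * l * T' s * (u * v) + σ ^ 2 * v)
            / (2 * l) := by ring
        rw [this, huv, hσ]
        field_simp
      linarith
  rw [abs_le]
  have h1 := key 1 (by simp)
  have h2 := key (-1) (by simp)
  constructor <;> linarith

lemma exists_limit_of_abs_sub_le {T : ℝ → ℝ} {α M : ℝ} (hα : 0 < α)
    (hT : ∀ x ≥ 0, ∀ y ≥ x, |T x - T y| ≤ M * Real.exp (-α * x)) :
    ∃ L, Filter.Tendsto T Filter.atTop (nhds L) ∧
      ∀ x ≥ 0, |T x - L| ≤ M * Real.exp (-α * x) := by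
  have hlim : Filter.Tendsto (fun x => M * Real.exp (-α * x)) Filter.atTop (nhds 0) := by
    simpa using (Real.tendsto_exp_atBot.comp
      (Filter.tendsto_id.const_mul_atTop_of_neg (neg_lt_zero.2 hα))).const_mul M
  have hcau : Cauchy (Filter.map T Filter.atTop) := by
    refine Metric.cauchy_iff.2 ⟨inferInstance, fun ε hε => ?_⟩
    obtain ⟨x, hx, hx0⟩ := ((hlim.eventually_lt_const (half_pos hε)).and
      (Filter.eventually_ge_atTop 0)).exists
    refine ⟨T '' Ici x, Filter.image_mem_map (Filter.Ici_mem_atTop x), ?_⟩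
    rintro _ ⟨y, hy, rfl⟩ _ ⟨z, hz, rfl⟩
    have h1 := hT x hx0 y hy
    have h2 := hT x hx0 z hz
    have := abs_sub_le (T y) (T x) (T z)
    rw [abs_sub_comm (T y) (T x)] at this
    rw [Real.dist_eq]
    linarith
  obtain ⟨L, hL⟩ := CompleteSpace.complete hcau
  refine ⟨L, hL, fun x hx => ?_⟩
  exact le_of_tendsto ((tendsto_const_nhds.sub hL).abs)
    (Filter.eventually_atTop.2 ⟨x, fun y hy => hT x hx y hy⟩)

lemma hasDerivAt_exp_mul_primitive {S : ℝ → ℝ} (hS : Continuous S) (a μ x : ℝ) :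
    HasDerivAt (fun x => Real.exp (-x / μ) * (a + μ⁻¹ * ∫ s in (0 : ℝ)..x, Real.exp (s / μ) * S s))
      ((S x - Real.exp (-x / μ) * (a + μ⁻¹ * ∫ s in (0 : ℝ)..x, Real.exp (s / μ) * S s)) / μ)
      x := by
  have hc : Continuous fun s => Real.exp (s / μ) * S s := by fun_prop
  refine ((((hasDerivAt_id x).neg.div_const μ).exp).fun_mul
    ((((hc.integral_hasStrictDerivAt 0 x).hasDerivAt).const_mul μ⁻¹).const_add a)).congr_deriv ?_
  have e : Real.exp (-x / μ) * Real.exp (x / μ) = 1 := by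
    rw [← Real.exp_add, ← Real.exp_zero]; congr 1; ring
  simp only [Pi.neg_apply, id]
  linear_combination (μ⁻¹ * S x) * e

lemma exp_kernel_eq (μ x s : ℝ) :
    μ⁻¹ * Real.exp (-(x - s) / μ) = (Real.exp (-x / μ) * μ⁻¹) * Real.exp (s / μ) := by
  have : Real.exp (-(x - s) / μ) = Real.exp (-x / μ) * Real.exp (s / μ) := by
    rw [← Real.exp_add]; congr 1; ring
  rw [this]; ring

lemma integrableOn_exp_div_mul {S : ℝ → ℝ} {C μ : ℝ} (hS : Continuous S) (hb : ∀ s, |S s| ≤ C)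
    (hμ : μ < 0) (x : ℝ) : IntegrableOn (fun s => Real.exp (s / μ) * S s) (Ioi x) := by
  have h1 := integrableOn_exp_mul_Ioi (inv_lt_zero.2 hμ) x
  refine Integrable.mono' (h1.mul_const C) (Continuous.aestronglyMeasurable (by fun_prop))
    (Filter.Eventually.of_forall fun s => ?_)
  rw [Real.norm_eq_abs, abs_mul, Real.abs_exp, div_eq_inv_mul]
  gcongr
  exact hb s

lemma measurable_setIntegral_kernel {S : ℝ → ℝ} (hS : Continuous S) (x : ℝ) (A : Set ℝ) :
    Measurable fun μ : ℝ => ∫ s in A, μ⁻¹ * Real.exp (-(x - s) / μ) * S s := by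
  refine (StronglyMeasurable.integral_prod_right (f := fun μ s : ℝ =>
    μ⁻¹ * Real.exp (-(x - s) / μ) * S s) (Measurable.stronglyMeasurable ?_)).measurable
  have := hS.measurable
  unfold Function.uncurry
  fun_prop

/-- The mild formulation of the transport equation produces a transport solution. -/
lemma isTransportSolution_of_mild {γ : ℝ} {T ψb : ℝ → ℝ} {ψ : ℝ → ℝ → ℝ}
    (hψbmeas : Measurable ψb) (hTc : ContinuousOn T (Ici 0))
    (hTbd : ∀ x ∈ Ici (0 : ℝ), T x ∈ Icc 0 γ)
    (hψbd : ∀ x ∈ Ici (0 : ℝ), ∀ μ ∈ Icc (-1 : ℝ) 1, ψ x μ ∈ Icc 0 (γ ^ 4))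
    (hψpos : ∀ μ ∈ Ioc (0 : ℝ) 1, ∀ x ∈ Ici (0 : ℝ),
      ψ x μ = ψb μ * Real.exp (-x / μ)
        + ∫ s in (0 : ℝ)..x, μ⁻¹ * Real.exp (-(x - s) / μ) * T s ^ 4)
    (hψneg : ∀ μ ∈ Ico (-1 : ℝ) 0, ∀ x ∈ Ici (0 : ℝ),
      ψ x μ = -∫ s in Ioi x, μ⁻¹ * Real.exp (-(x - s) / μ) * T s ^ 4) :
    IsTransportSolution γ T ψ := by
  set S : ℝ → ℝ := fun s => T (max s 0) ^ 4 with hS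
  have hSc : Continuous S :=
    (hTc.comp_continuous (continuous_id.max continuous_const) fun s => mem_Ici.2 (le_max_right _ _)).pow 4
  have hSeq : ∀ s ≥ 0, T s ^ 4 = S s := fun s hs => by simp only [hS, max_eq_left hs]
  have hSb : ∀ s, |S s| ≤ γ ^ 4 := fun s => by
    have := hTbd (max s 0) (mem_Ici.2 (le_max_right _ _))
    rw [hS, abs_pow, abs_of_nonneg this.1]
    exact pow_le_pow_left₀ this.1 this.2 4
  have hpos : ∀ μ ∈ Ioc (0 : ℝ) 1, ∀ x ∈ Ici (0 : ℝ), ψ x μ = ψb μ * Real.exp (-x / μ)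
      + ∫ s in Ioc 0 x, μ⁻¹ * Real.exp (-(x - s) / μ) * S s := fun μ hμ x hx => by
    rw [hψpos μ hμ x hx, intervalIntegral.integral_of_le hx]
    congr 1
    exact setIntegral_congr_fun measurableSet_Ioc fun s hs => by simp only [hSeq s hs.1.le]
  have hneg : ∀ μ ∈ Ico (-1 : ℝ) 0, ∀ x ∈ Ici (0 : ℝ), ψ x μ =
      -∫ s in Ioi x, μ⁻¹ * Real.exp (-(x - s) / μ) * S s := fun μ hμ x hx => by
    rw [hψneg μ hμ x hx]
    congr 1
    exact setIntegral_congr_fun measurableSet_Ioi fun s hs => by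
      simp only [hSeq s (le_trans hx (le_of_lt hs))]
  have hrep : ∀ μ ∈ Icc (-1 : ℝ) 1, μ ≠ 0 → ∃ a, ∀ x ≥ 0, ψ x μ =
      Real.exp (-x / μ) * (a + μ⁻¹ * ∫ s in (0 : ℝ)..x, Real.exp (s / μ) * S s) := by
    intro μ hμ h0
    rcases h0.lt_or_gt with h | h
    · refine ⟨-(μ⁻¹ * ∫ s in Ioi 0, Real.exp (s / μ) * S s), fun x hx => ?_⟩
      rw [hneg μ ⟨hμ.1, h⟩ x hx, ← intervalIntegral.integral_interval_add_Ioi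
        (integrableOn_exp_div_mul hSc hSb h 0) (integrableOn_exp_div_mul hSc hSb h x)]
      simp only [exp_kernel_eq, mul_assoc]
      rw [integral_const_mul, integral_const_mul]
      ring
    · refine ⟨ψb μ, fun x hx => ?_⟩
      rw [hpos μ ⟨h, hμ.2⟩ x hx, intervalIntegral.integral_of_le hx]
      simp only [exp_kernel_eq, mul_assoc]
      rw [integral_const_mul, integral_const_mul]
      ring
  refine ⟨hTc, hTbd, hψbd, ?_, ?_, ?_⟩
  · intro x hx
    have hm : Measurable fun μ : ℝ => if 0 < μ then ψb μ * Real.exp (-x / μ)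
        + ∫ s in Ioc 0 x, μ⁻¹ * Real.exp (-(x - s) / μ) * S s
        else -∫ s in Ioi x, μ⁻¹ * Real.exp (-(x - s) / μ) * S s :=
      Measurable.ite measurableSet_Ioi
        ((hψbmeas.mul (by fun_prop)).add (measurable_setIntegral_kernel hSc x _))
        (measurable_setIntegral_kernel hSc x _).neg
    refine hm.aestronglyMeasurable.congr ?_
    refine (ae_restrict_iff' measurableSet_uIoc).2 ?_
    filter_upwards [Measure.ae_ne volume (0 : ℝ)] with μ hμ0 hμ
    rw [uIoc_of_le (by norm_num)] at hμ
    rcases hμ0.lt_or_gt with h | h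
    · rw [if_neg h.not_gt, hneg μ ⟨hμ.1.le, h⟩ x hx]
    · rw [if_pos h, hpos μ ⟨h, hμ.2⟩ x hx]
  · intro μ hμ h0
    obtain ⟨a, ha⟩ := hrep μ hμ h0
    exact ContinuousOn.congr (fun x _ =>
      (hasDerivAt_exp_mul_primitive hSc a μ x).continuousAt.continuousWithinAt) ha
  · intro μ hμ h0 x hx
    obtain ⟨a, ha⟩ := hrep μ hμ h0
    rw [hSeq x hx.le, ha x hx.le]
    refine (hasDerivAt_exp_mul_primitive hSc a μ x).congr_of_eventuallyEq ?_
    filter_upwards [Ioi_mem_nhds hx] with y hy using ha y (le_of_lt hy)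

/-- Exponential decay of solutions of the nonlinear Milne problem satisfying
the weighted energy estimate. -/
theorem stmt_1 (γ Tb α : ℝ) (hγ : 0 < γ) (hTb : Tb ∈ Set.Icc 0 γ)
    (hα : α ∈ Set.Ioo (0:ℝ) 1)
    (ψb : ℝ → ℝ) (hψbmeas : Measurable ψb)
    (hψb : ∀ μ ∈ Set.Ioc (0:ℝ) 1, ψb μ ∈ Set.Icc 0 (γ ^ 4))
    (Mα : ℝ)
    (hMα : Mα = Real.sqrt ((∫ μ in (0:ℝ)..1, μ * (ψb μ - Tb ^ 4) ^ 2) / (6 * α * (1 - α))))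
    -- (T, ψ) a classical solution of the nonlinear Milne problem with data (Tb, ψb), bound γ
    (T T' T'' : ℝ → ℝ) (ψ : ℝ → ℝ → ℝ)
    (hT1 : ∀ x ∈ Set.Ici (0:ℝ), HasDerivWithinAt T (T' x) (Set.Ici 0) x)
    (hT2 : ∀ x ∈ Set.Ici (0:ℝ), HasDerivWithinAt T' (T'' x) (Set.Ici 0) x)
    (hT2c : ContinuousOn T'' (Set.Ici 0))
    (hTbd : ∀ x ∈ Set.Ici (0:ℝ), T x ∈ Set.Icc 0 γ)
    (hT0 : T 0 = Tb)
    (hψbd : ∀ x ∈ Set.Ici (0:ℝ), ∀ μ ∈ Set.Icc (-1:ℝ) 1, ψ x μ ∈ Set.Icc 0 (γ ^ 4))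
    (hψpos : ∀ μ ∈ Set.Ioc (0:ℝ) 1, ∀ x ∈ Set.Ici (0:ℝ),
      ψ x μ = ψb μ * Real.exp (-x / μ)
        + ∫ s in (0:ℝ)..x, μ⁻¹ * Real.exp (-(x - s) / μ) * T s ^ 4)
    (hψneg : ∀ μ ∈ Set.Ico (-1:ℝ) 0, ∀ x ∈ Set.Ici (0:ℝ),
      ψ x μ = -∫ s in Set.Ioi x, μ⁻¹ * Real.exp (-(x - s) / μ) * T s ^ 4)
    (hode : ∀ x ∈ Set.Ici (0:ℝ),
      T'' x + (∫ μ in (-1:ℝ)..1, (ψ x μ - T x ^ 4)) = 0)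
    -- the weighted estimate
    (hest : (∫ x in Set.Ioi (0:ℝ), Real.exp (2*α*x) * (4 * T x ^ 3 * T' x ^ 2))
        + (1 - α) * (∫ x in Set.Ioi (0:ℝ),
            (∫ μ in (-1:ℝ)..1, Real.exp (2*α*x) * (ψ x μ - T x ^ 4) ^ 2))
        ≤ (1/2) * (∫ μ in (0:ℝ)..1, μ * (ψb μ - Tb ^ 4) ^ 2)) :
    ∃ Tinf : ℝ, 0 ≤ Tinf ∧
      (∀ x ∈ Set.Ici (0:ℝ), |T x - Tinf| ≤ Mα * Real.exp (-α * x)) ∧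
      (∀ x ∈ Set.Ici (0:ℝ), ∀ μ ∈ Set.Ioc (0:ℝ) 1,
        |ψ x μ - Tinf ^ 4| ≤ |ψb μ - Tb ^ 4| * Real.exp (-x / μ)
          + 4 * (Tb + 2 * Mα) ^ 3 * Mα * Real.exp (-α * x) / (1 - μ * α)) ∧
      (∀ x ∈ Set.Ici (0:ℝ), ∀ μ ∈ Set.Ico (-1:ℝ) 0,
        |ψ x μ - Tinf ^ 4| ≤ 4 * (Tb + 2 * Mα) ^ 3 * Mα * Real.exp (-α * x) / (1 - μ * α)) ∧
      Tinf ≤ Tb + Mα ∧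
      (∀ x ∈ Set.Ici (0:ℝ), |T x| ≤ Tb + 2 * Mα) := by
  have hTc : ContinuousOn T (Ici 0) := fun x hx => (hT1 x hx).continuousWithinAt
  have hT'c : ContinuousOn T' (Ici 0) := fun x hx => (hT2 x hx).continuousWithinAt
  have hdT : ∀ x > 0, HasDerivAt T (T' x) x := fun x hx =>
    (hT1 x (le_of_lt hx)).hasDerivAt (Ici_mem_nhds hx)
  have hdT' : ∀ x > 0, HasDerivAt T' (T'' x) x := fun x hx =>
    (hT2 x (le_of_lt hx)).hasDerivAt (Ici_mem_nhds hx)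
  have h := isTransportSolution_of_mild hψbmeas hTc hTbd hψbd hψpos hψneg
  have hflux : ∀ x ≥ 0, T' x = ∫ μ in (-1 : ℝ)..1, μ * ψ x μ := fun x hx =>
    h.deriv_temp_eq_flux hT'c hdT hdT' (fun y hy => hode y (le_of_lt hy)) hx
  have hψ0 : ∀ μ ∈ Ioc (0 : ℝ) 1, ψ 0 μ = ψb μ := fun μ hμ => by
    simp [hψpos μ hμ 0 (mem_Ici.2 le_rfl)]
  obtain ⟨hα0, hα1⟩ := hα
  have hβ : 0 < 1 - α := by linarith
  set I := ∫ μ in (0 : ℝ)..1, μ * (ψb μ - Tb ^ 4) ^ 2 with hI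
  have hI0 : 0 ≤ I := intervalIntegral.integral_nonneg zero_le_one fun μ hμ =>
    mul_nonneg hμ.1 (sq_nonneg _)
  have hM0 : 0 ≤ Mα := hMα ▸ Real.sqrt_nonneg _
  have hMsq : 6 * α * (1 - α) * Mα ^ 2 = I := by
    rw [hMα, Real.sq_sqrt (by positivity)]
    field_simp
  set E : ℝ → ℝ := fun x => ∫ μ in (-1 : ℝ)..1, μ * (ψ x μ - T x ^ 4) ^ 2 with hE
  have hE0 : E 0 ≤ I := by
    have hii : IntervalIntegrable (fun μ => μ * (ψ 0 μ - T 0 ^ 4) ^ 2) volume (-1) 1 :=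
      intervalIntegrable_of_bounded (C := 1 * (γ ^ 4) ^ 2)
        (aestronglyMeasurable_id.mul ((h.meas_sub le_rfl).pow 2)) fun μ hμ => by
          rw [abs_mul, abs_pow]
          gcongr
          · exact abs_le.2 hμ
          · exact h.abs_sub_le le_rfl hμ
    have h1 : ∫ μ in (-1 : ℝ)..0, μ * (ψ 0 μ - T 0 ^ 4) ^ 2 ≤ 0 := by
      rw [intervalIntegral.integral_of_le (by norm_num)]
      exact setIntegral_nonpos measurableSet_Ioc fun μ hμ =>
        mul_nonpos_of_nonpos_of_nonneg hμ.2 (sq_nonneg _)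
    have h2 : ∫ μ in (0 : ℝ)..1, μ * (ψ 0 μ - T 0 ^ 4) ^ 2 = I := by
      rw [hI, intervalIntegral.integral_of_le zero_le_one,
        intervalIntegral.integral_of_le zero_le_one]
      refine setIntegral_congr_fun measurableSet_Ioc fun μ hμ => ?_
      simp only [hψ0 μ hμ, hT0]
    simp only [hE]
    rw [← intervalIntegral.integral_add_adjacent_intervals (b := 0)
      (hii.mono_set (uIcc_subset_uIcc (by norm_num [mem_uIcc]) (by norm_num [mem_uIcc])))
      (hii.mono_set (uIcc_subset_uIcc (by norm_num [mem_uIcc]) (by norm_num [mem_uIcc]))), h2]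
    linarith
  have hcauchy : ∀ x ≥ 0, ∀ y ≥ x, |T x - T y| ≤ Mα * Real.exp (-α * x) := by
    intro x hx y hxy
    refine abs_sub_le_of_dissipation (T' := T') (H := fun x => Real.exp (2 * α * x) * E x)
      (H' := fun x => Real.exp (2 * α * x) * (2 * α * E x +
        (-2 * (∫ μ in (-1 : ℝ)..1, (ψ x μ - T x ^ 4) ^ 2) - 8 * T x ^ 3 * T' x ^ 2)))
      (β := 1 - α) hα0 hβ hM0 hTc ?_ hdT ?_ ?_ ?_ ?_ hx hxy
    · exact (Continuous.continuousOn (by fun_prop)).mul h.continuousOn_entropy_flux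
    · intro z hz
      refine ((((hasDerivAt_id z).const_mul (2 * α)).exp).fun_mul
        (h.hasDerivAt_entropy_flux hdT hflux hz)).congr_deriv ?_
      simp only [id, hE]
      ring
    · intro z hz
      have h1 := (abs_le.1 (h.abs_entropy_flux_le (le_of_lt hz))).2
      have h2 := h.flux_sq_le (le_of_lt hz)
      rw [← hflux z (le_of_lt hz)] at h2
      have h3 := pow_nonneg (hTbd z (le_of_lt hz)).1 3
      have h4 : 0 ≤ T z ^ 3 * T' z ^ 2 := by positivity
      change E z ≤ _ at h1
      have h5 := mul_le_mul_of_nonneg_left h1 hα0.le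
      have h6 := mul_le_mul_of_nonneg_left h2 hβ.le
      have h7 : 2 * α * E z + (-2 * (∫ μ in (-1 : ℝ)..1, (ψ z μ - T z ^ 4) ^ 2)
          - 8 * T z ^ 3 * T' z ^ 2) ≤ -(3 * (1 - α) * T' z ^ 2) := by linarith
      refine (mul_le_mul_of_nonneg_left h7 (Real.exp_pos _).le).trans_eq ?_
      ring
    · exact fun z hz => mul_nonneg (Real.exp_pos _).le (h.entropy_flux_nonneg hdT hflux hz)
    · simpa [hMsq] using hE0
  obtain ⟨L, hlim, hL⟩ := exists_limit_of_abs_sub_le hα0 hcauchy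
  have hL0 : 0 ≤ L := ge_of_tendsto hlim
    (Filter.eventually_atTop.2 ⟨0, fun x hx => (hTbd x hx).1⟩)
  have hLT : |Tb - L| ≤ Mα := by simpa [hT0] using hL 0 le_rfl
  have hLle : L ≤ Tb + Mα := by linarith [(abs_le.1 hLT).1]
  have hTle : ∀ x ∈ Ici (0 : ℝ), |T x| ≤ Tb + 2 * Mα := by
    intro x hx
    have h1 : Mα * Real.exp (-α * x) ≤ Mα :=
      mul_le_of_le_one_right hM0 (Real.exp_le_one_iff.2 (by nlinarith [mem_Ici.1 hx]))
    rw [abs_of_nonneg (hTbd x hx).1]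
    linarith [(abs_le.1 (hL x hx)).2]
  have hB : 0 ≤ Tb + 2 * Mα := by linarith [hTb.1]
  set K := 4 * (Tb + 2 * Mα) ^ 3 * Mα with hK
  have hK0 : 0 ≤ K := by positivity
  have hpow : ∀ x ≥ 0, |T x ^ 4 - L ^ 4| ≤ K * Real.exp (-α * x) := by
    intro x hx
    calc |T x ^ 4 - L ^ 4| ≤ |T x - L| * (4 : ℕ) * max |T x| |L| ^ 3 := abs_pow_sub_pow_le _ _ 4
      _ ≤ (Mα * Real.exp (-α * x)) * (4 : ℕ) * (Tb + 2 * Mα) ^ 3 := by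
        gcongr
        · exact hL x hx
        · refine max_le (hTle x hx) ?_
          rw [abs_of_nonneg hL0]
          linarith
      _ = K * Real.exp (-α * x) := by rw [hK]; push_cast; ring
  refine ⟨L, hL0, hL, ?_, ?_, hLle, hTle⟩
  · intro x hx μ hμ
    refine (h.abs_sub_le_of_pos ⟨hα0, hα1⟩ hpow hμ hx).trans ?_
    have hd : 0 < 1 - μ * α := by nlinarith [hμ.1, hμ.2]
    have hd1 : 1 - μ * α ≤ 1 := by nlinarith [hμ.1, hμ.2]
    have h0 : |ψ 0 μ - L ^ 4| ≤ |ψb μ - Tb ^ 4| + K := by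
      rw [hψ0 μ hμ]
      refine (abs_sub_le _ (Tb ^ 4) _).trans (add_le_add_right ?_ _)
      simpa [hT0] using hpow 0 le_rfl
    have h1 := mul_le_mul_of_nonneg_right h0 (Real.exp_pos (-x / μ)).le
    have h2 : K * Real.exp (-x / μ) ≤ K * Real.exp (-x / μ) / (1 - μ * α) :=
      le_div_self (by positivity) hd hd1
    rw [mul_sub, sub_div]
    linarith
  · exact fun x hx μ hμ => h.abs_sub_le_of_neg ⟨hα0, hα1⟩ hK0 hpow hμ hx
end

section
/- Let B > 0, β ∈ [0,1), and let T ∈ C¹([0,B]) be nonnegative and satisfy the weighted coercivity inequality: for every f ∈ C¹([0,B]) with f(0) = 0, ∫₀^B e^{2βx} 4T(x)³ f'(x)² dx + ∫₀^B e^{2βx} 12 T(x)² T'(x) f(x) f'(x) dx ≥ 0. Let S₁ ∈ C([0,B]) and let φ_b : (0,1] → ℝ be measurable with ∫₀¹ μ φ_b(μ)² dμ < ∞. Suppose g ∈ C²([0,B]) and φ : [0,B]×[-1,1] → ℝ (with x ↦ φ(x,μ) being C¹ for each μ ≠ 0) satisfy: g''(x) + ∫_{-1}^{1}(φ(x,μ)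 − 4T(x)³ g(x)) dμ = 2 S₁(x) and μ ∂_x φ(x,μ) + φ(x,μ) − 4T(x)³ g(x) = S₁(x) on [0,B] for μ ≠ 0; g(0) = 0, g'(B) = 0; φ(0,μ) = φ_b(μ) and φ(B,μ) = φ(B,−μ) for μ ∈ (0,1]. Then ∫₀^B ∫_{-1}^{1} e^{2βx} (φ(x,μ) − 4T(x)³ g(x))² dμ dx + (1/(1−β)) ∫_{-1}^{0} |μ| φ(0,μ)² dμ ≤ (1/(1−β)) ∫₀¹ μ φ_b(μ)² dμ + (2/(1−β)²) ∫₀^B e^{2βx} S₁(x)² dx. -/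
open MeasureTheory Set

theorem integral_eq_sub_of_hasDerivWithinAt_Icc {a b : ℝ} (hab : a ≤ b) {f f' : ℝ → ℝ}
    (hf : ∀ x ∈ Icc a b, HasDerivWithinAt f (f' x) (Icc a b) x)
    (hc : ContinuousOn f' (Icc a b)) : ∫ x in a..b, f' x = f b - f a := by
  refine intervalIntegral.integral_eq_sub_of_hasDerivAt_of_le hab
    (fun x hx => (hf x hx).continuousWithinAt)
    (fun x hx => (hf x (Ioo_subset_Icc_self hx)).hasDerivAt (Icc_mem_nhds hx.1 hx.2)) ?_
  exact ContinuousOn.intervalIntegrable (by rwa [uIcc_of_le hab])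

/-- Duhamel formula for `m * ψ' + ψ = h`. -/
theorem transport_eq_duhamel {B m : ℝ} (hm : m ≠ 0) {ψ ψ' h : ℝ → ℝ} (hh : Continuous h)
    (hψ : ∀ x ∈ Icc 0 B, HasDerivWithinAt ψ (ψ' x) (Icc 0 B) x)
    (heq : ∀ x ∈ Icc 0 B, m * ψ' x + ψ x = h x) {x : ℝ} (hx : x ∈ Icc 0 B) :
    ψ x = Real.exp (-x / m) * (ψ 0 + m⁻¹ * ∫ y in (0:ℝ)..x, Real.exp (y / m) * h y) := by
  have hsub : Icc 0 x ⊆ Icc 0 B := Icc_subset_Icc_right hx.2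
  have key := integral_eq_sub_of_hasDerivWithinAt_Icc hx.1
    (f := fun y => Real.exp (y / m) * ψ y) (f' := fun y => m⁻¹ * (Real.exp (y / m) * h y))
    (fun y hy => by
      have h1 : HasDerivWithinAt (fun y => Real.exp (y / m)) (Real.exp (y / m) * (1 / m))
          (Icc 0 x) y := (((hasDerivAt_id y).div_const m).exp).hasDerivWithinAt
      refine (h1.mul ((hψ y (hsub hy)).mono hsub)).congr_deriv ?_
      rw [← heq y (hsub hy)]
      field_simp
      ring) (by fun_prop)
  rw [intervalIntegral.integral_const_mul] at key
  rw [key]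
  have : Real.exp (-x / m) * Real.exp (x / m) = 1 := by
    rw [← Real.exp_add, neg_div, neg_add_cancel, Real.exp_zero]
  simp only [zero_div, Real.exp_zero, one_mul]
  linear_combination (-ψ x) * this

/-- Pointwise bound for `m * ψ' + ψ = h` with `m > 0`. -/
theorem abs_transport_le {B m K : ℝ} (hm : 0 < m) {ψ ψ' h : ℝ → ℝ} (hh : Continuous h)
    (hK : ∀ x ∈ Icc 0 B, |h x| ≤ K)
    (hψ : ∀ x ∈ Icc 0 B, HasDerivWithinAt ψ (ψ' x) (Icc 0 B) x)
    (heq : ∀ x ∈ Icc 0 B, m * ψ' x + ψ x = h x) {x : ℝ} (hx : x ∈ Icc 0 B) :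
    |ψ x| ≤ K + Real.exp (-x / m) * |ψ 0| := by
  rw [transport_eq_duhamel hm.ne' hh hψ heq hx]
  have hK0 : 0 ≤ K := (abs_nonneg _).trans (hK x hx)
  have hprim : ∫ y in (0:ℝ)..x, m⁻¹ * (Real.exp (y / m) * K) = K * (Real.exp (x / m) - 1) := by
    rw [integral_eq_sub_of_hasDerivWithinAt_Icc hx.1 (f := fun y => Real.exp (y / m) * K)
      (fun y _ => by
        have h1 := ((((hasDerivAt_id y).div_const m).exp).mul_const K).hasDerivWithinAt
          (s := Icc 0 x)
        refine h1.congr_deriv ?_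
        simp only [id]
        field_simp) (by fun_prop)]
    simp
    ring
  have hint : |m⁻¹ * ∫ y in (0:ℝ)..x, Real.exp (y / m) * h y| ≤ K * (Real.exp (x / m) - 1) := by
    rw [← intervalIntegral.integral_const_mul, ← hprim, ← Real.norm_eq_abs]
    refine intervalIntegral.norm_integral_le_of_norm_le hx.1 ?_
      (Continuous.intervalIntegrable (by fun_prop) _ _)
    refine Filter.Eventually.of_forall fun y hy => ?_
    rw [Real.norm_eq_abs, abs_mul, abs_mul, abs_of_pos (inv_pos.2 hm), Real.abs_exp]
    have := hK y ⟨hy.1.le, hy.2.trans hx.2⟩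
    gcongr
  have hexp : Real.exp (-x / m) * Real.exp (x / m) = 1 := by
    rw [← Real.exp_add, neg_div, neg_add_cancel, Real.exp_zero]
  have hpos := Real.exp_pos (-x / m)
  rw [abs_mul, Real.abs_exp]
  calc _ ≤ Real.exp (-x / m) * (|ψ 0| + K * (Real.exp (x / m) - 1)) := by
        gcongr
        exact (abs_add_le _ _).trans (by gcongr)
    _ ≤ _ := by nlinarith [mul_nonneg hpos.le hK0]

/-- Solution of the Milne transport equation with right-hand side `h`, inflow data `φb` at `0`
and reflection at `B`. -/
noncomputable def milneSolution (B : ℝ) (h φb : ℝ → ℝ) (x μ : ℝ) : ℝ :=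
  let P : ℝ → ℝ → ℝ := fun x μ => μ⁻¹ * ∫ y in (0:ℝ)..x, Real.exp (y / μ) * h y
  if 0 < μ then Real.exp (-x / μ) * (φb μ + P x μ)
  else Real.exp (-x / μ) *
    (Real.exp (B / μ) * (Real.exp (B / μ) * (φb (-μ) + P B (-μ))) - P B μ + P x μ)

theorem measurable_duhamel {h : ℝ → ℝ} (hh : Continuous h) (x : ℝ) :
    Measurable fun μ : ℝ => μ⁻¹ * ∫ y in (0:ℝ)..x, Real.exp (y / μ) * h y := by
  refine measurable_inv.mul ?_
  simp only [intervalIntegral]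
  have hm : StronglyMeasurable (Function.uncurry fun μ y : ℝ => Real.exp (y / μ) * h y) := by
    refine Measurable.stronglyMeasurable ?_
    have := hh.measurable
    simp only [Function.uncurry_def]
    fun_prop
  exact (hm.integral_prod_right.measurable).sub hm.integral_prod_right.measurable

theorem stronglyMeasurable_milneSolution {B : ℝ} {h φb : ℝ → ℝ} (hh : Continuous h)
    (hφb : Measurable φb) : StronglyMeasurable (Function.uncurry (milneSolution B h φb)) := by
  refine Measurable.stronglyMeasurable ?_
  refine measurable_uncurry_of_continuous_of_measurable (fun μ => ?_) (fun x => ?_)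
  · have hP : Continuous fun x : ℝ => ∫ y in (0:ℝ)..x, Real.exp (y / μ) * h y :=
      intervalIntegral.continuous_primitive
        (fun a b => Continuous.intervalIntegrable (by fun_prop) a b) 0
    unfold milneSolution
    split_ifs <;> fun_prop
  · have hP := measurable_duhamel hh
    have h1 := hP x
    have h2 := hP B
    have h3 := h2.comp measurable_neg
    unfold milneSolution
    refine Measurable.ite measurableSet_Ioi ?_ ?_
    · fun_prop
    · simp only [Function.comp_def] at h3
      fun_prop

/-- The dominating function is square integrable on the slab. -/
theorem integrable_decay {B : ℝ} {φb : ℝ → ℝ} (hφb : Measurable φb)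
    (hint : IntegrableOn (fun μ => |μ| * φb |μ| ^ 2) (Ioc (-1) 1)) :
    Integrable (fun p : ℝ × ℝ => (Real.exp (-p.1 / |p.2|) * |φb (|p.2|)|) ^ 2)
      ((volume.restrict (Ioc 0 B)).prod (volume.restrict (Ioc (-1) 1))) := by
  have hmeas : Measurable fun p : ℝ × ℝ => (Real.exp (-p.1 / |p.2|) * |φb (|p.2|)|) ^ 2 := by
    fun_prop
  rw [integrable_prod_iff' hmeas.aestronglyMeasurable]
  constructor
  · refine Filter.Eventually.of_forall fun μ => ?_
    have hc : Continuous fun x : ℝ => (Real.exp (-x / |μ|) * |φb (|μ|)|) ^ 2 := by fun_prop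
    exact hc.integrableOn_Ioc
  · refine Integrable.mono' hint
      (hmeas.aestronglyMeasurable.norm.prod_swap.integral_prod_right') ?_
    have h0 : ∀ᵐ μ : ℝ ∂(volume.restrict (Ioc (-1:ℝ) 1)), μ ≠ 0 := by
      refine ae_restrict_of_ae ?_
      simp [ae_iff]
    filter_upwards [h0] with μ hμ
    have hμ' : 0 < |μ| := abs_pos.2 hμ
    rw [Real.norm_of_nonneg (integral_nonneg fun _ => norm_nonneg _)]
    rcases le_total B 0 with hB | hB
    · rw [Ioc_eq_empty (by linarith)]
      simp
      positivity
    have hpt : ∀ x, ‖(Real.exp (-x / |μ|) * |φb (|μ|)|) ^ 2‖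
        = (Real.exp (-(2 * x) / |μ|)) * φb |μ| ^ 2 := fun x => by
      rw [Real.norm_of_nonneg (sq_nonneg _), mul_pow, sq_abs, ← Real.exp_nat_mul]
      congr 2
      push_cast
      ring
    simp only [hpt]
    rw [integral_mul_const, ← intervalIntegral.integral_of_le hB,
      integral_eq_sub_of_hasDerivWithinAt_Icc hB
        (f := fun y => -(|μ| / 2) * Real.exp (-(2 * y) / |μ|)) (fun y _ => by
        have h1 := (((((hasDerivAt_id y).const_mul 2).neg).div_const |μ|).exp.const_mul
          (-(|μ| / 2))).hasDerivWithinAt (s := Icc 0 B)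
        refine h1.congr_deriv ?_
        simp only [id, Pi.neg_apply]
        field_simp) (by fun_prop)]
    refine mul_le_mul_of_nonneg_right ?_ (sq_nonneg _)
    have := Real.exp_pos (-(2 * B) / |μ|)
    simp
    nlinarith

/-- The transport part of the Milne system on `[0, B] × [-1, 1]`, with inflow data `φb` of finite
energy at `0` and reflection at `B`. -/
structure IsMilneTransport (B : ℝ) (h φb : ℝ → ℝ) (φ φ' : ℝ → ℝ → ℝ) : Prop where
  pos : 0 < B
  cont : Continuous h
  meas : Measurable φb
  int : IntegrableOn (fun μ => |μ| * φb |μ| ^ 2) (Ioc (-1) 1)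
  deriv : ∀ μ ∈ Icc (-1:ℝ) 1, μ ≠ 0 → ∀ x ∈ Icc 0 B,
    HasDerivWithinAt (fun y => φ y μ) (φ' x μ) (Icc 0 B) x
  eq : ∀ x ∈ Icc 0 B, ∀ μ ∈ Icc (-1:ℝ) 1, μ ≠ 0 → μ * φ' x μ + φ x μ = h x
  inflow : ∀ μ ∈ Ioc (0:ℝ) 1, φ 0 μ = φb μ
  reflect : ∀ μ ∈ Ioc (0:ℝ) 1, φ B μ = φ B (-μ)

theorem ae_slab (B : ℝ) : ∀ᵐ p : ℝ × ℝ
    ∂((volume.restrict (Ioc 0 B)).prod (volume.restrict (Ioc (-1) 1))),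
    p.1 ∈ Ioc 0 B ∧ p.2 ∈ Ioc (-1:ℝ) 1 ∧ p.2 ≠ 0 := by
  have h0 : ∀ᵐ μ : ℝ ∂(volume.restrict (Ioc (-1:ℝ) 1)), μ ≠ 0 :=
    ae_restrict_of_ae (by simp [ae_iff])
  filter_upwards [Measure.quasiMeasurePreserving_fst.ae
      (ae_restrict_mem (μ := volume) (measurableSet_Ioc (a := 0) (b := B))),
    Measure.quasiMeasurePreserving_snd.ae
      (ae_restrict_mem (μ := volume) (measurableSet_Ioc (a := (-1:ℝ)) (b := 1))),
    Measure.quasiMeasurePreserving_snd.ae h0] with p h1 h2 h3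
  exact ⟨h1, h2, h3⟩

theorem ae_angle : ∀ᵐ μ : ℝ ∂(volume.restrict (Ioc (-1:ℝ) 1)), μ ∈ Ioc (-1:ℝ) 1 ∧ μ ≠ 0 := by
  filter_upwards [ae_restrict_mem (μ := volume) (measurableSet_Ioc (a := (-1:ℝ)) (b := 1)),
    ae_restrict_of_ae (show ∀ᵐ μ : ℝ, μ ≠ 0 by simp [ae_iff])] with μ h1 h2
  exact ⟨h1, h2⟩

theorem setIntegral_angle_eq_zero_of_odd {f : ℝ → ℝ} (hf : ∀ μ ∈ Ioc (0:ℝ) 1, f (-μ) = -f μ) :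
    ∫ μ in Ioc (-1:ℝ) 1, f μ = 0 := by
  have hodd : ∀ μ ∈ Icc (-1:ℝ) 1, μ ≠ 0 → f (-μ) = -f μ := fun μ hμ h0 => by
    rcases h0.lt_or_gt with h | h
    · have := hf (-μ) ⟨by linarith, by linarith [hμ.1]⟩
      rw [neg_neg] at this
      linarith
    · exact hf μ ⟨h, hμ.2⟩
  have h1 : ∫ μ in (-1:ℝ)..1, f (-μ) = ∫ μ in (-1:ℝ)..1, f μ := by
    rw [intervalIntegral.integral_comp_neg, neg_neg]
  have h2 : ∫ μ in (-1:ℝ)..1, f (-μ) = ∫ μ in (-1:ℝ)..1, -f μ := by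
    rw [intervalIntegral.integral_of_le (by norm_num), intervalIntegral.integral_of_le (by norm_num)]
    refine integral_congr_ae ?_
    filter_upwards [ae_angle] with μ hμ
    exact hodd μ (Ioc_subset_Icc_self hμ.1) hμ.2
  rw [intervalIntegral.integral_neg] at h2
  rw [← intervalIntegral.integral_of_le (by norm_num)]
  linarith

namespace IsMilneTransport

variable {B : ℝ} {h φb : ℝ → ℝ} {φ φ' : ℝ → ℝ → ℝ}

theorem eq_milneSolution (H : IsMilneTransport B h φb φ φ') {x μ : ℝ} (hx : x ∈ Icc 0 B)
    (hμ : μ ∈ Icc (-1:ℝ) 1) (h0 : μ ≠ 0) : φ x μ = milneSolution B h φb x μ := by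
  have duhamel : ∀ ν ∈ Icc (-1:ℝ) 1, ν ≠ 0 → ∀ y ∈ Icc 0 B, φ y ν =
      Real.exp (-y / ν) * (φ 0 ν + ν⁻¹ * ∫ z in (0:ℝ)..y, Real.exp (z / ν) * h z) :=
    fun ν hν hν0 y hy => transport_eq_duhamel (ψ := fun y => φ y ν) (ψ' := fun y => φ' y ν)
      hν0 H.cont (H.deriv ν hν hν0) (fun y hy => H.eq y hy ν hν hν0) hy
  have hB : B ∈ Icc 0 B := right_mem_Icc.2 H.pos.le
  unfold milneSolution
  rcases h0.lt_or_gt with hneg | hpos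
  · have hμ' : -μ ∈ Ioc (0:ℝ) 1 := ⟨by linarith, by linarith [hμ.1]⟩
    have e1 := duhamel (-μ) ⟨by linarith [hμ'.1], hμ'.2⟩ (neg_ne_zero.2 h0) B hB
    have e2 := duhamel μ hμ h0 B hB
    have e3 := H.reflect (-μ) hμ'
    rw [neg_neg] at e3
    rw [H.inflow (-μ) hμ', neg_div_neg_eq] at e1
    simp only [not_lt.2 hneg.le, if_false]
    rw [duhamel μ hμ h0 x hx, ← e1, e3, e2]
    have : Real.exp (B / μ) * Real.exp (-B / μ) = 1 := by
      rw [← Real.exp_add, neg_div, add_neg_cancel, Real.exp_zero]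
    rw [← mul_assoc (Real.exp (B / μ)), this]
    ring
  · simp only [hpos, if_true]
    rw [duhamel μ hμ h0 x hx, H.inflow μ ⟨hpos, hμ.2⟩]

theorem exists_bound (H : IsMilneTransport B h φb φ φ') : ∃ K, 0 ≤ K ∧ ∀ x ∈ Icc 0 B,
    ∀ μ ∈ Icc (-1:ℝ) 1, μ ≠ 0 → |φ x μ| ≤ K + Real.exp (-x / |μ|) * |φb (|μ|)| := by
  obtain ⟨K, hK⟩ := isCompact_Icc.exists_bound_of_continuousOn
    (H.cont.continuousOn (s := Icc 0 B))
  have hB : B ∈ Icc 0 B := right_mem_Icc.2 H.pos.le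
  have hK0 : 0 ≤ K := (norm_nonneg _).trans (hK B hB)
  have hposb : ∀ μ ∈ Ioc (0:ℝ) 1, ∀ x ∈ Icc 0 B,
      |φ x μ| ≤ K + Real.exp (-x / μ) * |φb μ| := fun μ hμ x hx => by
    have hμ' : μ ∈ Icc (-1:ℝ) 1 := ⟨by linarith [hμ.1], hμ.2⟩
    rw [← H.inflow μ hμ]
    exact abs_transport_le (ψ := fun y => φ y μ) (ψ' := fun y => φ' y μ) hμ.1 H.cont hK
      (H.deriv μ hμ' hμ.1.ne') (fun y hy => H.eq y hy μ hμ' hμ.1.ne') hx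
  refine ⟨2 * K, by positivity, fun x hx μ hμ h0 => ?_⟩
  rcases h0.lt_or_gt with hneg | hpos
  · have hμ' : -μ ∈ Ioc (0:ℝ) 1 := ⟨by linarith, by linarith [hμ.1]⟩
    have hrefl : ∀ y ∈ Icc 0 B, B - y ∈ Icc 0 B := fun y hy =>
      ⟨by linarith [hy.2], by linarith [hy.1]⟩
    have hback := abs_transport_le (B := B) (ψ := fun y => φ (B - y) μ)
      (ψ' := fun y => - φ' (B - y) μ) (h := fun y => h (B - y)) (K := K) hμ'.1
      (by have := H.cont; fun_prop) (fun y hy => hK _ (hrefl y hy))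
      (fun y hy => by
        have h1 : HasDerivWithinAt (fun y => B - y) (-1) (Icc 0 B) y :=
          ((hasDerivAt_id y).const_sub B).hasDerivWithinAt
        have h2 := (H.deriv μ hμ h0 (B - y) (hrefl y hy)).comp y h1 hrefl
        exact h2.congr_deriv (by ring))
      (fun y hy => by rw [← H.eq (B - y) (hrefl y hy) μ hμ h0]; ring) (hrefl x hx)
    have hre := H.reflect (-μ) hμ'
    rw [neg_neg] at hre
    simp only [sub_sub_cancel, sub_zero] at hback
    rw [← hre] at hback
    have hin := hposb (-μ) hμ' B hB
    rw [abs_of_neg hneg]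
    have e1 : Real.exp (-(B - x) / -μ) ≤ 1 := by
      rw [Real.exp_le_one_iff]
      exact div_nonpos_of_nonpos_of_nonneg (by linarith [hx.2]) hμ'.1.le
    have e2 : Real.exp (-B / -μ) ≤ Real.exp (-x / -μ) := by
      rw [Real.exp_le_exp]
      have := hμ'.1
      have := hx.2
      gcongr
    calc |φ x μ| ≤ K + Real.exp (-(B - x) / -μ) * |φ B (-μ)| := hback
      _ ≤ K + 1 * (K + Real.exp (-x / -μ) * |φb (-μ)|) := by
        gcongr
        exact hin.trans (by gcongr)
      _ = _ := by ring
  · rw [abs_of_pos hpos]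
    have := hposb μ ⟨hpos, hμ.2⟩ x hx
    linarith

theorem aestronglyMeasurable (H : IsMilneTransport B h φb φ φ') :
    AEStronglyMeasurable (fun p : ℝ × ℝ => φ p.1 p.2)
      ((volume.restrict (Ioc 0 B)).prod (volume.restrict (Ioc (-1) 1))) := by
  refine (stronglyMeasurable_milneSolution (B := B) H.cont H.meas).aestronglyMeasurable.congr ?_
  filter_upwards [ae_slab B] with p hp
  exact (H.eq_milneSolution (Ioc_subset_Icc_self hp.1) (Ioc_subset_Icc_self hp.2.1) hp.2.2).symm

theorem aestronglyMeasurable_slice (H : IsMilneTransport B h φb φ φ') {x : ℝ}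
    (hx : x ∈ Icc 0 B) :
    AEStronglyMeasurable (fun μ => φ x μ) (volume.restrict (Ioc (-1) 1)) := by
  have hm := (stronglyMeasurable_milneSolution (B := B) H.cont H.meas).measurable.comp
    (measurable_prodMk_left (x := x))
  refine hm.aestronglyMeasurable.congr ?_
  filter_upwards [ae_angle] with μ hμ
  exact (H.eq_milneSolution hx (Ioc_subset_Icc_self hμ.1) hμ.2).symm

theorem integrable_sq (H : IsMilneTransport B h φb φ φ') :
    Integrable (fun p : ℝ × ℝ => φ p.1 p.2 ^ 2)
      ((volume.restrict (Ioc 0 B)).prod (volume.restrict (Ioc (-1) 1))) := by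
  obtain ⟨K, hK0, hK⟩ := H.exists_bound
  refine Integrable.mono' (((integrable_const (K ^ 2)).add
    (integrable_decay (B := B) H.meas H.int)).const_mul 2) (H.aestronglyMeasurable.pow 2) ?_
  filter_upwards [ae_slab B] with p hp
  have := hK p.1 (Ioc_subset_Icc_self hp.1) p.2 (Ioc_subset_Icc_self hp.2.1) hp.2.2
  rw [Real.norm_of_nonneg (sq_nonneg _), ← sq_abs]
  simp only [Pi.add_apply]
  set D := Real.exp (-p.1 / |p.2|) * |φb (|p.2|)|
  nlinarith [abs_nonneg (φ p.1 p.2), sq_nonneg (K - D)]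

theorem integrable (H : IsMilneTransport B h φb φ φ') :
    Integrable (fun p : ℝ × ℝ => φ p.1 p.2)
      ((volume.restrict (Ioc 0 B)).prod (volume.restrict (Ioc (-1) 1))) :=
  ((memLp_two_iff_integrable_sq H.aestronglyMeasurable).2 H.integrable_sq).integrable
    one_le_two

theorem integrable_mul_sq_slice (H : IsMilneTransport B h φb φ φ') {x : ℝ} (hx : x ∈ Icc 0 B) :
    Integrable (fun μ => μ * φ x μ ^ 2) (volume.restrict (Ioc (-1) 1)) := by
  obtain ⟨K, hK0, hK⟩ := H.exists_bound
  refine Integrable.mono' (((integrable_const (K ^ 2)).add H.int).const_mul 2)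
    (measurable_id.aestronglyMeasurable.mul ((H.aestronglyMeasurable_slice hx).pow 2)) ?_
  filter_upwards [ae_angle] with μ hμ
  have hb := hK x hx μ (Ioc_subset_Icc_self hμ.1) hμ.2
  have he : Real.exp (-x / |μ|) ≤ 1 := by
    rw [Real.exp_le_one_iff]
    exact div_nonpos_of_nonpos_of_nonneg (by linarith [hx.1]) (abs_nonneg _)
  have hb' : |φ x μ| ≤ K + |φb (|μ|)| :=
    hb.trans (by gcongr; exact mul_le_of_le_one_left (abs_nonneg _) he)
  have hμ1 : |μ| ≤ 1 := abs_le.2 ⟨hμ.1.1.le, hμ.1.2⟩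
  rw [Real.norm_eq_abs, abs_mul, abs_of_nonneg (sq_nonneg (φ x μ))]
  simp only [Pi.add_apply]
  have hsq : φ x μ ^ 2 ≤ 2 * K ^ 2 + 2 * φb |μ| ^ 2 := by
    rw [← sq_abs, ← sq_abs (φb _)]
    nlinarith [abs_nonneg (φ x μ), sq_nonneg (K - |φb (|μ|)|)]
  nlinarith [abs_nonneg μ, sq_nonneg K, mul_le_mul_of_nonneg_left hsq (abs_nonneg μ)]

theorem integrable_mul_slice (H : IsMilneTransport B h φb φ φ') {x : ℝ} (hx : x ∈ Icc 0 B) :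
    Integrable (fun μ => μ * φ x μ) (volume.restrict (Ioc (-1) 1)) := by
  refine Integrable.mono' ((integrable_const 1).add (H.integrable_mul_sq_slice hx).abs)
    (measurable_id.aestronglyMeasurable.mul (H.aestronglyMeasurable_slice hx)) ?_
  filter_upwards [ae_angle] with μ hμ
  have hμ1 : |μ| ≤ 1 := abs_le.2 ⟨hμ.1.1.le, hμ.1.2⟩
  simp only [Pi.add_apply, Real.norm_eq_abs, abs_mul, abs_pow]
  nlinarith [abs_nonneg μ, abs_nonneg (φ x μ), mul_nonneg (abs_nonneg μ)
    (sq_nonneg (|φ x μ| - 1)), mul_nonneg (abs_nonneg μ) (abs_nonneg (φ x μ))]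

theorem continuousOn_slice (H : IsMilneTransport B h φb φ φ') {μ : ℝ}
    (hμ : μ ∈ Icc (-1:ℝ) 1) (h0 : μ ≠ 0) : ContinuousOn (fun x => φ x μ) (Icc 0 B) :=
  fun x hx => (H.deriv μ hμ h0 x hx).continuousWithinAt

/-- Conservation law for the flux `∫ μ φ dμ`, which vanishes at the reflecting end. -/
theorem flux_eq (H : IsMilneTransport B h φb φ φ') {x : ℝ} (hx : x ∈ Icc 0 B) :
    ∫ μ in Ioc (-1:ℝ) 1, μ * φ x μ
      = -∫ y in Ioc x B, ∫ μ in Ioc (-1:ℝ) 1, (h y - φ y μ) := by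
  have hB : B ∈ Icc 0 B := right_mem_Icc.2 H.pos.le
  have hprod : Integrable (fun p : ℝ × ℝ => h p.1 - φ p.1 p.2)
      ((volume.restrict (Ioc x B)).prod (volume.restrict (Ioc (-1) 1))) := by
    have h1 : Integrable (fun p : ℝ × ℝ => h p.1 - φ p.1 p.2)
        ((volume.restrict (Ioc 0 B)).prod (volume.restrict (Ioc (-1) 1))) :=
      Integrable.sub (Integrable.comp_fst (H.cont.integrableOn_Ioc) _) H.integrable
    rw [Measure.prod_restrict] at h1 ⊢
    exact IntegrableOn.mono_set h1 (prod_mono (Ioc_subset_Ioc_left hx.1) subset_rfl)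
  have hslice : ∀ᵐ μ ∂(volume.restrict (Ioc (-1:ℝ) 1)),
      μ * φ B μ - μ * φ x μ = ∫ y in Ioc x B, (h y - φ y μ) := by
    filter_upwards [ae_angle] with μ hμ
    have hμI := Ioc_subset_Icc_self hμ.1
    have hsub : Icc x B ⊆ Icc 0 B := Icc_subset_Icc_left hx.1
    rw [← intervalIntegral.integral_of_le hx.2,
      integral_eq_sub_of_hasDerivWithinAt_Icc hx.2 (f := fun y => μ * φ y μ)
        (f' := fun y => h y - φ y μ)
        (fun y hy => (((H.deriv μ hμI hμ.2 y (hsub hy)).mono hsub).const_mul μ).congr_deriv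
          (by rw [← H.eq y (hsub hy) μ hμI hμ.2]; ring))
        (H.cont.continuousOn.sub ((H.continuousOn_slice hμI hμ.2).mono hsub))]
  rw [integral_integral_swap hprod, ← integral_congr_ae hslice,
    integral_sub (H.integrable_mul_slice hB) (H.integrable_mul_slice hx),
    setIntegral_angle_eq_zero_of_odd (f := fun μ => μ * φ B μ)]
  · ring
  · intro μ hμ
    rw [← H.reflect μ hμ]
    ring

theorem integrable_energy_density (H : IsMilneTransport B h φb φ φ') (β : ℝ) :
    Integrable (fun p : ℝ × ℝ => 2 * Real.exp (2 * β * p.1) *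
        (β * p.2 * φ p.1 p.2 ^ 2 + φ p.1 p.2 * (h p.1 - φ p.1 p.2)))
      ((volume.restrict (Ioc 0 B)).prod (volume.restrict (Ioc (-1) 1))) := by
  have hcont := H.cont
  obtain ⟨C, hC⟩ := isCompact_Icc.exists_bound_of_continuousOn
    (show ContinuousOn h (Icc 0 B) from H.cont.continuousOn)
  obtain ⟨E, hE⟩ := isCompact_Icc.exists_bound_of_continuousOn
    (show ContinuousOn (fun x => 2 * Real.exp (2 * β * x)) (Icc 0 B) by fun_prop)
  have hmφ := H.aestronglyMeasurable
  have i1 : Integrable (fun p : ℝ × ℝ => β * p.2 * φ p.1 p.2 ^ 2)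
      ((volume.restrict (Ioc 0 B)).prod (volume.restrict (Ioc (-1) 1))) := by
    refine H.integrable_sq.bdd_mul (c := |β|) (f := fun p : ℝ × ℝ => β * p.2)
      (by fun_prop) ?_
    filter_upwards [ae_slab B] with p hp
    rw [Real.norm_eq_abs, abs_mul]
    exact mul_le_of_le_one_right (abs_nonneg _) (abs_le.2 ⟨hp.2.1.1.le, hp.2.1.2⟩)
  have i2 : Integrable (fun p : ℝ × ℝ => φ p.1 p.2 * (h p.1 - φ p.1 p.2))
      ((volume.restrict (Ioc 0 B)).prod (volume.restrict (Ioc (-1) 1))) := by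
    have : Integrable (fun p : ℝ × ℝ => h p.1 * φ p.1 p.2)
      ((volume.restrict (Ioc 0 B)).prod (volume.restrict (Ioc (-1) 1))) := by
      refine H.integrable.bdd_mul (c := C) (f := fun p : ℝ × ℝ => h p.1)
        (hcont.comp continuous_fst).aestronglyMeasurable ?_
      filter_upwards [ae_slab B] with p hp
      exact hC _ (Ioc_subset_Icc_self hp.1)
    refine (this.sub H.integrable_sq).congr (Filter.Eventually.of_forall fun p => ?_)
    simp only [Pi.sub_apply]
    ring
  refine (i1.add i2).bdd_mul (c := E) (f := fun p : ℝ × ℝ => 2 * Real.exp (2 * β * p.1))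
    (by fun_prop) ?_
  filter_upwards [ae_slab B] with p hp
  exact hE _ (Ioc_subset_Icc_self hp.1)

/-- Weighted energy identity for the transport equation. -/
theorem energy_eq (H : IsMilneTransport B h φb φ φ') (β : ℝ) :
    -∫ μ in Ioc (-1:ℝ) 1, μ * φ 0 μ ^ 2 = ∫ x in Ioc 0 B, ∫ μ in Ioc (-1:ℝ) 1,
      2 * Real.exp (2 * β * x) * (β * μ * φ x μ ^ 2 + φ x μ * (h x - φ x μ)) := by
  have hB : B ∈ Icc 0 B := right_mem_Icc.2 H.pos.le
  have hslice : ∀ᵐ μ ∂(volume.restrict (Ioc (-1:ℝ) 1)),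
      Real.exp (2 * β * B) * (μ * φ B μ ^ 2) - μ * φ 0 μ ^ 2 = ∫ x in Ioc 0 B,
        2 * Real.exp (2 * β * x) * (β * μ * φ x μ ^ 2 + φ x μ * (h x - φ x μ)) := by
    filter_upwards [ae_angle] with μ hμ
    have hμI := Ioc_subset_Icc_self hμ.1
    have hφc := H.continuousOn_slice hμI hμ.2
    have hhc : ContinuousOn h (Icc 0 B) := H.cont.continuousOn
    rw [← intervalIntegral.integral_of_le H.pos.le,
      integral_eq_sub_of_hasDerivWithinAt_Icc H.pos.le
        (f := fun x => Real.exp (2 * β * x) * (μ * φ x μ ^ 2)) (fun x hx => by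
          have h1 : HasDerivWithinAt (fun x => Real.exp (2 * β * x))
              (Real.exp (2 * β * x) * (2 * β * 1)) (Icc 0 B) x :=
            (((hasDerivAt_id x).const_mul (2 * β)).exp).hasDerivWithinAt
          refine (h1.mul (((H.deriv μ hμI hμ.2 x hx).pow 2).const_mul μ)).congr_deriv ?_
          rw [← H.eq x hx μ hμI hμ.2]
          simp only [Pi.pow_apply]
          push_cast
          ring) (by fun_prop)]
    simp
  rw [integral_integral_swap (H.integrable_energy_density β), ← integral_congr_ae hslice,
    integral_sub ((H.integrable_mul_sq_slice hB).const_mul _)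
      (H.integrable_mul_sq_slice (left_mem_Icc.2 H.pos.le)), integral_const_mul,
    setIntegral_angle_eq_zero_of_odd (f := fun μ => μ * φ B μ ^ 2)]
  · ring
  · intro μ hμ
    rw [← H.reflect μ hμ]
    ring

theorem estimate (H : IsMilneTransport B h φb φ φ') {β : ℝ} (hβ : β ∈ Ico (0:ℝ) 1)
    {θ θ' S g' g'' : ℝ → ℝ} (hS : ContinuousOn S (Icc 0 B))
    (hh : ∀ x ∈ Icc 0 B, h x = S x + θ x)
    (hθ : ∀ x ∈ Icc 0 B, HasDerivWithinAt θ (θ' x) (Icc 0 B) x)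
    (hθ' : ContinuousOn θ' (Icc 0 B))
    (hg' : ∀ x ∈ Icc 0 B, HasDerivWithinAt g' (g'' x) (Icc 0 B) x)
    (hg'' : ContinuousOn g'' (Icc 0 B))
    (hode : ∀ x ∈ Icc 0 B, g'' x + ∫ μ in Ioc (-1:ℝ) 1, (φ x μ - θ x) = 2 * S x)
    (hθ0 : θ 0 = 0) (hgB : g' B = 0)
    (hcoer : 0 ≤ ∫ x in (0:ℝ)..B, Real.exp (2 * β * x) * (θ' x * g' x)) :
    (1 - β) * (∫ x in Ioc 0 B, ∫ μ in Ioc (-1:ℝ) 1, Real.exp (2 * β * x) * (φ x μ - θ x) ^ 2)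
      ≤ (∫ μ in Ioc (-1:ℝ) 1, μ * φ 0 μ ^ 2)
        + 2 / (1 - β) * ∫ x in Ioc 0 B, Real.exp (2 * β * x) * S x ^ 2 := by
  have hβ1 : 0 < 1 - β := by linarith [hβ.2]
  have hθc : ContinuousOn θ (Icc 0 B) := fun x hx => (hθ x hx).continuousWithinAt
  have hg'c : ContinuousOn g' (Icc 0 B) := fun x hx => (hg' x hx).continuousWithinAt
  have hφint : ∀ᵐ x ∂(volume.restrict (Ioc 0 B)),
      Integrable (fun μ => φ x μ) (volume.restrict (Ioc (-1:ℝ) 1)) := H.integrable.prod_right_ae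
  have hφsq : ∀ᵐ x ∂(volume.restrict (Ioc 0 B)),
      Integrable (fun μ => φ x μ ^ 2) (volume.restrict (Ioc (-1:ℝ) 1)) :=
    H.integrable_sq.prod_right_ae
  have hmem : ∀ᵐ x ∂(volume.restrict (Ioc 0 B)), x ∈ Ioc 0 B := ae_restrict_mem measurableSet_Ioc
  have hvol : ∀ c : ℝ, ∫ _ in Ioc (-1:ℝ) 1, c = 2 * c := fun c => by
    rw [setIntegral_const, Real.volume_real_Ioc_of_le (by norm_num), smul_eq_mul]
    norm_num
  have hmean : ∀ᵐ x ∂(volume.restrict (Ioc 0 B)),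
      ∫ μ in Ioc (-1:ℝ) 1, φ x μ = 2 * θ x + 2 * S x - g'' x := by
    filter_upwards [hφint, hmem] with x hx hxm
    have := hode x (Ioc_subset_Icc_self hxm)
    rw [integral_sub hx (integrable_const _), hvol] at this
    linarith
  have hflux : ∀ x ∈ Icc 0 B, ∫ μ in Ioc (-1:ℝ) 1, μ * φ x μ = g' x := fun x hx => by
    have hsub : Icc x B ⊆ Icc 0 B := Icc_subset_Icc_left hx.1
    have hae : ∀ᵐ y ∂(volume.restrict (Ioc x B)),
        ∫ μ in Ioc (-1:ℝ) 1, (h y - φ y μ) = g'' y := by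
      refine ae_restrict_of_ae_restrict_of_subset (Ioc_subset_Ioc_left hx.1) ?_
      filter_upwards [hφint, hmem, hmean] with y hy hym hymean
      rw [integral_sub (integrable_const _) hy, hvol, hymean, hh y (Ioc_subset_Icc_self hym)]
      ring
    rw [H.flux_eq hx, integral_congr_ae hae, ← intervalIntegral.integral_of_le hx.2,
      integral_eq_sub_of_hasDerivWithinAt_Icc hx.2 (fun y hy => (hg' y (hsub hy)).mono hsub)
        (hg''.mono hsub), hgB]
    ring
  have hdev : ∀ᵐ x ∂(volume.restrict (Ioc 0 B)),
      Integrable (fun μ => (φ x μ - θ x) ^ 2) (volume.restrict (Ioc (-1:ℝ) 1)) := by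
    filter_upwards [hφint, hφsq] with x h1 h2
    refine ((h2.sub (h1.const_mul (2 * θ x))).add (integrable_const (θ x ^ 2))).congr
      (Filter.Eventually.of_forall fun μ => ?_)
    simp only [Pi.add_apply, Pi.sub_apply]
    ring
  have hcint : ∀ f : ℝ → ℝ, ContinuousOn f (Icc 0 B) →
      Integrable f (volume.restrict (Ioc 0 B)) := fun f hf =>
    (hf.integrableOn_Icc).mono_set Ioc_subset_Icc_self
  have hdissip : Integrable (fun x => ∫ μ in Ioc (-1:ℝ) 1,
      Real.exp (2 * β * x) * (φ x μ - θ x) ^ 2) (volume.restrict (Ioc 0 B)) := by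
    have h1 : Integrable (fun x => ∫ μ in Ioc (-1:ℝ) 1, φ x μ ^ 2)
      (volume.restrict (Ioc 0 B)) := H.integrable_sq.integral_prod_left
    have h2 := h1.add (hcint (fun x => -(2 * θ x) * (2 * θ x + 2 * S x - g'' x) + 2 * θ x ^ 2)
      (by fun_prop))
    obtain ⟨E, hE⟩ := isCompact_Icc.exists_bound_of_continuousOn
      (show ContinuousOn (fun x => Real.exp (2 * β * x)) (Icc 0 B) by fun_prop)
    refine (h2.bdd_mul (c := E) (f := fun x : ℝ => Real.exp (2 * β * x)) (by fun_prop)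
      ?_).congr ?_
    · filter_upwards [hmem] with x hx
      exact hE x (Ioc_subset_Icc_self hx)
    · filter_upwards [hφint, hφsq, hmean] with x h3 h4 h5
      rw [integral_const_mul]
      congr 1
      have : ∀ μ, (φ x μ - θ x) ^ 2 = φ x μ ^ 2 - 2 * θ x * φ x μ + θ x ^ 2 := fun μ => by ring
      simp only [this, Pi.add_apply]
      have h6 : Integrable (fun μ => φ x μ ^ 2 - 2 * θ x * φ x μ)
        (volume.restrict (Ioc (-1:ℝ) 1)) := h4.sub (h3.const_mul _)
      rw [integral_add h6 (integrable_const _),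
        integral_sub h4 (h3.const_mul _), integral_const_mul, h5, hvol]
      ring
  have hinner : ∀ᵐ x ∂(volume.restrict (Ioc 0 B)),
      ∫ μ in Ioc (-1:ℝ) 1,
        2 * Real.exp (2 * β * x) * (β * μ * φ x μ ^ 2 + φ x μ * (h x - φ x μ))
      ≤ -(1 - β) * (∫ μ in Ioc (-1:ℝ) 1, Real.exp (2 * β * x) * (φ x μ - θ x) ^ 2)
        + 2 / (1 - β) * (Real.exp (2 * β * x) * S x ^ 2)
        + 2 * (Real.exp (2 * β * x) * (2 * β * θ x * g' x + θ x * g'' x)) := by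
    filter_upwards [hφint, hφsq, hmean, hdev, hmem,
      (H.integrable_energy_density β).prod_right_ae] with x h1 h2 h3 h4 hxm h5
    have hx := Ioc_subset_Icc_self hxm
    have j1 := h4.const_mul (-(1 - β) / 2)
    have j2 := (H.integrable_mul_slice hx).const_mul (2 * β * θ x)
    have hid : Integrable (fun μ : ℝ => μ) (volume.restrict (Ioc (-1:ℝ) 1)) :=
      continuous_id.integrableOn_Ioc
    have j3 := hid.const_mul (-β * θ x ^ 2)
    have j4 := h1.const_mul (-θ x)
    have j5 : Integrable (fun _ : ℝ => S x ^ 2 / (2 * (1 - β)) + θ x * S x + θ x ^ 2)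
      (volume.restrict (Ioc (-1:ℝ) 1)) := integrable_const _
    have hodd : ∫ μ in Ioc (-1:ℝ) 1, μ = 0 :=
      setIntegral_angle_eq_zero_of_odd (f := fun μ => μ) fun _ _ => rfl
    have hle := integral_mono_ae h5
      (((((j1.add j2).add j3).add j4).add j5).const_mul (2 * Real.exp (2 * β * x))) (by
        filter_upwards [ae_angle] with μ hμ
        refine mul_le_mul_of_nonneg_left ?_ (by positivity)
        simp only [Pi.add_apply]
        rw [hh x hx]
        have hy : (φ x μ - θ x) * S x
            ≤ (1 - β) / 2 * (φ x μ - θ x) ^ 2 + S x ^ 2 / (2 * (1 - β)) := by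
          have : 0 ≤ ((1 - β) * (φ x μ - θ x) - S x) ^ 2 / (2 * (1 - β)) := by positivity
          have e : ((1 - β) * (φ x μ - θ x) - S x) ^ 2 / (2 * (1 - β))
            = (1 - β) / 2 * (φ x μ - θ x) ^ 2 + S x ^ 2 / (2 * (1 - β))
              - (φ x μ - θ x) * S x := by
            field_simp
            ring
          linarith
        have hm : 0 ≤ β * (1 - μ) * (φ x μ - θ x) ^ 2 :=
          mul_nonneg (mul_nonneg hβ.1 (by linarith [hμ.1.2])) (sq_nonneg _)
        linarith)
    refine hle.trans (le_of_eq ?_)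
    rw [integral_const_mul, integral_add' (((j1.add j2).add j3).add j4) j5,
      integral_add' ((j1.add j2).add j3) j4, integral_add' (j1.add j2) j3, integral_add' j1 j2,
      hvol, integral_const_mul, integral_const_mul, integral_const_mul, integral_const_mul,
      integral_const_mul, hflux x hx, hodd, h3]
    field_simp
    ring
  have hparts : ∫ x in Ioc 0 B, Real.exp (2 * β * x) * (2 * β * θ x * g' x + θ x * g'' x)
      = -∫ x in (0:ℝ)..B, Real.exp (2 * β * x) * (θ' x * g' x) := by
    have h1 := integral_eq_sub_of_hasDerivWithinAt_Icc H.pos.le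
      (f := fun x => Real.exp (2 * β * x) * (θ x * g' x))
      (f' := fun x => Real.exp (2 * β * x) * (2 * β * θ x * g' x + θ x * g'' x)
        + Real.exp (2 * β * x) * (θ' x * g' x)) (fun x hx => by
          have h1 : HasDerivWithinAt (fun x => Real.exp (2 * β * x))
              (Real.exp (2 * β * x) * (2 * β * 1)) (Icc 0 B) x :=
            (((hasDerivAt_id x).const_mul (2 * β)).exp).hasDerivWithinAt
          exact (h1.mul ((hθ x hx).mul (hg' x hx))).congr_deriv (by simp only [Pi.mul_apply]; ring))
      (by fun_prop)
    rw [hθ0, hgB, intervalIntegral.integral_of_le H.pos.le,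
      integral_add (hcint _ (by fun_prop)) (hcint _ (by fun_prop)),
      ← intervalIntegral.integral_of_le (f := fun x => _ * (θ' x * g' x)) H.pos.le] at h1
    linarith
  have i2 := (hcint (fun x => Real.exp (2 * β * x) * S x ^ 2) (by fun_prop)).const_mul
    (2 / (1 - β))
  have i3 := (hcint (fun x => Real.exp (2 * β * x) * (2 * β * θ x * g' x + θ x * g'' x))
    (by fun_prop)).const_mul 2
  have hfin := integral_mono_ae (H.integrable_energy_density β).integral_prod_left
    (((hdissip.const_mul (-(1 - β))).add i2).add i3) hinner
  rw [← H.energy_eq β, integral_add' ((hdissip.const_mul _).add i2) i3,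
    integral_add' (hdissip.const_mul _) i2, integral_const_mul, integral_const_mul,
    integral_const_mul, hparts] at hfin
  linarith

end IsMilneTransport

theorem integrableOn_comp_abs {f : ℝ → ℝ} (hf : IntegrableOn f (Ioc 0 1)) :
    IntegrableOn (fun μ => f |μ|) (Ioc (-1) 1) := by
  have h1 : IntervalIntegrable f volume 0 1 :=
    (intervalIntegrable_iff_integrableOn_Ioc_of_le zero_le_one).2 hf
  have h2 : IntervalIntegrable (fun μ => f (-μ)) volume (-1) 0 := by
    have := ((IntervalIntegrable.iff_comp_neg (f := f)).1 h1).symm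
    rwa [neg_zero] at this
  have h3 : IntervalIntegrable (fun μ => f |μ|) volume (-1) 0 :=
    h2.congr fun μ hμ => by
      rw [uIoc_of_le (by norm_num)] at hμ
      simp only [abs_of_nonpos hμ.2]
  have h4 : IntervalIntegrable (fun μ => f |μ|) volume 0 1 :=
    h1.congr fun μ hμ => by
      rw [uIoc_of_le zero_le_one] at hμ
      simp only [abs_of_pos hμ.1]
  exact (intervalIntegrable_iff_integrableOn_Ioc_of_le (by norm_num)).1 (h3.trans h4)

/-- Weighted energy estimate for the linearized Milne system on a bounded
interval [0,B]. -/
theorem stmt_3 (B β : ℝ) (hB : 0 < B) (hβ : β ∈ Set.Ico (0:ℝ) 1)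
    (T T' : ℝ → ℝ)
    (hT : ∀ x ∈ Set.Icc (0:ℝ) B, HasDerivWithinAt T (T' x) (Set.Icc 0 B) x)
    (hT'c : ContinuousOn T' (Set.Icc 0 B))
    (hTpos : ∀ x ∈ Set.Icc (0:ℝ) B, 0 ≤ T x)
    -- weighted coercivity inequality
    (hcoer : ∀ f f' : ℝ → ℝ,
      (∀ x ∈ Set.Icc (0:ℝ) B, HasDerivWithinAt f (f' x) (Set.Icc 0 B) x) →
      ContinuousOn f' (Set.Icc 0 B) → f 0 = 0 →
      0 ≤ (∫ x in (0:ℝ)..B, Real.exp (2*β*x) * (4 * T x ^ 3 * f' x ^ 2))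
        + (∫ x in (0:ℝ)..B, Real.exp (2*β*x) * (12 * T x ^ 2 * T' x * f x * f' x)))
    (S₁ : ℝ → ℝ) (hS₁ : ContinuousOn S₁ (Set.Icc 0 B))
    (φb : ℝ → ℝ) (hφbmeas : Measurable φb)
    (hφbint : IntegrableOn (fun μ => μ * φb μ ^ 2) (Set.Ioc 0 1))
    (g g' g'' : ℝ → ℝ) (φ φ' : ℝ → ℝ → ℝ)
    (hg1 : ∀ x ∈ Set.Icc (0:ℝ) B, HasDerivWithinAt g (g' x) (Set.Icc 0 B) x)
    (hg2 : ∀ x ∈ Set.Icc (0:ℝ) B, HasDerivWithinAt g' (g'' x) (Set.Icc 0 B) x)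
    (hg2c : ContinuousOn g'' (Set.Icc 0 B))
    (hφreg : ∀ μ ∈ Set.Icc (-1:ℝ) 1, μ ≠ 0 →
      (∀ x ∈ Set.Icc (0:ℝ) B, HasDerivWithinAt (fun y => φ y μ) (φ' x μ) (Set.Icc 0 B) x) ∧
      ContinuousOn (fun x => φ' x μ) (Set.Icc 0 B))
    -- the linearized system with source
    (hode : ∀ x ∈ Set.Icc (0:ℝ) B,
      g'' x + (∫ μ in (-1:ℝ)..1, (φ x μ - 4 * T x ^ 3 * g x)) = 2 * S₁ x)
    (htr : ∀ x ∈ Set.Icc (0:ℝ) B, ∀ μ ∈ Set.Icc (-1:ℝ) 1, μ ≠ 0 →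
      μ * φ' x μ + φ x μ - 4 * T x ^ 3 * g x = S₁ x)
    -- boundary conditions
    (hg0 : g 0 = 0) (hgB : g' B = 0)
    (hφ0 : ∀ μ ∈ Set.Ioc (0:ℝ) 1, φ 0 μ = φb μ)
    (hφB : ∀ μ ∈ Set.Ioc (0:ℝ) 1, φ B μ = φ B (-μ)) :
    (∫ x in (0:ℝ)..B, (∫ μ in (-1:ℝ)..1,
        Real.exp (2*β*x) * (φ x μ - 4 * T x ^ 3 * g x) ^ 2))
      + (1/(1-β)) * (∫ μ in (-1:ℝ)..0, |μ| * (φ 0 μ) ^ 2)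
      ≤ (1/(1-β)) * (∫ μ in (0:ℝ)..1, μ * φb μ ^ 2)
        + (2/(1-β)^2) * (∫ x in (0:ℝ)..B, Real.exp (2*β*x) * S₁ x ^ 2) := by
  have hβ1 : 0 < 1 - β := by linarith [hβ.2]
  have hTc : ContinuousOn T (Icc 0 B) := fun x hx => (hT x hx).continuousWithinAt
  have hgc : ContinuousOn g (Icc 0 B) := fun x hx => (hg1 x hx).continuousWithinAt
  have hg'c : ContinuousOn g' (Icc 0 B) := fun x hx => (hg2 x hx).continuousWithinAt
  have hsrc : ContinuousOn (fun x => S₁ x + 4 * T x ^ 3 * g x) (Icc 0 B) := by fun_prop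
  have hext : ∀ x ∈ Icc 0 B, IccExtend hB.le
      ((Icc 0 B).domRestrict fun x => S₁ x + 4 * T x ^ 3 * g x) x = S₁ x + 4 * T x ^ 3 * g x :=
    fun x hx => by rw [IccExtend_of_mem _ _ hx, domRestrict_apply]
  have H : IsMilneTransport B (IccExtend hB.le
      ((Icc 0 B).domRestrict fun x => S₁ x + 4 * T x ^ 3 * g x)) φb φ φ' :=
    { pos := hB
      cont := hsrc.domRestrict.Icc_extend'
      meas := hφbmeas
      int := integrableOn_comp_abs hφbint
      deriv := fun μ hμ h0 => (hφreg μ hμ h0).1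
      eq := fun x hx μ hμ h0 => by
        rw [hext x hx]
        linarith [htr x hx μ hμ h0]
      inflow := hφ0
      reflect := hφB }
  have hθ : ∀ x ∈ Icc 0 B, HasDerivWithinAt (fun x => 4 * T x ^ 3 * g x)
      (12 * T x ^ 2 * T' x * g x + 4 * T x ^ 3 * g' x) (Icc 0 B) x := fun x hx =>
    ((((hT x hx).pow 3).const_mul 4).mul (hg1 x hx)).congr_deriv (by
      simp only [Pi.pow_apply]
      push_cast
      ring)
  have hc := hcoer g g' hg1 hg'c hg0
  rw [← intervalIntegral.integral_add
    (ContinuousOn.intervalIntegrable (by rw [uIcc_of_le hB.le]; fun_prop))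
    (ContinuousOn.intervalIntegrable (by rw [uIcc_of_le hB.le]; fun_prop))] at hc
  have hest := H.estimate (S := S₁) hβ hS₁ hext hθ (by fun_prop) hg2 hg2c
    (fun x hx => by
      rw [← intervalIntegral.integral_of_le (by norm_num)]
      exact hode x hx) (by simp [hg0]) hgB
    (hc.trans_eq (intervalIntegral.integral_congr fun x _ => by ring))
  have hsq := H.integrable_mul_sq_slice (left_mem_Icc.2 hB.le)
  have hsplit : ∫ μ in Ioc (-1:ℝ) 1, μ * φ 0 μ ^ 2
      = (∫ μ in (0:ℝ)..1, μ * φb μ ^ 2) - ∫ μ in (-1:ℝ)..0, |μ| * (φ 0 μ) ^ 2 := by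
    have hI : IntervalIntegrable (fun μ => μ * φ 0 μ ^ 2) volume (-1) 1 :=
      (intervalIntegrable_iff_integrableOn_Ioc_of_le (by norm_num)).2 hsq
    have hneg : ∫ μ in (-1:ℝ)..0, |μ| * (φ 0 μ) ^ 2 = -∫ μ in (-1:ℝ)..0, μ * φ 0 μ ^ 2 := by
      rw [← intervalIntegral.integral_neg]
      refine intervalIntegral.integral_congr fun μ hμ => ?_
      rw [uIcc_of_le (by norm_num)] at hμ
      simp only [abs_of_nonpos hμ.2]
      ring
    have hpos : ∫ μ in (0:ℝ)..1, μ * φb μ ^ 2 = ∫ μ in (0:ℝ)..1, μ * φ 0 μ ^ 2 := by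
      rw [intervalIntegral.integral_of_le zero_le_one, intervalIntegral.integral_of_le zero_le_one]
      refine setIntegral_congr_fun measurableSet_Ioc fun μ hμ => ?_
      simp only [hφ0 μ hμ]
    rw [hneg, hpos, ← intervalIntegral.integral_of_le (by norm_num),
      ← intervalIntegral.integral_add_adjacent_intervals (b := 0)
        (hI.mono_set (by
          rw [uIcc_of_le (by norm_num), uIcc_of_le (by norm_num)]
          exact Icc_subset_Icc_right zero_le_one))
        (hI.mono_set (by
          rw [uIcc_of_le (by norm_num), uIcc_of_le (by norm_num)]
          exact Icc_subset_Icc_left (by norm_num)))]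
    ring
  rw [hsplit] at hest
  simp only [intervalIntegral.integral_of_le hB.le,
    intervalIntegral.integral_of_le (show (-1:ℝ) ≤ 1 by norm_num)]
  rw [← mul_le_mul_iff_right₀ hβ1]
  refine le_of_eq_of_le ?_ ((add_le_add_left hest
    (∫ μ in (-1:ℝ)..0, |μ| * (φ 0 μ) ^ 2)).trans_eq ?_)
  · field_simp
  · field_simp
    ring
end
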